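/- Criterion for cuspidal beaks: let f be a generalized timelike minimal surface with real Weierstrass data (g1, g2, ω1 du, ω2 dv) and let p be an ω-singular point with ω2(p) = 0. Then f is A-equivalent at p to the cuspidal beaks f_CBK(u,v) = (v, u^3 - uv^2, 3u^4 - 2u^2v^2) at the origin if and only if, at p: ω1 ≠ 0, (ω2)_v ≠ 0, g1 g2 = 1, and (g1)_u (g2)_v ≠ 0. -/

import Mathlib

noncomputable section

open Real Filter

abbrev R2 : Type := ℝ × ℝ
abbrev R3 : Type := ℝ × ℝ × ℝ

/-- The partial derivative in the `u`-direction. -/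
def pu (f : R2 → R3) (p : R2) : R3 := fderiv ℝ f p (1, 0)
/-- The partial derivative in the `v`-direction. -/
def pv (f : R2 → R3) (p : R2) : R3 := fderiv ℝ f p (0, 1)

/-- Determinant of three column vectors in ℝ³. -/
def det3 (a b c : R3) : ℝ :=
  a.1 * (b.2.1 * c.2.2 - b.2.2 * c.2.1)
  - b.1 * (a.2.1 * c.2.2 - a.2.2 * c.2.1)
  + c.1 * (a.2.1 * b.2.2 - a.2.2 * b.2.1)

/-- Determinant of two vectors in ℝ². -/
def det2 (a b : R2) : ℝ := a.1 * b.2 - a.2 * b.1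

/-- Euclidean inner product on ℝ³. -/
def ip3 (a b : R3) : ℝ := a.1 * b.1 + a.2.1 * b.2.1 + a.2.2 * b.2.2

/-- `f : ℝ² → ℝ³ = 𝕃³` is the generalized timelike minimal surface with real Weierstrass
data `(g1, g2, w1 du, w2 dv)`: it is smooth, its partial derivatives are
`f_u = (ω1/2)·(-1-g1², 1-g1², 2g1)` and `f_v = (ω2/2)·(1+g2², 1-g2², -2g2)`
(which encodes the Weierstrass-type integral representation), and it is an immersion
on an open dense set. -/
structure IsGTMS (f : R2 → R3) (g1 g2 w1 w2 : ℝ → ℝ) : Prop where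
  smooth_f : ContDiff ℝ (⊤ : ℕ∞) f
  smooth_g1 : ContDiff ℝ (⊤ : ℕ∞) g1
  smooth_g2 : ContDiff ℝ (⊤ : ℕ∞) g2
  smooth_w1 : ContDiff ℝ (⊤ : ℕ∞) w1
  smooth_w2 : ContDiff ℝ (⊤ : ℕ∞) w2
  deriv_u : ∀ p : R2, pu f p =
    ((-1 - g1 p.1 ^ 2) * w1 p.1 / 2, (1 - g1 p.1 ^ 2) * w1 p.1 / 2, g1 p.1 * w1 p.1)
  deriv_v : ∀ p : R2, pv f p =
    ((1 + g2 p.2 ^ 2) * w2 p.2 / 2, (1 - g2 p.2 ^ 2) * w2 p.2 / 2, -(g2 p.2 * w2 p.2))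
  dense_immersion : Dense {p : R2 | Function.Injective (fderiv ℝ f p)}

/-- `Φ` is a germ of diffeomorphism at `p`. -/
def IsLocalDiffeoAt {E F : Type*} [NormedAddCommGroup E] [NormedSpace ℝ E]
    [NormedAddCommGroup F] [NormedSpace ℝ F] (Φ : E → F) (p : E) : Prop :=
  ∃ (U : Set E) (V : Set F) (Φinv : F → E),
    IsOpen U ∧ p ∈ U ∧ IsOpen V ∧ Φ p ∈ V ∧
    ContDiffOn ℝ (⊤ : ℕ∞) Φ U ∧ ContDiffOn ℝ (⊤ : ℕ∞) Φinv V ∧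
    Set.MapsTo Φ U V ∧ Set.MapsTo Φinv V U ∧
    (∀ x ∈ U, Φinv (Φ x) = x) ∧ (∀ y ∈ V, Φ (Φinv y) = y)

/-- 𝒜-equivalence of the germ of `f1` at `p1` and the germ of `f2` at `p2`. -/
def AEquiv (f1 : R2 → R3) (p1 : R2) (f2 : R2 → R3) (p2 : R2) : Prop :=
  ∃ (Φ : R2 → R2) (Ψ : R3 → R3),
    IsLocalDiffeoAt Φ p1 ∧ Φ p1 = p2 ∧
    IsLocalDiffeoAt Ψ (f1 p1) ∧ Ψ (f1 p1) = f2 p2 ∧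
    ∀ᶠ x in nhds p1, Ψ (f1 x) = f2 (Φ x)

/-- The canonical unit normal of a generalized timelike minimal surface. -/
def gtmsNormal (g1 g2 : ℝ → ℝ) (p : R2) : R3 :=
  (Real.sqrt ((1 - g1 p.1 * g2 p.2) ^ 2 + 2 * (g1 p.1 + g2 p.2) ^ 2))⁻¹ •
    (g1 p.1 + g2 p.2, -g1 p.1 + g2 p.2, 1 + g1 p.1 * g2 p.2)

/-- The signed area density function `λ = det(f_u, f_v, n)`. -/
def areaDensity (f : R2 → R3) (g1 g2 : ℝ → ℝ) (p : R2) : ℝ :=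
  det3 (pu f p) (pv f p) (gtmsNormal g1 g2 p)

/-- `f` is a front at `p`: the Legendrian lift `(f, n)` is an immersion at `p`,
where `n` is the canonical unit normal. -/
def IsFrontAt (f : R2 → R3) (g1 g2 : ℝ → ℝ) (p : R2) : Prop :=
  Function.Injective (fderiv ℝ (fun q => (f q, gtmsNormal g1 g2 q)) p)

/-- The differential of `f` at `p` has rank one. -/
def RankOne (f : R2 → R3) (p : R2) : Prop :=
  LinearMap.rank (fderiv ℝ f p).toLinearMap = 1

/-- Directional derivative of `F` along the vector field `X`. -/
def vD (X : R2 → R2) (F : R2 → R3) : R2 → R3 := fun q => fderiv ℝ F q (X q)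

/-- `φ_i = g_i' / (g_i² ω_i)`. -/
def phiW (g w : ℝ → ℝ) : ℝ → ℝ := fun t => deriv g t / (g t ^ 2 * w t)
/-- `Φ_i = (g_i/g_i') φ_i'`. -/
def PhiW (g w : ℝ → ℝ) : ℝ → ℝ := fun t => g t / deriv g t * deriv (phiW g w) t

/-- standard cuspidal butterfly -/
def fCBF : R2 → R3 := fun q =>
  (q.1, 5 * q.2 ^ 4 + 2 * q.1 * q.2, 4 * q.2 ^ 5 + q.1 * q.2 ^ 2 - q.1 ^ 2)
/-- standard cuspidal S₁⁺ singularity -/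
def fCS1p : R2 → R3 := fun q => (q.1, q.2 ^ 2, q.2 ^ 3 * (q.1 ^ 2 + q.2 ^ 2))
/-- standard cuspidal S₁⁻ singularity -/
def fCS1m : R2 → R3 := fun q => (q.1, q.2 ^ 2, q.2 ^ 3 * (q.1 ^ 2 - q.2 ^ 2))
/-- standard cuspidal edge -/
def fCE : R2 → R3 := fun q => (q.1, q.2 ^ 2, q.2 ^ 3)
/-- standard (2,5)-cuspidal edge -/
def fCE25 : R2 → R3 := fun q => (q.1, q.2 ^ 2, q.2 ^ 5)
/-- standard cuspidal beaks -/
def fCBK : R2 → R3 := fun q =>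
  (q.2, q.1 ^ 3 - q.1 * q.2 ^ 2, 3 * q.1 ^ 4 - 2 * q.1 ^ 2 * q.2 ^ 2)
/-- standard cuspidal lips -/
def fCLP : R2 → R3 := fun q =>
  (q.2, q.1 ^ 3 + q.1 * q.2 ^ 2, 3 * q.1 ^ 4 + 2 * q.1 ^ 2 * q.2 ^ 2)
/-- standard D₄⁺ singularity -/
def fD4p : R2 → R3 := fun q =>
  (q.1 * q.2, q.1 ^ 2 + 3 * q.2 ^ 2, q.1 ^ 2 * q.2 + q.2 ^ 3)
/-- standard D₄⁻ singularity -/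
def fD4m : R2 → R3 := fun q =>
  (q.1 * q.2, q.1 ^ 2 - 3 * q.2 ^ 2, q.1 ^ 2 * q.2 - q.2 ^ 3)

open scoped ContDiff Topology FourierTransform SchwartzMap

section Germs

variable {E F G : Type*} [NormedAddCommGroup E] [NormedSpace ℝ E]
  [NormedAddCommGroup F] [NormedSpace ℝ F] [NormedAddCommGroup G] [NormedSpace ℝ G]

theorem exists_contDiff_eventuallyEq [FiniteDimensional ℝ E] {f : E → F} {s : Set E} {x₀ : E}
    (hs : s ∈ 𝓝 x₀) (hf : ContDiffOn ℝ ∞ f s) :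
    ∃ g : E → F, ContDiff ℝ ∞ g ∧ g =ᶠ[𝓝 x₀] f := by
  obtain ⟨r, hr, hrs⟩ := Metric.mem_nhds_iff.1 hs
  let φ : ContDiffBump x₀ := ⟨r / 4, r / 2, by positivity, by linarith⟩
  refine ⟨fun x => φ x • f x, contDiff_iff_contDiffAt.2 fun x => ?_, ?_⟩
  · by_cases hx : x ∈ Metric.ball x₀ r
    · exact φ.contDiff.contDiffAt.smul
        ((hf.mono hrs).contDiffAt (Metric.isOpen_ball.mem_nhds hx))
    · have h0 : (fun x => φ x • f x) =ᶠ[𝓝 x] fun _ => 0 := by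
        have : x ∈ (Metric.closedBall x₀ (r / 2))ᶜ := by
          simp only [Metric.mem_ball, not_lt, Set.mem_compl_iff, Metric.mem_closedBall,
            not_le] at hx ⊢
          linarith
        filter_upwards [Metric.isClosed_closedBall.isOpen_compl.mem_nhds this] with y hy
        rw [φ.zero_of_le_dist, zero_smul]
        simp only [Set.mem_compl_iff, Metric.mem_closedBall, not_le] at hy
        exact hy.le
      exact contDiffAt_const.congr_of_eventuallyEq h0
  · filter_upwards [φ.eventuallyEq_one] with x hx
    simp [hx]

/-- A globally smooth map which is a diffeomorphism germ at `x₀`, with a globally smooth germ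
inverse. -/
def IsDiffeoGerm (Φ : E → F) (x₀ : E) : Prop :=
  ContDiff ℝ ∞ Φ ∧ ∃ Θ : F → E, ContDiff ℝ ∞ Θ ∧ Θ (Φ x₀) = x₀ ∧
    (∀ᶠ x in 𝓝 x₀, Θ (Φ x) = x) ∧ ∀ᶠ y in 𝓝 (Φ x₀), Φ (Θ y) = y

theorem IsDiffeoGerm.comp {Ψ : F → G} {Φ : E → F} {x₀ : E} (hΨ : IsDiffeoGerm Ψ (Φ x₀))
    (hΦ : IsDiffeoGerm Φ x₀) : IsDiffeoGerm (fun x => Ψ (Φ x)) x₀ := by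
  obtain ⟨h1, Θ, h2, h3, h4, h5⟩ := hΦ
  obtain ⟨k1, Ξ, k2, k3, k4, k5⟩ := hΨ
  refine ⟨k1.comp h1, fun z => Θ (Ξ z), h2.comp k2, by simp [k3, h3], ?_, ?_⟩
  · filter_upwards [h4, h1.continuous.continuousAt.eventually k4] with x hx hx'
    rw [hx', hx]
  · have : Tendsto Ξ (𝓝 (Ψ (Φ x₀))) (𝓝 (Φ x₀)) := by
      simpa [k3] using (k2.continuous.continuousAt (x := Ψ (Φ x₀))).tendsto
    filter_upwards [k5, this.eventually h5] with x hx hx'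
    rw [hx', hx]

theorem IsDiffeoGerm.isLocalDiffeoAt {Φ : E → F} {x₀ : E} (hΦ : IsDiffeoGerm Φ x₀) :
    IsLocalDiffeoAt Φ x₀ := by
  obtain ⟨h1, Θ, h2, h3, h4, h5⟩ := hΦ
  obtain ⟨U, hU, hUo, hxU⟩ := eventually_nhds_iff.1 h4
  obtain ⟨V, hV, hVo, hxV⟩ := eventually_nhds_iff.1 h5
  refine ⟨U ∩ Φ ⁻¹' V, V ∩ Θ ⁻¹' U, Θ, hUo.inter (hVo.preimage h1.continuous), ⟨hxU, hxV⟩,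
    hVo.inter (hUo.preimage h2.continuous), ⟨hxV, by simpa [h3] using hxU⟩, h1.contDiffOn,
    h2.contDiffOn, ?_, ?_, fun x hx => hU x hx.1, fun y hy => hV y hy.1⟩
  · rintro x ⟨hx, hx'⟩
    exact ⟨hx', by simpa [hU x hx] using hx⟩
  · rintro y ⟨hy, hy'⟩
    exact ⟨hy', by simpa [hV y hy] using hy⟩

/-- Inverse function theorem for germs. -/
theorem isDiffeoGerm_of_equiv [FiniteDimensional ℝ E] [FiniteDimensional ℝ F] {Φ : E → F} {x₀ : E}
    (hΦ : ContDiff ℝ ∞ Φ) (L : E ≃L[ℝ] F) (hL : HasFDerivAt Φ (L : E →L[ℝ] F) x₀) :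
    IsDiffeoGerm Φ x₀ := by
  have : CompleteSpace E := FiniteDimensional.complete ℝ E
  have : CompleteSpace F := FiniteDimensional.complete ℝ F
  have hc : ContDiffAt ℝ ∞ Φ x₀ := hΦ.contDiffAt
  have hn : (∞ : WithTop ℕ∞) ≠ 0 := by simp
  let e := hc.toOpenPartialHomeomorph Φ hL hn
  have he : ∀ x, e x = Φ x := fun _ => rfl
  have hx₀ : x₀ ∈ e.source := hc.mem_toOpenPartialHomeomorph_source hL hn
  have hy₀ : Φ x₀ ∈ e.target := e.map_source hx₀
  have hsymm : e.symm (Φ x₀) = x₀ := e.left_inv hx₀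
  -- points of the source with invertible derivative
  have hinv : ∀ᶠ x in 𝓝 x₀, fderiv ℝ Φ x ∈ Set.range ((↑) : (E ≃L[ℝ] F) → E →L[ℝ] F) := by
    have h1 : Continuous (fderiv ℝ Φ) := hΦ.continuous_fderiv hn
    refine h1.continuousAt.eventually (ContinuousLinearEquiv.isOpen.mem_nhds ?_)
    exact ⟨L, hL.fderiv.symm⟩
  have hsc : ContinuousAt e.symm (Φ x₀) := e.continuousAt_symm hy₀
  have hev : ∀ᶠ y in 𝓝 (Φ x₀), fderiv ℝ Φ (e.symm y) ∈
      Set.range ((↑) : (E ≃L[ℝ] F) → E →L[ℝ] F) := by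
    have := hsc.tendsto
    rw [hsymm] at this
    exact this.eventually hinv
  obtain ⟨V, hVs, hVo, hV₀⟩ := eventually_nhds_iff.1
    (hev.and (e.open_target.mem_nhds hy₀))
  have hcd : ContDiffOn ℝ ∞ e.symm V := by
    intro y hy
    obtain ⟨⟨L', hL'⟩, hyt⟩ := hVs y hy
    refine (e.contDiffAt_symm hyt (f₀' := L') ?_ hΦ.contDiffAt).contDiffWithinAt
    rw [hL']
    exact (hΦ.differentiable hn _).hasFDerivAt
  obtain ⟨Θ, hΘ, hΘe⟩ := exists_contDiff_eventuallyEq (hVo.mem_nhds hV₀) hcd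
  refine ⟨hΦ, Θ, hΘ, by rw [hΘe.self_of_nhds, hsymm], ?_, ?_⟩
  · filter_upwards [hΦ.continuous.continuousAt.eventually hΘe, e.open_source.mem_nhds hx₀]
      with x hx hx'
    rw [hx]; exact e.left_inv hx'
  · filter_upwards [hΘe, e.open_target.mem_nhds hy₀] with y hy hy'
    rw [hy]; exact e.right_inv hy'

theorem isDiffeoGerm_of_injective [FiniteDimensional ℝ E] {Φ : E → E} {x₀ : E}
    (hΦ : ContDiff ℝ ∞ Φ) (hinj : ∀ v, fderiv ℝ Φ x₀ v = 0 → v = 0) :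
    IsDiffeoGerm Φ x₀ := by
  have hi : Function.Injective (fderiv ℝ Φ x₀).toLinearMap :=
    (injective_iff_map_eq_zero _).2 hinj
  let L : E ≃L[ℝ] E := (LinearEquiv.ofInjectiveEndo _ hi).toContinuousLinearEquiv
  have hL : (L : E →L[ℝ] E) = fderiv ℝ Φ x₀ := by
    ext v; rfl
  refine isDiffeoGerm_of_equiv hΦ L ?_
  rw [hL]
  exact (hΦ.differentiable (by simp) _).hasFDerivAt

end Germs

section ParametricIntegral

open MeasureTheory

variable {E A : Type} [NormedAddCommGroup E] [NormedSpace ℝ E]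
  [NormedAddCommGroup A] [NormedSpace ℝ A]

theorem contDiff_fderiv_fst {G : Type} [NormedAddCommGroup G] [NormedSpace ℝ G]
    {F : E × A → G} (hF : ContDiff ℝ ∞ F) :
    ContDiff ℝ ∞ fun q : E × A => fderiv ℝ (fun x => F (x, q.2)) q.1 :=
  ContDiff.fderiv (f := fun (q : E × A) x => F (x, q.2)) (m := ∞)
    (hF.comp (contDiff_snd.prodMk (contDiff_snd.comp contDiff_fst))) contDiff_fst (by simp)

theorem exists_bound_iteratedFDeriv {K : Set (E × A)} (hK : IsCompact K) (k : ℕ) :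
    ∀ {G : Type} [NormedAddCommGroup G] [NormedSpace ℝ G] {F : E × A → G},
      ContDiff ℝ ∞ F → ∃ C, ∀ q ∈ K, ‖iteratedFDeriv ℝ k (fun x => F (x, q.2)) q.1‖ ≤ C := by
  induction k with
  | zero =>
    intro G _ _ F hF
    obtain ⟨C, hC⟩ := hK.exists_bound_of_continuousOn hF.continuous.continuousOn
    exact ⟨C, fun q hq => by simpa using hC q hq⟩
  | succ k ih =>
    intro G _ _ F hF
    obtain ⟨C, hC⟩ := ih (contDiff_fderiv_fst hF)
    refine ⟨C, fun q hq => ?_⟩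
    rw [← norm_iteratedFDeriv_fderiv]
    exact hC q hq

variable [MeasurableSpace A] [BorelSpace A] [SecondCountableTopology A]

theorem hasFDerivAt_integral_aux {G : Type} [NormedAddCommGroup G] [NormedSpace ℝ G]
    (μ : Measure A) {F : E × A → G} (hF : ContDiff ℝ ∞ F)
    (hb : ∀ (k : ℕ) (x₀ : E), ∃ b : A → ℝ, Integrable b μ ∧ ∃ s ∈ 𝓝 x₀, ∀ᵐ a ∂μ, ∀ x ∈ s,
      ‖iteratedFDeriv ℝ k (fun x => F (x, a)) x‖ ≤ b a) (x₀ : E) :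
    HasFDerivAt (fun x => ∫ a, F (x, a) ∂μ)
      (∫ a, fderiv ℝ (fun x => F (x, a)) x₀ ∂μ) x₀ := by
  obtain ⟨b, hbi, s, hs, hbs⟩ := hb 1 x₀
  obtain ⟨b', hbi', s', hs', hbs'⟩ := hb 0 x₀
  have hcont : ∀ x, AEStronglyMeasurable (fun a => F (x, a)) μ := fun x =>
    (hF.continuous.comp (by fun_prop : Continuous fun a : A => (x, a))).aestronglyMeasurable
  refine hasFDerivAt_integral_of_dominated_of_fderiv_le
    (F := fun x a => F (x, a)) (F' := fun x a => fderiv ℝ (fun x => F (x, a)) x)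
    (bound := b) hs (Eventually.of_forall hcont) ?_ ?_ ?_ hbi ?_
  · refine hbi'.mono' (hcont x₀) ?_
    filter_upwards [hbs'] with a ha
    simpa using ha x₀ (mem_of_mem_nhds hs')
  · exact ((contDiff_fderiv_fst hF).continuous.comp
      (by fun_prop : Continuous fun a : A => (x₀, a))).aestronglyMeasurable
  · filter_upwards [hbs] with a ha x hx
    have := ha x hx
    rwa [← zero_add 1, ← norm_iteratedFDeriv_fderiv, norm_iteratedFDeriv_zero] at this
  · refine Eventually.of_forall fun a x _ => ?_
    have : ContDiff ℝ ∞ fun x => F (x, a) := hF.comp (contDiff_id.prodMk contDiff_const)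
    exact (this.differentiable (by simp) x).hasFDerivAt

/-- Smoothness of integrals depending on a parameter, under domination of all derivatives. -/
theorem contDiff_integral_of_dominated (μ : Measure A) {G : Type} [NormedAddCommGroup G]
    [NormedSpace ℝ G] {F : E × A → G} (hF : ContDiff ℝ ∞ F)
    (hb : ∀ (k : ℕ) (x₀ : E), ∃ b : A → ℝ, Integrable b μ ∧ ∃ s ∈ 𝓝 x₀, ∀ᵐ a ∂μ, ∀ x ∈ s,
      ‖iteratedFDeriv ℝ k (fun x => F (x, a)) x‖ ≤ b a) :
    ContDiff ℝ ∞ fun x => ∫ a, F (x, a) ∂μ := by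
  rw [contDiff_infty]
  intro n
  induction n generalizing G with
  | zero =>
    refine contDiff_zero.2 (continuous_iff_continuousAt.2 fun x => ?_)
    exact (hasFDerivAt_integral_aux μ hF hb x).continuousAt
  | succ n ih =>
    push_cast
    refine contDiff_succ_iff_hasFDerivAt.2
      ⟨_, ih (contDiff_fderiv_fst hF) ?_, hasFDerivAt_integral_aux μ hF hb⟩
    intro k x₀
    obtain ⟨b, hbi, s, hs, h⟩ := hb (k + 1) x₀
    refine ⟨b, hbi, s, hs, ?_⟩
    filter_upwards [h] with a ha x hx
    have := ha x hx
    rwa [← norm_iteratedFDeriv_fderiv] at this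

theorem contDiff_integral_Icc [FiniteDimensional ℝ E] {F : E × ℝ → ℝ} (hF : ContDiff ℝ ∞ F) :
    ContDiff ℝ ∞ fun x => ∫ t in (0 : ℝ)..1, F (x, t) := by
  simp_rw [intervalIntegral.integral_of_le zero_le_one]
  refine contDiff_integral_of_dominated (volume.restrict (Set.Ioc (0 : ℝ) 1)) hF fun k x₀ => ?_
  have hp : ProperSpace E := FiniteDimensional.proper ℝ E
  obtain ⟨C, hC⟩ := exists_bound_iteratedFDeriv
    ((isCompact_closedBall x₀ 1).prod (isCompact_Icc (a := (0 : ℝ)) (b := 1))) k hF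
  refine ⟨fun _ => C, integrable_const C, _, Metric.closedBall_mem_nhds x₀ one_pos, ?_⟩
  filter_upwards [ae_restrict_mem measurableSet_Ioc] with a ha x hx
  exact hC (x, a) ⟨hx, ha.1.le, ha.2⟩

end ParametricIntegral

section Hadamard

variable {E : Type} [NormedAddCommGroup E] [NormedSpace ℝ E]

/-- Hadamard's lemma with parameters. -/
theorem hadamard_lemma [FiniteDimensional ℝ E] {F : E × ℝ → ℝ} (hF : ContDiff ℝ ∞ F) :
    ∃ H : E × ℝ → ℝ, ContDiff ℝ ∞ H ∧ (∀ x y, F (x, y) = F (x, 0) + y * H (x, y)) ∧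
      ∀ x, H (x, 0) = fderiv ℝ F (x, 0) (0, 1) := by
  have hd : ContDiff ℝ ∞ fun q : E × ℝ => fderiv ℝ F q (0, 1) :=
    (hF.fderiv_right (m := ∞) (by simp)).clm_apply contDiff_const
  refine ⟨fun q => ∫ t in (0 : ℝ)..1, fderiv ℝ F (q.1, t * q.2) (0, 1), ?_, fun x y => ?_,
    fun x => by simp⟩
  · refine contDiff_integral_Icc
      (F := fun p : (E × ℝ) × ℝ => fderiv ℝ F (p.1.1, p.2 * p.1.2) (0, 1)) ?_
    exact hd.comp (by fun_prop : ContDiff ℝ ∞ fun p : (E × ℝ) × ℝ => (p.1.1, p.2 * p.1.2))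
  · have hder : ∀ t : ℝ, HasDerivAt (fun t : ℝ => F (x, t * y))
        (y * fderiv ℝ F (x, t * y) (0, 1)) t := by
      intro t
      have h1 : HasDerivAt (fun t : ℝ => (x, t * y)) ((0 : E), y) t :=
        (hasDerivAt_const t x).prodMk (by simpa using (hasDerivAt_id t).mul_const y)
      have h2 := ((hF.differentiable (by simp) (x, t * y)).hasFDerivAt).comp_hasDerivAt t h1
      refine h2.congr_deriv ?_
      have h3 : ((0 : E), y) = y • ((0 : E), (1 : ℝ)) := by simp
      rw [h3, map_smul, smul_eq_mul]
    have := intervalIntegral.integral_eq_sub_of_hasDerivAt (a := 0) (b := 1)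
      (fun t _ => hder t) (Continuous.intervalIntegrable (by
        have := hd.continuous
        fun_prop) _ _)
    rw [intervalIntegral.integral_const_mul] at this
    simp only [one_mul, zero_mul] at this
    simp only
    linarith

/-- A primitive of `r ^ n * φ r` vanishing at `0` is `r ^ (n + 1)` times a smooth function. -/
theorem exists_eq_pow_mul {B φ : ℝ → ℝ} (hφ : ContDiff ℝ ∞ φ) (n : ℕ) (hB0 : B 0 = 0)
    (hB : ∀ᶠ r in 𝓝 (0 : ℝ), HasDerivAt B (r ^ n * φ r) r) :
    ∃ m : ℝ → ℝ, ContDiff ℝ ∞ m ∧ (∀ᶠ r in 𝓝 (0 : ℝ), B r = r ^ (n + 1) * m r) ∧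
      m 0 = φ 0 / (n + 1) := by
  refine ⟨fun r => ∫ t in (0 : ℝ)..1, t ^ n * φ (t * r), ?_, ?_, ?_⟩
  · refine contDiff_integral_Icc (F := fun p : ℝ × ℝ => p.2 ^ n * φ (p.2 * p.1)) ?_
    fun_prop
  · obtain ⟨δ, hδ, h⟩ := Metric.eventually_nhds_iff.1 hB
    refine Metric.eventually_nhds_iff.2 ⟨δ, hδ, fun r hr => ?_⟩
    have hder : ∀ t ∈ Set.uIcc (0 : ℝ) 1, HasDerivAt (fun t : ℝ => B (t * r))
        (r ^ (n + 1) * (t ^ n * φ (t * r))) t := by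
      intro t ht
      rw [Set.uIcc_of_le zero_le_one] at ht
      have hlt : dist (t * r) 0 < δ := by
        rw [dist_zero_right, norm_mul] at *
        calc ‖t‖ * ‖r‖ ≤ 1 * ‖r‖ := by
              gcongr
              rw [Real.norm_eq_abs, abs_le]; constructor <;> linarith [ht.1, ht.2]
          _ < δ := by simpa using hr
      have h1 : HasDerivAt (fun t : ℝ => t * r) r t := by
        simpa using (hasDerivAt_id t).mul_const r
      refine ((h hlt).comp t h1).congr_deriv ?_
      rw [mul_pow]; ring
    have := intervalIntegral.integral_eq_sub_of_hasDerivAt hder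
      (Continuous.intervalIntegrable (by have := hφ.continuous; fun_prop) _ _)
    rw [intervalIntegral.integral_const_mul] at this
    simp only [one_mul, zero_mul, hB0, sub_zero] at this
    exact this.symm
  · simp only [mul_zero]
    rw [intervalIntegral.integral_mul_const, integral_pow]
    simp
    ring

end Hadamard

section CosSqrt

open FormalMultilinearSeries

def cosSqrtCoeff (n : ℕ) : ℝ := (-1) ^ n / (2 * n).factorial

/-- The entire function `c` with `c (w ^ 2) = cos w`. -/
def cosSqrt (x : ℝ) : ℝ := ofScalarsSum (𝕜 := ℝ) (E := ℝ) cosSqrtCoeff x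

theorem contDiff_cosSqrt : ContDiff ℝ ∞ cosSqrt := by
  have hrad : (ofScalars ℝ (𝕜 := ℝ) cosSqrtCoeff).radius = ⊤ := by
    refine ofScalars_radius_eq_top_of_tendsto _ _ (Eventually.of_forall fun n => ?_) ?_
    · unfold cosSqrtCoeff; positivity
    · have h : ∀ n : ℕ, ‖cosSqrtCoeff n.succ‖ / ‖cosSqrtCoeff n‖
          = 1 / (((2 * n + 2 : ℕ) : ℝ) * ((2 * n + 1 : ℕ) : ℝ)) := by
        intro n
        simp only [cosSqrtCoeff, norm_div, norm_pow, norm_neg, norm_one, one_pow,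
          Nat.succ_eq_add_one, mul_add, mul_one]
        rw [show (2 * n + 2).factorial = (2 * n + 2) * ((2 * n + 1) * (2 * n).factorial) from by
          rw [Nat.factorial_succ, Nat.factorial_succ]]
        have : ((2 * n).factorial : ℝ) ≠ 0 := by positivity
        simp only [RCLike.norm_natCast]
        push_cast
        field_simp
      simp_rw [h]
      refine squeeze_zero (fun n => by positivity) (fun n => ?_)
        (tendsto_one_div_add_atTop_nhds_zero_nat (𝕜 := ℝ))
      push_cast
      gcongr
      nlinarith [(Nat.cast_nonneg n : (0 : ℝ) ≤ n)]
  have hp := (ofScalars ℝ (𝕜 := ℝ) cosSqrtCoeff).hasFPowerSeriesOnBall (by rw [hrad]; simp)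
  refine contDiff_iff_contDiffAt.2 fun x => ?_
  have := hp.analyticAt_of_mem (y := x) (by simp [hrad])
  exact this.contDiffAt

theorem cosSqrt_sq (w : ℝ) : cosSqrt (w ^ 2) = cos w := by
  unfold cosSqrt
  rw [ofScalarsSum_eq_tsum]
  rw [← (Real.hasSum_cos w).tsum_eq]
  refine tsum_congr fun n => ?_
  simp only [cosSqrtCoeff, smul_eq_mul, ← pow_mul]
  ring

theorem two_mul_deriv_of_sq_eq_cos {C : ℝ → ℝ} (hC : ContDiff ℝ ∞ C)
    (h : ∀ w, C (w ^ 2) = cos w) (w : ℝ) : 2 * w * deriv C (w ^ 2) = -sin w := by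
  have h1 : HasDerivAt (fun w : ℝ => C (w ^ 2)) (deriv C (w ^ 2) * (2 * w)) w := by
    have := ((hC.differentiable (by simp) (w ^ 2)).hasDerivAt).comp w (hasDerivAt_pow 2 w)
    exact this.congr_deriv (by simp)
  rw [funext h] at h1
  linarith [h1.unique (hasDerivAt_cos w)]

theorem cosSqrt_ode {x : ℝ} (hx : 0 < x) (n : ℕ) :
    4 * x * iteratedDeriv (n + 2) cosSqrt x + (4 * n + 2) * iteratedDeriv (n + 1) cosSqrt x
      + iteratedDeriv n cosSqrt x = 0 := by
  have hd : ∀ (n : ℕ) (x : ℝ),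
      HasDerivAt (iteratedDeriv n cosSqrt) (iteratedDeriv (n + 1) cosSqrt x) x := by
    intro n x
    rw [iteratedDeriv_succ]
    exact ((contDiff_cosSqrt.differentiable_iteratedDeriv n
      (by exact_mod_cast WithTop.coe_lt_top n)) x).hasDerivAt
  induction n generalizing x with
  | zero =>
    obtain ⟨w, hw, rfl⟩ : ∃ w : ℝ, 0 < w ∧ w ^ 2 = x :=
      ⟨√x, Real.sqrt_pos.2 hx, Real.sq_sqrt hx.le⟩
    have e1 : (fun w : ℝ => 2 * w * iteratedDeriv 1 cosSqrt (w ^ 2)) = fun w => -sin w := by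
      funext w
      rw [iteratedDeriv_one]
      exact two_mul_deriv_of_sq_eq_cos contDiff_cosSqrt cosSqrt_sq w
    have h1 : HasDerivAt (fun w : ℝ => 2 * w * iteratedDeriv 1 cosSqrt (w ^ 2))
        (2 * iteratedDeriv 1 cosSqrt (w ^ 2)
          + 2 * w * (iteratedDeriv 2 cosSqrt (w ^ 2) * (2 * w))) w := by
      have h2 := (hd 1 (w ^ 2)).comp w (hasDerivAt_pow 2 w)
      have h3 : HasDerivAt (fun w : ℝ => 2 * w) 2 w := by
        simpa using (hasDerivAt_id w).const_mul 2
      refine (h3.mul h2).congr_deriv ?_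
      simp
    rw [e1] at h1
    have := h1.unique (hasDerivAt_sin w).neg
    rw [← cosSqrt_sq w] at this
    simp only [zero_add, iteratedDeriv_zero, Nat.cast_zero]
    linarith
  | succ n ih =>
    have h0 : HasDerivAt (fun y => 4 * y * iteratedDeriv (n + 2) cosSqrt y
        + (4 * n + 2) * iteratedDeriv (n + 1) cosSqrt y + iteratedDeriv n cosSqrt y)
        (4 * iteratedDeriv (n + 2) cosSqrt x + 4 * x * iteratedDeriv (n + 3) cosSqrt x
          + (4 * n + 2) * iteratedDeriv (n + 2) cosSqrt x + iteratedDeriv (n + 1) cosSqrt x) x := by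
      have h3 : HasDerivAt (fun w : ℝ => 4 * w) 4 x := by
        simpa using (hasDerivAt_id x).const_mul 4
      exact ((h3.mul (hd (n + 2) x)).add ((hd (n + 1) x).const_mul _)).add (hd n x)
    have h1 : (fun y => 4 * y * iteratedDeriv (n + 2) cosSqrt y
        + (4 * n + 2) * iteratedDeriv (n + 1) cosSqrt y + iteratedDeriv n cosSqrt y)
        =ᶠ[𝓝 x] fun _ => 0 := by
      filter_upwards [lt_mem_nhds hx] with y hy using ih hy
    have := h0.unique ((hasDerivAt_const x (0 : ℝ)).congr_of_eventuallyEq h1)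
    push_cast
    linarith

theorem exists_bound_iteratedDeriv_cosSqrt (n : ℕ) :
    ∃ M, ∀ x, 1 ≤ x → |iteratedDeriv n cosSqrt x| ≤ M := by
  induction n using Nat.twoStepInduction with
  | zero =>
    refine ⟨1, fun x hx => ?_⟩
    rw [iteratedDeriv_zero, ← Real.sq_sqrt (zero_le_one.trans hx), cosSqrt_sq]
    exact abs_cos_le_one _
  | one =>
    refine ⟨1, fun x hx => ?_⟩
    have h := two_mul_deriv_of_sq_eq_cos contDiff_cosSqrt cosSqrt_sq (√x)
    rw [Real.sq_sqrt (zero_le_one.trans hx)] at h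
    have h1 : 1 ≤ √x := Real.one_le_sqrt.2 hx
    have h2 : |2 * √x * deriv cosSqrt x| ≤ 1 := by
      rw [h, abs_neg]; exact abs_sin_le_one _
    rw [abs_mul, abs_of_pos (by positivity : 0 < 2 * √x)] at h2
    rw [iteratedDeriv_one]
    nlinarith [abs_nonneg (deriv cosSqrt x)]
  | more n ih1 ih2 =>
    obtain ⟨M1, h1⟩ := ih1
    obtain ⟨M2, h2⟩ := ih2
    refine ⟨(4 * n + 2) * M2 + M1, fun x hx => ?_⟩
    have h := cosSqrt_ode (zero_lt_one.trans_le hx) n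
    have a1 := h1 x hx
    have a2 := h2 x hx
    have h3 : 4 * x * |iteratedDeriv (n + 2) cosSqrt x| ≤ (4 * n + 2) * M2 + M1 := by
      rw [← abs_of_pos (by positivity : 0 < 4 * x), ← abs_mul,
        show 4 * x * iteratedDeriv (n + 2) cosSqrt x =
          -((4 * n + 2) * iteratedDeriv (n + 1) cosSqrt x + iteratedDeriv n cosSqrt x) by linarith,
        abs_neg]
      refine (abs_add_le _ _).trans (add_le_add ?_ a1)
      rw [abs_mul, abs_of_pos (by positivity)]
      gcongr
    nlinarith [abs_nonneg (iteratedDeriv (n + 2) cosSqrt x)]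

/-- A function of temperate growth with `C (w ^ 2) = cos w`. -/
theorem exists_temperate_sq_eq_cos : ∃ C : ℝ → ℝ, C.HasTemperateGrowth ∧
    (deriv C).HasTemperateGrowth ∧ ∀ w, C (w ^ 2) = cos w := by
  let C : ℝ → ℝ := fun x => Real.smoothTransition (x + 1) * cosSqrt x
  have hC : ContDiff ℝ ∞ C :=
    (Real.smoothTransition.contDiff.comp (by fun_prop)).mul contDiff_cosSqrt
  have key : ∀ n : ℕ, ∃ M, ∀ x, |iteratedDeriv n C x| ≤ M := by
    intro n
    obtain ⟨M1, h1⟩ := exists_bound_iteratedDeriv_cosSqrt n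
    obtain ⟨M2, h2⟩ := (isCompact_Icc (a := (-1 : ℝ)) (b := 1)).exists_bound_of_continuousOn
      (hC.continuous_iteratedDeriv n (by exact_mod_cast le_top)).continuousOn
    refine ⟨|M1| + |M2|, fun x => ?_⟩
    rcases lt_or_ge x (-1) with hx | hx
    · have : C =ᶠ[𝓝 x] fun _ => 0 := by
        filter_upwards [gt_mem_nhds hx] with y hy
        simp only [C]
        rw [Real.smoothTransition.zero_of_nonpos (by linarith), zero_mul]
      rw [this.iteratedDeriv_eq]
      simp only [iteratedDeriv_const]
      split_ifs <;> simp <;> positivity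
    rcases le_or_gt x 1 with hx' | hx'
    · refine (h2 x ⟨hx, hx'⟩).trans ?_
      linarith [abs_nonneg M1, le_abs_self M2]
    · have : C =ᶠ[𝓝 x] cosSqrt := by
        filter_upwards [lt_mem_nhds hx'] with y hy
        simp only [C]
        rw [Real.smoothTransition.one_of_one_le (by linarith), one_mul]
      rw [this.iteratedDeriv_eq]
      refine (h1 x hx'.le).trans ?_
      linarith [abs_nonneg M2, le_abs_self M1]
  refine ⟨C, ⟨hC, fun n => ?_⟩, ⟨?_, fun n => ?_⟩, fun w => ?_⟩
  · obtain ⟨M, hM⟩ := key n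
    refine ⟨0, M, fun x => ?_⟩
    rw [norm_iteratedFDeriv_eq_norm_iteratedDeriv]
    simpa using hM x
  · exact (contDiff_infty_iff_deriv.1 hC).2
  · obtain ⟨M, hM⟩ := key (n + 1)
    refine ⟨0, M, fun x => ?_⟩
    rw [norm_iteratedFDeriv_eq_norm_iteratedDeriv, ← iteratedDeriv_succ']
    simpa using hM x
  · simp only [C]
    rw [Real.smoothTransition.one_of_one_le (by nlinarith [sq_nonneg w]), one_mul, cosSqrt_sq]

end CosSqrt

section EvenOdd

open MeasureTheory

theorem hasTemperateGrowth_cexp :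
    Function.HasTemperateGrowth fun s : ℝ => Complex.exp (s * Complex.I) := by
  obtain ⟨C, h1, h2, h3⟩ := exists_temperate_sq_eq_cos
  have hid : Function.HasTemperateGrowth fun s : ℝ => s := .id'
  have hsq : Function.HasTemperateGrowth fun s : ℝ => s ^ 2 := by
    simp only [sq]; exact hid.mul hid
  have hc : (fun s : ℝ => Complex.exp (s * Complex.I)) = fun s : ℝ =>
      ((C (s ^ 2) : ℝ) : ℂ) + ((-2 * s * deriv C (s ^ 2) : ℝ) : ℂ) * Complex.I := by
    funext s
    rw [Complex.exp_mul_I, ← Complex.ofReal_cos, ← Complex.ofReal_sin, h3]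
    have := two_mul_deriv_of_sq_eq_cos h1.1 h3 s
    rw [show -2 * s * deriv C (s ^ 2) = sin s by linarith]
  rw [hc]
  have a1 := Function.Complex.hasTemperateGrowth_ofReal.comp (h1.comp hsq)
  have a2 := Function.Complex.hasTemperateGrowth_ofReal.comp
    (((Function.HasTemperateGrowth.const (-2 : ℝ)).mul hid).mul (h2.comp hsq))
  exact a1.add (a2.mul (.const Complex.I))

/-- Integrals of a Schwartz function against a function of temperate growth depend smoothly on
parameters. -/
theorem contDiff_integral_schwartz {E A : Type} [NormedAddCommGroup E] [NormedSpace ℝ E]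
    [NormedAddCommGroup A] [InnerProductSpace ℝ A] [FiniteDimensional ℝ A] [MeasurableSpace A]
    [BorelSpace A] (φ : 𝓢(A, ℂ)) {M : E × A → ℂ} (hM : M.HasTemperateGrowth) :
    ContDiff ℝ ∞ fun x => ∫ ξ, φ ξ * M (x, ξ) := by
  have hsm : ∀ ξ : A, ContDiff ℝ ∞ fun x => M (x, ξ) := fun ξ =>
    hM.1.comp (contDiff_id.prodMk contDiff_const)
  refine contDiff_integral_of_dominated (volume : Measure A)
    (F := fun q : E × A => φ q.2 * M q) ((φ.smooth ⊤ |>.comp contDiff_snd).mul hM.1) ?_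
  intro k x₀
  obtain ⟨m, C, hC⟩ := hM.2 k
  have hbd : ∀ x ξ, ‖iteratedFDeriv ℝ k (fun x => M (x, ξ)) x‖ ≤ C * (1 + ‖(x, ξ)‖) ^ m := by
    intro x ξ
    have hsh : ContDiff ℝ ∞ fun q : E × A => M (q + (0, ξ)) :=
      hM.1.comp (contDiff_id.add contDiff_const)
    have h1 : (fun x => M (x, ξ)) =
        (fun q : E × A => M (q + (0, ξ))) ∘ ContinuousLinearMap.inl ℝ E A := by
      funext x; simp
    rw [h1, ContinuousLinearMap.iteratedFDeriv_comp_right _ hsh _ (by exact_mod_cast le_top),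
      iteratedFDeriv_comp_add_right]
    refine (ContinuousMultilinearMap.norm_compContinuousLinearMap_le _ _).trans ?_
    have h2 : ∏ _i : Fin k, ‖ContinuousLinearMap.inl ℝ E A‖ ≤ 1 :=
      Finset.prod_le_one (fun _ _ => norm_nonneg (ContinuousLinearMap.inl ℝ E A))
        (fun _ _ => ContinuousLinearMap.norm_inl_le_one ℝ E A)
    refine (mul_le_of_le_one_right (norm_nonneg _) h2).trans ?_
    simpa using hC (x, ξ)
  have hC0 : 0 ≤ C := by
    have := (norm_nonneg _).trans (hC 0)
    simpa using this
  refine ⟨fun ξ => C * ((2 + ‖x₀‖) ^ m * (2 ^ (m - 1) * (‖φ ξ‖ + ‖ξ‖ ^ m * ‖φ ξ‖))), ?_,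
    _, Metric.closedBall_mem_nhds x₀ one_pos, Eventually.of_forall fun ξ x hx => ?_⟩
  · refine Integrable.const_mul (Integrable.const_mul (Integrable.const_mul ?_ _) _) _
    exact (φ.integrable.norm).add (φ.integrable_pow_mul volume m)
  · have h1 : (fun x => φ ξ * M (x, ξ)) = φ ξ • fun x => M (x, ξ) := by
      funext x; simp
    have h2 : ‖x‖ ≤ ‖x₀‖ + 1 := by
      have := norm_sub_norm_le x x₀
      rw [Metric.mem_closedBall, dist_eq_norm] at hx
      linarith
    have h3 : 1 + ‖(x, ξ)‖ ≤ (2 + ‖x₀‖) * (1 + ‖ξ‖) := by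
      rw [Prod.norm_mk]
      have := norm_nonneg ξ
      have := norm_nonneg x₀
      rcases max_cases ‖x‖ ‖ξ‖ with h | h <;> nlinarith
    have h4 : (1 + ‖ξ‖) ^ m ≤ 2 ^ (m - 1) * (1 + ‖ξ‖ ^ m) := by
      simpa using add_pow_le zero_le_one (norm_nonneg ξ) m
    dsimp only
    rw [h1, iteratedFDeriv_const_smul_apply
      ((hsm ξ).of_le (by exact_mod_cast le_top)).contDiffAt, norm_smul]
    calc ‖φ ξ‖ * ‖iteratedFDeriv ℝ k (fun x => M (x, ξ)) x‖
        ≤ ‖φ ξ‖ * (C * ((2 + ‖x₀‖) * (1 + ‖ξ‖)) ^ m) := by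
          gcongr
          exact (hbd x ξ).trans (by gcongr)
      _ = ‖φ ξ‖ * (C * ((2 + ‖x₀‖) ^ m * (1 + ‖ξ‖) ^ m)) := by rw [mul_pow]
      _ ≤ ‖φ ξ‖ * (C * ((2 + ‖x₀‖) ^ m * (2 ^ (m - 1) * (1 + ‖ξ‖ ^ m)))) := by gcongr
      _ = _ := by ring

/-- Smooth functions are `F₀ (x, y, v²) + v F₁ (x, y, v²)` near the origin. -/
theorem exists_even_odd {F : ℝ × ℝ × ℝ → ℝ} (hF : ContDiff ℝ ∞ F) :
    ∃ F₀ F₁ : ℝ × ℝ × ℝ → ℝ, ContDiff ℝ ∞ F₀ ∧ ContDiff ℝ ∞ F₁ ∧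
      ∀ᶠ q in 𝓝 (0 : ℝ × ℝ × ℝ),
        F q = F₀ (q.1, q.2.1, q.2.2 ^ 2) + q.2.2 * F₁ (q.1, q.2.1, q.2.2 ^ 2) := by
  obtain ⟨C, h1, h2, h3⟩ := exists_temperate_sq_eq_cos
  let χ : ContDiffBump (0 : EuclideanSpace ℝ (Fin 3)) := ⟨1, 2, one_pos, one_lt_two⟩
  let f : EuclideanSpace ℝ (Fin 3) → ℂ := fun w => ((χ w * F (w 0, w 1, w 2) : ℝ) : ℂ)
  have hfs : ContDiff ℝ ∞ f := by
    refine Complex.ofRealCLM.contDiff.comp (χ.contDiff.mul (hF.comp ?_))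
    fun_prop
  have hfc : HasCompactSupport f := by
    refine χ.hasCompactSupport.mono fun w hw => ?_
    simp only [f, Function.mem_support] at hw ⊢
    intro h; exact hw (by simp [h])
  let φ : 𝓢(EuclideanSpace ℝ (Fin 3), ℂ) := 𝓕 (hfc.toSchwartzMap hfs)
  have hinv : ∀ w, f w = ∫ ξ, Complex.exp (↑(2 * π * inner ℝ ξ w) * Complex.I) • φ ξ := by
    intro w
    rw [← Real.fourierInv_eq', SchwartzMap.fourier_coe]
    have := DFunLike.congr_fun (FourierTransform.fourierInv_fourier_eq
      (F := 𝓢(EuclideanSpace ℝ (Fin 3), ℂ)) (hfc.toSchwartzMap hfs)) w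
    rw [SchwartzMap.fourierInv_coe, SchwartzMap.fourier_coe] at this
    exact this.symm
  -- coordinates
  let P := (ℝ × ℝ × ℝ) × EuclideanSpace ℝ (Fin 3)
  have hξ : ∀ i : Fin 3, Function.HasTemperateGrowth fun p : P => p.2 i := fun i =>
    ((EuclideanSpace.proj i : EuclideanSpace ℝ (Fin 3) →L[ℝ] ℝ).comp
      (ContinuousLinearMap.snd ℝ (ℝ × ℝ × ℝ) (EuclideanSpace ℝ (Fin 3)))).hasTemperateGrowth
  have hx : Function.HasTemperateGrowth fun p : P => p.1.1 :=
    ((ContinuousLinearMap.fst ℝ ℝ (ℝ × ℝ)).comp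
      (ContinuousLinearMap.fst ℝ (ℝ × ℝ × ℝ) (EuclideanSpace ℝ (Fin 3)))).hasTemperateGrowth
  have hy : Function.HasTemperateGrowth fun p : P => p.1.2.1 :=
    (((ContinuousLinearMap.fst ℝ ℝ ℝ).comp (ContinuousLinearMap.snd ℝ ℝ (ℝ × ℝ))).comp
      (ContinuousLinearMap.fst ℝ (ℝ × ℝ × ℝ) (EuclideanSpace ℝ (Fin 3)))).hasTemperateGrowth
  have hz : Function.HasTemperateGrowth fun p : P => p.1.2.2 :=
    (((ContinuousLinearMap.snd ℝ ℝ ℝ).comp (ContinuousLinearMap.snd ℝ ℝ (ℝ × ℝ))).comp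
      (ContinuousLinearMap.fst ℝ (ℝ × ℝ × ℝ) (EuclideanSpace ℝ (Fin 3)))).hasTemperateGrowth
  let M : P → ℂ := fun p => Complex.exp (↑(2 * π * (p.2 0 * p.1.1 + p.2 1 * p.1.2.1)) * Complex.I)
  have hM : M.HasTemperateGrowth :=
    hasTemperateGrowth_cexp.comp ((Function.HasTemperateGrowth.const (2 * π)).mul
      (((hξ 0).mul hx).add ((hξ 1).mul hy)))
  have harg : Function.HasTemperateGrowth fun p : P => 2 * π * p.2 2 * (2 * π * p.2 2) * p.1.2.2 :=
    (((Function.HasTemperateGrowth.const (2 * π)).mul (hξ 2)).mul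
      ((Function.HasTemperateGrowth.const (2 * π)).mul (hξ 2))).mul hz
  let M₀ : P → ℂ := fun p => M p * ((C (2 * π * p.2 2 * (2 * π * p.2 2) * p.1.2.2) : ℝ) : ℂ)
  have hM₀ : M₀.HasTemperateGrowth :=
    hM.mul (Function.Complex.hasTemperateGrowth_ofReal.comp (h1.comp harg))
  let M₁ : P → ℂ := fun p => M p * (((-2 * (2 * π * p.2 2)) *
    deriv C (2 * π * p.2 2 * (2 * π * p.2 2) * p.1.2.2) : ℝ) : ℂ) * Complex.I
  have hM₁ : M₁.HasTemperateGrowth :=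
    (hM.mul (Function.Complex.hasTemperateGrowth_ofReal.comp (((Function.HasTemperateGrowth.const (-2)).mul
      ((Function.HasTemperateGrowth.const (2 * π)).mul (hξ 2))).mul (h2.comp harg)))).mul
      (.const Complex.I)
  have hint : ∀ {N : P → ℂ}, N.HasTemperateGrowth → ∀ q, Integrable fun ξ => φ ξ * N (q, ξ) := by
    intro N hN q
    have hN' : Function.HasTemperateGrowth fun ξ => N (q, ξ) := by
      have hs : Function.HasTemperateGrowth fun ξ : EuclideanSpace ℝ (Fin 3) =>
          ContinuousLinearMap.inr ℝ (ℝ × ℝ × ℝ) (EuclideanSpace ℝ (Fin 3)) ξ + (q, 0) :=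
        (ContinuousLinearMap.hasTemperateGrowth _).add (.const _)
      have := hN.comp hs
      simpa [Function.comp_def] using this
    have := (SchwartzMap.smulLeftCLM ℂ (fun ξ => N (q, ξ)) φ).integrable (μ := volume)
    refine this.congr (Eventually.of_forall fun ξ => ?_)
    rw [SchwartzMap.smulLeftCLM_apply_apply hN', smul_eq_mul, mul_comm]
  refine ⟨fun q => (∫ ξ, φ ξ * M₀ (q, ξ)).re, fun q => (∫ ξ, φ ξ * M₁ (q, ξ)).re,
    Complex.reCLM.contDiff.comp (contDiff_integral_schwartz φ hM₀),
    Complex.reCLM.contDiff.comp (contDiff_integral_schwartz φ hM₁), ?_⟩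
  have htend : Tendsto (fun q : ℝ × ℝ × ℝ => (!₂[q.1, q.2.1, q.2.2] : EuclideanSpace ℝ (Fin 3)))
      (𝓝 0) (𝓝 0) := by
    have hcont : Continuous fun q : ℝ × ℝ × ℝ =>
        (!₂[q.1, q.2.1, q.2.2] : EuclideanSpace ℝ (Fin 3)) := by
      refine (PiLp.continuous_toLp 2 _).comp (continuous_pi fun i => ?_)
      fin_cases i <;> simp <;> fun_prop
    convert hcont.tendsto 0 using 2
    ext i; fin_cases i <;> simp
  filter_upwards [htend.eventually χ.eventuallyEq_one] with q hq
  obtain ⟨x, y, v⟩ := q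
  have e1 : ((F (x, y, v) : ℝ) : ℂ) = f !₂[x, y, v] := by
    simp only [f]
    dsimp only at hq
    rw [hq]
    simp
  have e2 : f !₂[x, y, v] = (∫ ξ, φ ξ * M₀ ((x, y, v ^ 2), ξ))
      + (v : ℂ) * ∫ ξ, φ ξ * M₁ ((x, y, v ^ 2), ξ) := by
    rw [hinv, ← integral_const_mul, ← integral_add (hint hM₀ _) ((hint hM₁ _).const_mul _)]
    congr 1
    funext ξ
    have hin : inner ℝ ξ !₂[x, y, v] = ξ 0 * x + ξ 1 * y + ξ 2 * v := by
      simp [PiLp.inner_apply, Fin.sum_univ_three]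
      ring
    simp only [M₀, M₁, M, hin]
    rw [show 2 * π * (ξ 0 * x + ξ 1 * y + ξ 2 * v) =
      2 * π * (ξ 0 * x + ξ 1 * y) + 2 * π * ξ 2 * v by ring, Complex.ofReal_add, add_mul,
      Complex.exp_add, Complex.exp_mul_I ((2 * π * ξ 2 * v : ℝ) : ℂ), ← Complex.ofReal_cos,
      ← Complex.ofReal_sin, ← h3]
    have h4 := two_mul_deriv_of_sq_eq_cos h1.1 h3 (2 * π * ξ 2 * v)
    rw [show sin (2 * π * ξ 2 * v) = v * (-2 * (2 * π * ξ 2) *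
      deriv C ((2 * π * ξ 2 * v) ^ 2)) by linarith,
      show (2 * π * ξ 2 * v) ^ 2 = 2 * π * ξ 2 * (2 * π * ξ 2) * v ^ 2 by ring]
    rw [Complex.ofReal_mul v, smul_eq_mul]
    ring
  have e3 := congrArg Complex.re (e1.trans e2)
  rw [Complex.ofReal_re, Complex.add_re, Complex.re_ofReal_mul] at e3
  exact e3

theorem exists_even_odd_real {m : ℝ → ℝ} (hm : ContDiff ℝ ∞ m) :
    ∃ m₀ m₁ : ℝ → ℝ, ContDiff ℝ ∞ m₀ ∧ ContDiff ℝ ∞ m₁ ∧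
      ∀ᶠ r in 𝓝 (0 : ℝ), m r = m₀ (r ^ 2) + r * m₁ (r ^ 2) := by
  obtain ⟨F₀, F₁, h₀, h₁, h⟩ := exists_even_odd (F := fun q => m q.2.2) (by fun_prop)
  refine ⟨fun z => F₀ (0, 0, z), fun z => F₁ (0, 0, z), by fun_prop, by fun_prop, ?_⟩
  have : Tendsto (fun r : ℝ => ((0 : ℝ), (0 : ℝ), r)) (𝓝 0) (𝓝 0) := by
    have hc : Continuous fun r : ℝ => ((0 : ℝ), (0 : ℝ), r) := by fun_prop
    exact hc.tendsto 0
  exact this.eventually h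

end EvenOdd

section Implicit

/-- Implicit function theorem for germs. -/
theorem exists_implicit {Q P : Type} [NormedAddCommGroup Q] [NormedSpace ℝ Q]
    [FiniteDimensional ℝ Q] [NormedAddCommGroup P] [NormedSpace ℝ P] [FiniteDimensional ℝ P]
    {Φ : Q × P → P} (hΦ : ContDiff ℝ ∞ Φ) {q₀ : Q} {p₀ : P} (h0 : Φ (q₀, p₀) = 0)
    (hinj : ∀ h, fderiv ℝ Φ (q₀, p₀) (0, h) = 0 → h = 0) :
    ∃ p : Q → P, ContDiff ℝ ∞ p ∧ p q₀ = p₀ ∧ ∀ᶠ q in 𝓝 q₀, Φ (q, p q) = 0 := by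
  have hd := (hΦ.differentiable (by simp) (q₀, p₀)).hasFDerivAt
  have hΞ : ContDiff ℝ ∞ fun x : Q × P => (x.1, Φ x) := contDiff_fst.prodMk hΦ
  have hΞd : HasFDerivAt (fun x : Q × P => (x.1, Φ x))
      ((ContinuousLinearMap.fst ℝ Q P).prod (fderiv ℝ Φ (q₀, p₀))) (q₀, p₀) :=
    hasFDerivAt_fst.prodMk hd
  obtain ⟨-, Θ, hΘ, h1, h2, h3⟩ := isDiffeoGerm_of_injective (x₀ := (q₀, p₀)) hΞ (by
    rintro ⟨h, k⟩ hv
    rw [hΞd.fderiv] at hv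
    simp only [ContinuousLinearMap.prod_apply, ContinuousLinearMap.coe_fst', Prod.mk_eq_zero]
      at hv
    obtain ⟨rfl, hv⟩ := hv
    rw [hinj k hv]; rfl)
  dsimp only at h1 h3
  rw [h0] at h1 h3
  refine ⟨fun q => (Θ (q, 0)).2, by fun_prop, congrArg Prod.snd h1, ?_⟩
  have ht : Tendsto (fun q : Q => (q, (0 : P))) (𝓝 q₀) (𝓝 (q₀, 0)) :=
    (by fun_prop : Continuous fun q : Q => (q, (0 : P))).tendsto _
  filter_upwards [ht.eventually h3] with q hq
  rw [Prod.mk.injEq] at hq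
  have : (q, (Θ (q, 0)).2) = Θ (q, 0) := Prod.ext hq.1.symm rfl
  rw [this, hq.2]

theorem exists_contDiff_inv {E : Type} [NormedAddCommGroup E] [NormedSpace ℝ E]
    [FiniteDimensional ℝ E] {f : E → ℝ} (hf : ContDiff ℝ ∞ f) {x₀ : E} (h0 : f x₀ ≠ 0) :
    ∃ g : E → ℝ, ContDiff ℝ ∞ g ∧ ∀ᶠ x in 𝓝 x₀, g x * f x = 1 := by
  have hs : {x | f x ≠ 0} ∈ 𝓝 x₀ := hf.continuous.continuousAt.eventually_ne h0
  obtain ⟨g, hg, hge⟩ := exists_contDiff_eventuallyEq hs (f := fun x => (f x)⁻¹)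
    (hf.contDiffOn.inv fun x hx => hx)
  refine ⟨g, hg, ?_⟩
  filter_upwards [hge, hs] with x hx hx'
  rw [hx, inv_mul_cancel₀ hx']

theorem exists_contDiff_sqrt {E : Type} [NormedAddCommGroup E] [NormedSpace ℝ E]
    [FiniteDimensional ℝ E] {f : E → ℝ} (hf : ContDiff ℝ ∞ f) {x₀ : E} (h0 : 0 < f x₀) :
    ∃ g : E → ℝ, ContDiff ℝ ∞ g ∧ g x₀ = √(f x₀) ∧ ∀ᶠ x in 𝓝 x₀, g x ^ 2 = f x := by
  have hs : {x | 0 < f x} ∈ 𝓝 x₀ := hf.continuous.continuousAt.eventually (lt_mem_nhds h0)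
  obtain ⟨g, hg, hge⟩ := exists_contDiff_eventuallyEq hs (f := fun x => √(f x))
    (hf.contDiffOn.sqrt fun x hx => ne_of_gt hx)
  refine ⟨g, hg, hge.self_of_nhds, ?_⟩
  filter_upwards [hge, hs] with x hx hx'
  rw [hx, Real.sq_sqrt (le_of_lt hx')]

/-- Morse lemma with parameters, in one variable. -/
theorem parametric_morse {E : Type} [NormedAddCommGroup E] [NormedSpace ℝ E]
    [FiniteDimensional ℝ E] {Λ : E × ℝ → ℝ} (hΛ : ContDiff ℝ ∞ Λ) {N : ℝ → ℝ}
    (hN : ContDiff ℝ ∞ N) (hN0 : N 0 ≠ 0) (h : ∀ᶠ t in 𝓝 (0 : ℝ), Λ (0, t) = t ^ 2 * N t) :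
    ∃ (V : E × ℝ → ℝ) (Λ₀ : E → ℝ) (K : ℝ), ContDiff ℝ ∞ V ∧ ContDiff ℝ ∞ Λ₀ ∧ K ≠ 0 ∧
      V 0 = 0 ∧ Λ₀ 0 = 0 ∧ fderiv ℝ V 0 (0, 1) ≠ 0 ∧
      ∀ᶠ q in 𝓝 (0 : E × ℝ), Λ q = Λ₀ q.1 + K * V q ^ 2 := by
  -- the critical point
  have hΛt : ContDiff ℝ ∞ fun q : E × ℝ => fderiv ℝ Λ q (0, 1) :=
    (hΛ.fderiv_right (m := ∞) (by simp)).clm_apply contDiff_const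
  have hline : ∀ (G : E × ℝ → ℝ), ContDiff ℝ ∞ G → ∀ (e : E) (t : ℝ),
      HasDerivAt (fun t => G (e, t)) (fderiv ℝ G (e, t) (0, 1)) t := fun G hG e t =>
    ((hG.differentiable (by simp) (e, t)).hasFDerivAt).comp_hasDerivAt t
      ((hasDerivAt_const t e).prodMk (hasDerivAt_id t))
  have hNd : ∀ t, HasDerivAt (fun t => t ^ 2 * N t) (2 * t * N t + t ^ 2 * deriv N t) t := by
    intro t
    have := (hasDerivAt_pow 2 t).mul (hN.differentiable (by simp) t).hasDerivAt
    exact this.congr_deriv (by simp)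
  have h1 : ∀ᶠ t in 𝓝 (0 : ℝ), fderiv ℝ Λ ((0 : E), t) (0, 1) = 2 * t * N t + t ^ 2 * deriv N t := by
    filter_upwards [h.eventually_nhds] with t ht
    exact (hline Λ hΛ 0 t).unique ((hNd t).congr_of_eventuallyEq ht)
  have h2 : fderiv ℝ (fun q : E × ℝ => fderiv ℝ Λ q (0, 1)) ((0 : E), 0) (0, 1) = 2 * N 0 := by
    refine ((hline _ hΛt 0 0).congr_of_eventuallyEq ?_).unique ?_ (f := fun t : ℝ =>
      2 * t * N t + t ^ 2 * deriv N t)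
    · filter_upwards [h1] with t ht using ht.symm
    · have hN' : Differentiable ℝ (deriv N) :=
        (contDiff_infty_iff_deriv.1 hN).2.differentiable (by simp)
      have := ((((hasDerivAt_id (0 : ℝ)).const_mul 2).mul
        (hN.differentiable (by simp) 0).hasDerivAt).add
        ((hasDerivAt_pow 2 (0 : ℝ)).mul (hN' 0).hasDerivAt))
      exact this.congr_deriv (by simp)
  obtain ⟨κ, hκ, hκ0, hκe⟩ := exists_implicit hΛt (q₀ := (0 : E)) (p₀ := (0 : ℝ))
    (by simpa using h1.self_of_nhds) (by
      intro t ht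
      have : ((0 : E), t) = t • ((0 : E), (1 : ℝ)) := by simp
      rw [this, map_smul, h2, smul_eq_mul] at ht
      simpa [hN0] using ht)
  -- Taylor expansion at the critical point
  obtain ⟨H, hH, hHe, hH0⟩ := hadamard_lemma (F := fun q : E × ℝ => Λ (q.1, κ q.1 + q.2))
    (by fun_prop)
  obtain ⟨K, hK, hKe, -⟩ := hadamard_lemma hH
  have hHz : ∀ᶠ e in 𝓝 (0 : E), H (e, 0) = 0 := by
    filter_upwards [hκe] with e he
    rw [hH0 e]
    have a1 := hline (fun q : E × ℝ => Λ (q.1, κ q.1 + q.2)) (by fun_prop) e 0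
    have a2 : HasDerivAt (fun t => Λ (e, κ e + t)) (fderiv ℝ Λ (e, κ e) (0, 1)) 0 := by
      have a3 := hline Λ hΛ e (κ e + 0)
      have := a3.comp_const_add (κ e) 0
      simpa using this
    exact (a1.unique a2).trans he
  have hmain : ∀ᶠ q in 𝓝 (0 : E × ℝ),
      Λ (q.1, q.2) = Λ (q.1, κ q.1) + (q.2 - κ q.1) ^ 2 * K (q.1, q.2 - κ q.1) := by
    filter_upwards [(continuous_fst.tendsto (0 : E × ℝ)).eventually hHz] with q hq
    have b1 := hHe q.1 (q.2 - κ q.1)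
    rw [hKe, hq] at b1
    simp only [add_sub_cancel, add_zero] at b1
    rw [b1]; ring
  have hΛ00 : Λ (0, 0) = 0 := by simpa using h.self_of_nhds
  have hK0 : K (0, 0) = N 0 := by
    have hev : ∀ᶠ t in 𝓝[≠] (0 : ℝ), K (0, t) = N t := by
      have ht : Tendsto (fun t : ℝ => ((0 : E), t)) (𝓝 0) (𝓝 0) :=
        (by fun_prop : Continuous fun t : ℝ => ((0 : E), t)).tendsto 0
      filter_upwards [(ht.eventually hmain).filter_mono nhdsWithin_le_nhds,
        h.filter_mono nhdsWithin_le_nhds, self_mem_nhdsWithin] with t h1 h2 h3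
      simp only [hκ0, sub_zero, hΛ00, zero_add, h2] at h1
      have h4 : t ^ 2 ≠ 0 := pow_ne_zero 2 h3
      exact (mul_left_cancel₀ h4 h1).symm
    have l1 : Tendsto (fun t : ℝ => K ((0 : E), t)) (𝓝[≠] 0) (𝓝 (K (0, 0))) :=
      ((hK.continuous.comp (by fun_prop : Continuous fun t : ℝ => ((0 : E), t))).tendsto 0).mono_left
        nhdsWithin_le_nhds
    have l2 : Tendsto N (𝓝[≠] 0) (𝓝 (N 0)) := (hN.continuous.tendsto 0).mono_left
      nhdsWithin_le_nhds
    exact tendsto_nhds_unique (l1.congr' hev) l2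
  obtain ⟨W, hW, hW0, hWe⟩ := exists_contDiff_sqrt (x₀ := (0 : E × ℝ))
    (f := fun q : E × ℝ => K (q.1, q.2 - κ q.1) / N 0) (by fun_prop) (by simp [hκ0, hK0, hN0])
  simp only [Prod.fst_zero, Prod.snd_zero, hκ0, sub_zero, hK0, div_self hN0, Real.sqrt_one] at hW0
  refine ⟨fun q => (q.2 - κ q.1) * W q, fun e => Λ (e, κ e), N 0, by fun_prop, by fun_prop, hN0,
    by simp [hκ0], by simp [hκ0, hΛ00], ?_, ?_⟩
  · have c1 := hline (fun q => (q.2 - κ q.1) * W q) (by fun_prop) 0 0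
    have c2 : HasDerivAt (fun t : ℝ => (t - κ 0) * W (0, t)) 1 0 := by
      have c3 := ((hasDerivAt_id (0 : ℝ)).sub_const (κ 0)).mul (hline W hW 0 0)
      exact c3.congr_deriv (by simp [hκ0]; exact hW0)
    have := c1.unique c2
    rw [Prod.mk_zero_zero] at this
    rw [this]; exact one_ne_zero
  · filter_upwards [hmain, hWe] with q h1 h2
    have h3 : K (q.1, q.2 - κ q.1) = N 0 * W q ^ 2 := by rw [h2]; field_simp
    rw [show q = (q.1, q.2) from rfl, h1, h3]
    ring

theorem hadamard_two {P : Type} [NormedAddCommGroup P] [NormedSpace ℝ P] [FiniteDimensional ℝ P]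
    {φ : P × ℝ × ℝ → ℝ} (hφ : ContDiff ℝ ∞ φ) :
    ∃ φ₁ φ₂ : P × ℝ × ℝ → ℝ, ContDiff ℝ ∞ φ₁ ∧ ContDiff ℝ ∞ φ₂ ∧
      (∀ x y z, φ (x, y, z) = φ (x, 0, 0) + y * φ₁ (x, y, z) + z * φ₂ (x, y, z)) ∧
      (∀ x, φ₁ (x, 0, 0) = fderiv ℝ φ (x, 0, 0) (0, 1, 0)) ∧
      ∀ x, φ₂ (x, 0, 0) = fderiv ℝ φ (x, 0, 0) (0, 0, 1) := by
  obtain ⟨A, hA, hAe, hA0⟩ := hadamard_lemma (E := P) (F := fun q => φ (q.1, q.2, 0)) (by fun_prop)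
  obtain ⟨B, hB, hBe, hB0⟩ := hadamard_lemma (E := P × ℝ) (F := fun q => φ (q.1.1, q.1.2, q.2))
    (by fun_prop)
  refine ⟨fun q => A (q.1, q.2.1), fun q => B ((q.1, q.2.1), q.2.2), by fun_prop, by fun_prop,
    fun x y z => ?_, fun x => ?_, fun x => ?_⟩
  · have h1 := hBe (x, y) z
    have h2 := hAe x y
    simp only at h1 h2 ⊢
    rw [h1, h2]
  · simp only [hA0]
    have hd : HasFDerivAt (fun q : P × ℝ => (q.1, q.2, (0 : ℝ)))
        ((ContinuousLinearMap.fst ℝ P ℝ).prod ((ContinuousLinearMap.snd ℝ P ℝ).prod 0)) (x, 0) :=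
      hasFDerivAt_fst.prodMk (hasFDerivAt_snd.prodMk (hasFDerivAt_const _ _))
    have := ((hφ.differentiable (by simp) (x, 0, 0)).hasFDerivAt).comp (x, (0 : ℝ)) hd
    have h2 := this.fderiv
    rw [show (fun q : P × ℝ => φ (q.1, q.2, 0)) = φ ∘ fun q : P × ℝ => (q.1, q.2, (0 : ℝ)) from rfl,
      h2]
    simp
  · simp only [hB0]
    have hd : HasFDerivAt (fun q : (P × ℝ) × ℝ => (q.1.1, q.1.2, q.2))
        (((ContinuousLinearMap.fst ℝ P ℝ).comp (ContinuousLinearMap.fst ℝ (P × ℝ) ℝ)).prod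
          (((ContinuousLinearMap.snd ℝ P ℝ).comp (ContinuousLinearMap.fst ℝ (P × ℝ) ℝ)).prod
            (ContinuousLinearMap.snd ℝ (P × ℝ) ℝ))) ((x, 0), 0) :=
      (((ContinuousLinearMap.fst ℝ P ℝ).comp (ContinuousLinearMap.fst ℝ (P × ℝ) ℝ)).prod
          (((ContinuousLinearMap.snd ℝ P ℝ).comp (ContinuousLinearMap.fst ℝ (P × ℝ) ℝ)).prod
            (ContinuousLinearMap.snd ℝ (P × ℝ) ℝ))).hasFDerivAt
    have := HasFDerivAt.comp ((x, (0 : ℝ)), (0 : ℝ))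
      ((hφ.differentiable (by simp) (x, 0, 0)).hasFDerivAt) hd
    have h2 := this.fderiv
    rw [show (fun q : (P × ℝ) × ℝ => φ (q.1.1, q.1.2, q.2)) =
      φ ∘ fun q : (P × ℝ) × ℝ => (q.1.1, q.1.2, q.2) from rfl, h2]
    simp

end Implicit

section EdgeForm

/-- A germ `G` in coordinates adapted to a cuspidal edge: the source coordinates satisfy
`r² = E + v τ` and `r³ = S₀ + v S₁`, where the coefficients are functions on the target and
`v²` is the third component of `G`; the edge is the first coordinate axis. -/
structure EdgeForm (G : R2 → R3) (E τ S₀ S₁ : R3 → ℝ) (R : ℝ → ℝ) (v : R2 → ℝ) : Prop where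
  smooth_G : ContDiff ℝ ∞ G
  smooth_E : ContDiff ℝ ∞ E
  smooth_τ : ContDiff ℝ ∞ τ
  smooth_S₀ : ContDiff ℝ ∞ S₀
  smooth_S₁ : ContDiff ℝ ∞ S₁
  smooth_R : ContDiff ℝ ∞ R
  G_zero : G 0 = 0
  sq_eq : ∀ᶠ q in 𝓝 (0 : R2), q.2 ^ 2 = E (G q) + v q * τ (G q)
  cube_eq : ∀ᶠ q in 𝓝 (0 : R2), q.2 ^ 3 = S₀ (G q) + v q * S₁ (G q)
  v_sq : ∀ᶠ q in 𝓝 (0 : R2), v q ^ 2 = (G q).2.2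
  edge_E : ∀ᶠ x in 𝓝 (0 : ℝ), E (x, 0, 0) = R x ^ 2
  edge_S₀ : ∀ᶠ x in 𝓝 (0 : ℝ), S₀ (x, 0, 0) = R x ^ 3
  edge_S₁ : ∀ᶠ x in 𝓝 (0 : ℝ), 2 * S₁ (x, 0, 0) = 3 * τ (x, 0, 0) * R x
  R_zero : R 0 = 0
  deriv_R : deriv R 0 ≠ 0
  τ_zero : τ 0 ≠ 0
  S₀_deriv : fderiv ℝ S₀ 0 (0, 1, 0) ≠ 0
  G_deriv_fst : fderiv ℝ G 0 (1, 0) = (1, 0, 0)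
  G_deriv_snd : fderiv ℝ G 0 (0, 1) = 0

theorem ContDiff.hasDerivAt_comp {E F : Type} [NormedAddCommGroup E] [NormedSpace ℝ E]
    [NormedAddCommGroup F] [NormedSpace ℝ F] {G : E → F} (hG : ContDiff ℝ ∞ G) {c : ℝ → E} {c' : E}
    {t : ℝ} (hc : HasDerivAt c c' t) :
    HasDerivAt (fun t => G (c t)) (fderiv ℝ G (c t) c') t :=
  ((hG.differentiable (by simp) (c t)).hasFDerivAt).comp_hasDerivAt t hc

theorem eventually_eq_of_punctured {f g : ℝ → ℝ} (hf : Continuous f) (hg : Continuous g)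
    {x₀ : ℝ} (h : ∀ᶠ x in 𝓝[≠] x₀, f x = g x) : ∀ᶠ x in 𝓝 x₀, f x = g x := by
  have h0 : f x₀ = g x₀ := by
    have l1 : Tendsto f (𝓝[≠] x₀) (𝓝 (f x₀)) := (hf.tendsto x₀).mono_left nhdsWithin_le_nhds
    have l2 : Tendsto g (𝓝[≠] x₀) (𝓝 (g x₀)) := (hg.tendsto x₀).mono_left nhdsWithin_le_nhds
    exact tendsto_nhds_unique (l1.congr' h) l2
  rw [eventually_nhdsWithin_iff] at h
  filter_upwards [h] with x hx
  by_cases hxx : x = x₀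
  · rw [hxx, h0]
  · exact hx hxx

theorem exists_edgeForm {F : R2 → R3} (hF : ContDiff ℝ ∞ F) (hF0 : F 0 = 0)
    (hFr : fderiv ℝ F 0 (0, 1) = 0) {ρ : ℝ → ℝ} (hρ : ContDiff ℝ ∞ ρ) (hρ0 : ρ 0 = 0)
    (hρ1 : deriv ρ 0 ≠ 0) (hk : ∀ᶠ s in 𝓝 (0 : ℝ), ∃ k : ℝ, fderiv ℝ F (s, ρ s) (k, 1) = 0)
    (hx : HasDerivAt (fun s => (F (s, ρ s)).1) 1 0)
    {V S : R3 → ℝ} {Λ₀ : R2 → ℝ} {K : ℝ} (hV : ContDiff ℝ ∞ V) (hS : ContDiff ℝ ∞ S)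
    (hΛ₀ : ContDiff ℝ ∞ Λ₀) (hK : K ≠ 0) (hV0 : V 0 = 0) (hΛ00 : Λ₀ 0 = 0)
    (hV1 : fderiv ℝ V 0 (0, 0, 1) ≠ 0) (hS1 : fderiv ℝ S 0 (0, 1, 0) ≠ 0)
    (hcube : ∀ᶠ q in 𝓝 (0 : R2), q.2 ^ 3 = S ((F q).1, (F q).2.1, q.2 ^ 2))
    (hmorse : ∀ᶠ q in 𝓝 (0 : R2), (F q).2.2 =
      Λ₀ ((F q).1, (F q).2.1) + K * V ((F q).1, (F q).2.1, q.2 ^ 2) ^ 2) :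
    ∃ (Q : R3 → R3) (E τ S₀ S₁ : R3 → ℝ) (R : ℝ → ℝ) (v : R2 → ℝ),
      IsDiffeoGerm Q 0 ∧ Q 0 = 0 ∧ EdgeForm (fun q => Q (F q)) E τ S₀ S₁ R v := by
  set x : ℝ → ℝ := fun s => (F (s, ρ s)).1 with hxdef
  have hxs : ContDiff ℝ ∞ x := by fun_prop
  have hF00 : F (0, 0) = 0 := hF0
  have hx0 : x 0 = 0 := by simp [hxdef, hρ0, hF00]
  obtain ⟨-, σ, hσ, hσ0, hσ1, hσ2⟩ := isDiffeoGerm_of_injective (x₀ := (0 : ℝ)) hxs (by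
    intro v hv
    rw [hx.hasFDerivAt.fderiv] at hv
    simpa using hv)
  rw [hx0] at hσ0 hσ2
  set γ : ℝ → ℝ := fun X => (F (σ X, ρ (σ X))).2.1 with hγdef
  have hγ : ContDiff ℝ ∞ γ := by fun_prop
  have hγ0 : γ 0 = 0 := by simp [hγdef, hσ0, hρ0, hF00]
  set Q : R3 → R3 := fun q => (q.1, q.2.1 - γ q.1, (q.2.2 - Λ₀ (q.1, q.2.1)) / K) with hQdef
  have hQ : ContDiff ℝ ∞ Q := by fun_prop
  have hΛ00' : Λ₀ (0, 0) = 0 := hΛ00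
  have hQ0 : Q 0 = 0 := by simp [hQdef, hγ0, hΛ00']
  have hγd : ∀ w : R3, HasDerivAt (fun t : ℝ => γ (t * w.1)) (deriv γ 0 * w.1) 0 := by
    intro w
    have h1 := (hγ.differentiable (by simp) (0 * w.1)).hasDerivAt.scomp (0 : ℝ)
      ((hasDerivAt_id (0 : ℝ)).mul_const w.1)
    exact h1.congr_deriv (by simp; ring)
  have hline : ∀ w : R3, HasDerivAt (fun t : ℝ => t • w) w 0 := fun w =>
    ((hasDerivAt_id (0 : ℝ)).smul_const w).congr_deriv (by simp)
  have hQg : IsDiffeoGerm Q 0 := by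
    refine isDiffeoGerm_of_injective hQ fun w hw => ?_
    have h1 := hQ.hasDerivAt_comp (hline w)
    rw [zero_smul, hw] at h1
    have h2 : HasDerivAt (fun t : ℝ => Q (t • w)) (w.1, w.2.1 - deriv γ 0 * w.1,
        (w.2.2 - fderiv ℝ Λ₀ 0 (w.1, w.2.1)) / K) 0 := by
      have h3 := hΛ₀.hasDerivAt_comp ((((hasDerivAt_id (0 : ℝ)).mul_const w.1).prodMk
        ((hasDerivAt_id (0 : ℝ)).mul_const w.2.1)))
      refine HasDerivAt.prodMk ?_ (HasDerivAt.prodMk ?_ ?_)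
      · simpa using (hasDerivAt_id (0 : ℝ)).mul_const w.1
      · simpa using ((hasDerivAt_id (0 : ℝ)).mul_const w.2.1).fun_sub (hγd w)
      · have := (((hasDerivAt_id (0 : ℝ)).mul_const w.2.2).sub h3).div_const K
        exact this.congr_deriv (by simp; rfl)
    have h4 := h1.unique h2
    simp only [Prod.ext_iff, Prod.fst_zero, Prod.snd_zero] at h4
    obtain ⟨h5, h6, h7⟩ := h4
    have e1 : w.1 = 0 := h5.symm
    have e2 : w.2.1 = 0 := by rw [e1] at h6; linarith
    have e3 : w.2.2 = 0 := by
      rw [e1, e2, Prod.mk_zero_zero, map_zero, sub_zero] at h7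
      have := div_eq_zero_iff.1 h7.symm
      tauto
    exact Prod.ext e1 (Prod.ext e2 e3)
  set Θ : R3 → R3 := fun q => (q.1, q.2.1 - γ q.1, V q) with hΘdef
  have hΘ : ContDiff ℝ ∞ Θ := by fun_prop
  have hΘ0 : Θ 0 = 0 := by simp [hΘdef, hγ0, hV0]
  obtain ⟨-, I, hI, hI0, hI1, -⟩ : IsDiffeoGerm Θ 0 := by
    refine isDiffeoGerm_of_injective hΘ fun w hw => ?_
    have h1 := hΘ.hasDerivAt_comp (hline w)
    rw [zero_smul, hw] at h1
    have h2 : HasDerivAt (fun t : ℝ => Θ (t • w)) (w.1, w.2.1 - deriv γ 0 * w.1,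
        fderiv ℝ V 0 w) 0 := by
      refine HasDerivAt.prodMk ?_ (HasDerivAt.prodMk ?_ ?_)
      · simpa using (hasDerivAt_id (0 : ℝ)).mul_const w.1
      · simpa using ((hasDerivAt_id (0 : ℝ)).mul_const w.2.1).fun_sub (hγd w)
      · have := hV.hasDerivAt_comp (hline w)
        rwa [zero_smul] at this
    have h4 := h1.unique h2
    simp only [Prod.ext_iff, Prod.fst_zero, Prod.snd_zero] at h4
    obtain ⟨h5, h6, h7⟩ := h4
    have e1 : w.1 = 0 := h5.symm
    have e2 : w.2.1 = 0 := by rw [e1] at h6; linarith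
    have e3 : w = w.2.2 • ((0, 0, 1) : R3) := Prod.ext (by simp [e1]) (Prod.ext (by simp [e2])
      (by simp))
    rw [e3, map_smul, smul_eq_mul] at h7
    have e4 : w.2.2 = 0 := by
      rcases mul_eq_zero.1 h7.symm with h | h
      · exact h
      · exact absurd h hV1
    rw [e3, e4, zero_smul]
  rw [hΘ0] at hI0
  obtain ⟨E, τ, hE, hτ, hEτ⟩ := exists_even_odd (F := fun q => (I q).2.2) (by fun_prop)
  obtain ⟨S₀, S₁, hS₀, hS₁, hSS⟩ := exists_even_odd (F := fun q => S (I q)) (by fun_prop)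
  set v : R2 → ℝ := fun q => V ((F q).1, (F q).2.1, q.2 ^ 2) with hvdef
  have hv : ContDiff ℝ ∞ v := by fun_prop
  -- identities for the even and odd parts
  have hΘt : Tendsto Θ (𝓝 0) (𝓝 0) := by
    have := hΘ.continuous.tendsto 0
    rwa [hΘ0] at this
  have hTΘ : ∀ᶠ q in 𝓝 (0 : R3), q.2.2 =
      E (q.1, q.2.1 - γ q.1, V q ^ 2) + V q * τ (q.1, q.2.1 - γ q.1, V q ^ 2) := by
    filter_upwards [hI1, hΘt.eventually hEτ] with q h1 h2
    rw [h1] at h2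
    exact h2
  have hSΘ : ∀ᶠ q in 𝓝 (0 : R3), S q =
      S₀ (q.1, q.2.1 - γ q.1, V q ^ 2) + V q * S₁ (q.1, q.2.1 - γ q.1, V q ^ 2) := by
    filter_upwards [hI1, hΘt.eventually hSS] with q h1 h2
    rw [h1] at h2
    exact h2
  set G : R2 → R3 := fun q => Q (F q) with hGdef
  have hG : ContDiff ℝ ∞ G := hQ.comp hF
  have hG0 : G 0 = 0 := by simp [hGdef, hF0, hQ0]
  have hvsq : ∀ᶠ q in 𝓝 (0 : R2), v q ^ 2 = (G q).2.2 := by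
    filter_upwards [hmorse] with q hq
    simp only [hGdef, hQdef, hvdef]
    rw [hq]; field_simp; ring
  have hjt : Tendsto (fun q : R2 => (((F q).1, (F q).2.1, q.2 ^ 2) : R3)) (𝓝 0) (𝓝 0) := by
    have : Continuous (fun q : R2 => (((F q).1, (F q).2.1, q.2 ^ 2) : R3)) := by
      have := hF.continuous
      fun_prop
    have := this.tendsto 0
    simp only [hF0, Prod.fst_zero, Prod.snd_zero, ne_eq, OfNat.ofNat_ne_zero, not_false_eq_true,
      zero_pow] at this
    exact this
  have hGv : ∀ᶠ q in 𝓝 (0 : R2), ((F q).1, (F q).2.1 - γ (F q).1, v q ^ 2) = G q := by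
    filter_upwards [hvsq] with q hq
    rw [hq]
  have hsq : ∀ᶠ q in 𝓝 (0 : R2), q.2 ^ 2 = E (G q) + v q * τ (G q) := by
    filter_upwards [hGv, hjt.eventually hTΘ] with q h1 h2
    rw [← h1]
    exact h2
  have hcb : ∀ᶠ q in 𝓝 (0 : R2), q.2 ^ 3 = S₀ (G q) + v q * S₁ (G q) := by
    filter_upwards [hGv, hjt.eventually hSΘ, hcube] with q h1 h2 h3
    rw [← h1, h3]
    exact h2
  -- the edge
  have hct : Tendsto (fun s : ℝ => ((s, ρ s) : R2)) (𝓝 0) (𝓝 0) := by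
    have : Continuous (fun s : ℝ => ((s, ρ s) : R2)) := by
      have := hρ.continuous
      fun_prop
    have := this.tendsto 0
    rwa [hρ0] at this
  have hGe : ∀ᶠ s in 𝓝 (0 : ℝ), (G (s, ρ s)).1 = x s ∧ (G (s, ρ s)).2.1 = 0 := by
    filter_upwards [hσ1] with s hs
    refine ⟨rfl, ?_⟩
    change (F (s, ρ s)).2.1 - γ (x s) = 0
    simp only [hγdef, hs, sub_self]
  have hρne : ∀ᶠ s in 𝓝[≠] (0 : ℝ), ρ s ≠ 0 := by
    have := (hρ.differentiable (by simp) 0).hasDerivAt.eventually_ne hρ1 (c := 0)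
    exact this
  have hedge : ∀ᶠ s in 𝓝[≠] (0 : ℝ), G (s, ρ s) = (x s, 0, 0) ∧ E (x s, 0, 0) = ρ s ^ 2 ∧
      S₀ (x s, 0, 0) = ρ s ^ 3 ∧ 2 * S₁ (x s, 0, 0) = 3 * τ (x s, 0, 0) * ρ s := by
    filter_upwards [hρne, (hct.eventually hsq.eventually_nhds).filter_mono nhdsWithin_le_nhds,
      (hct.eventually hcb.eventually_nhds).filter_mono nhdsWithin_le_nhds,
      (hct.eventually hvsq.eventually_nhds).filter_mono nhdsWithin_le_nhds,
      hGe.filter_mono nhdsWithin_le_nhds, hk.filter_mono nhdsWithin_le_nhds]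
      with s h1 h2 h3 h4 h5 h6
    obtain ⟨k, hk⟩ := h6
    set c : ℝ → R2 := fun t => (s + t * k, ρ s + t) with hc
    have hcd : HasDerivAt c (k, 1) 0 := by
      refine HasDerivAt.prodMk ?_ ?_
      · simpa using ((hasDerivAt_id (0 : ℝ)).mul_const k).const_add s
      · simpa using (hasDerivAt_id (0 : ℝ)).const_add (ρ s)
    have hc0 : c 0 = (s, ρ s) := by simp [hc]
    have hctt : Tendsto c (𝓝 0) (𝓝 (s, ρ s)) := by
      have := hcd.continuousAt.tendsto
      rwa [hc0] at this
    have hFc := hF.hasDerivAt_comp hcd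
    rw [hc0, hk] at hFc
    have hcomp : ∀ P : R3 → ℝ, ContDiff ℝ ∞ P → HasDerivAt (fun t => P (G (c t))) 0 0 := by
      intro P hP
      have := (hP.comp hQ).hasDerivAt_comp hFc
      simpa using this
    have hvc := hv.hasDerivAt_comp hcd
    set D := fderiv ℝ v (c 0) (k, 1)
    have d1 : 2 * ρ s = τ (G (s, ρ s)) * D := by
      have a1 := (hcomp E hE).add (hvc.mul (hcomp τ hτ))
      have a2 : HasDerivAt (fun t => (c t).2 ^ 2) (2 * ρ s) 0 := by
        have := ((hasDerivAt_id (0 : ℝ)).const_add (ρ s)).pow 2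
        exact this.congr_deriv (by simp)
      have a3 := a1.congr_of_eventuallyEq (hctt.eventually h2)
      rw [a2.unique a3, hc0]; ring
    have d2 : 3 * ρ s ^ 2 = S₁ (G (s, ρ s)) * D := by
      have a1 := (hcomp S₀ hS₀).add (hvc.mul (hcomp S₁ hS₁))
      have a2 : HasDerivAt (fun t => (c t).2 ^ 3) (3 * ρ s ^ 2) 0 := by
        have := ((hasDerivAt_id (0 : ℝ)).const_add (ρ s)).pow 3
        exact this.congr_deriv (by simp)
      have a3 := a1.congr_of_eventuallyEq (hctt.eventually h3)
      rw [a2.unique a3, hc0]; ring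
    have hD : D ≠ 0 := by
      rintro hD
      rw [hD, mul_zero] at d1
      exact h1 (by linarith)
    have hv0 : v (s, ρ s) = 0 := by
      have a1 := hvc.pow 2
      have a2 := hcomp (fun q => q.2.2) (by fun_prop)
      have a3 := a1.unique (a2.congr_of_eventuallyEq (hctt.eventually h4))
      rw [hc0] at a3
      simpa [hD] using a3
    have hGs : G (s, ρ s) = (x s, 0, 0) := by
      refine Prod.ext h5.1 (Prod.ext h5.2 ?_)
      change (G (s, ρ s)).2.2 = 0
      rw [← h4.self_of_nhds, hv0]; ring
    have h2' := h2.self_of_nhds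
    have h3' := h3.self_of_nhds
    simp only [hv0, zero_mul, add_zero, hGs] at h2' h3'
    rw [hGs] at d1 d2
    refine ⟨hGs, h2'.symm, h3'.symm, mul_right_cancel₀ hD ?_⟩
    linear_combination (-2) * d2 + 3 * ρ s * d1
  have hσt : Tendsto σ (𝓝[≠] 0) (𝓝[≠] 0) := by
    refine tendsto_nhdsWithin_iff.2 ⟨?_, ?_⟩
    · have := hσ.continuous.tendsto 0
      rw [hσ0] at this
      exact this.mono_left nhdsWithin_le_nhds
    · filter_upwards [hσ2.filter_mono nhdsWithin_le_nhds, self_mem_nhdsWithin] with X h1 h2 h3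
      rw [Set.mem_singleton_iff] at h3
      rw [h3, hx0] at h1
      exact h2 h1.symm
  have hedge' : ∀ᶠ X in 𝓝[≠] (0 : ℝ), E (X, 0, 0) = ρ (σ X) ^ 2 ∧
      S₀ (X, 0, 0) = ρ (σ X) ^ 3 ∧ 2 * S₁ (X, 0, 0) = 3 * τ (X, 0, 0) * ρ (σ X) := by
    filter_upwards [hσt.eventually hedge, hσ2.filter_mono nhdsWithin_le_nhds] with X h1 h2
    rw [h2] at h1
    exact h1.2
  have cE := hE.continuous
  have cτ := hτ.continuous
  have cS₀ := hS₀.continuous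
  have cS₁ := hS₁.continuous
  have cσ := hσ.continuous
  have cρ := hρ.continuous
  have edgeS₁ : ∀ᶠ X in 𝓝 (0 : ℝ), 2 * S₁ (X, 0, 0) = 3 * τ (X, 0, 0) * ρ (σ X) :=
    eventually_eq_of_punctured (by fun_prop) (by fun_prop) (hedge'.mono fun X h => h.2.2)
  have hS₁0 : S₁ 0 = 0 := by
    have := edgeS₁.self_of_nhds
    rw [hσ0, hρ0] at this
    change 2 * S₁ 0 = _ at this
    linarith
  have hσd : HasDerivAt σ 1 0 := by
    have h1 := (hσ.differentiable (by simp) 0).hasDerivAt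
    rw [← hx0] at h1
    have h2 := (h1.comp (0 : ℝ) hx).unique
      ((hasDerivAt_id (0 : ℝ)).congr_of_eventuallyEq (hσ1.mono fun s hs => hs))
    rw [hx0, mul_one] at h2
    rw [← h2]
    exact (hσ.differentiable (by simp) 0).hasDerivAt
  have hGr : fderiv ℝ G 0 (0, 1) = 0 := by
    have : HasFDerivAt G ((fderiv ℝ Q (F 0)).comp (fderiv ℝ F 0)) 0 :=
      (hQ.differentiable (by simp) (F 0)).hasFDerivAt.comp 0
        (hF.differentiable (by simp) 0).hasFDerivAt
    rw [this.fderiv]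
    simp [hFr]
  refine ⟨Q, E, τ, S₀, S₁, fun X => ρ (σ X), v, hQg, hQ0, ?_⟩
  refine ⟨hG, hE, hτ, hS₀, hS₁, by fun_prop, hG0, hsq, hcb, hvsq,
    eventually_eq_of_punctured (by fun_prop) (by fun_prop) (hedge'.mono fun X h => h.1),
    eventually_eq_of_punctured (by fun_prop) (by fun_prop) (hedge'.mono fun X h => h.2.1),
    edgeS₁, by simp only [hσ0, hρ0], ?_, ?_, ?_, ?_, hGr⟩
  · have h1 := (hρ.differentiable (by simp) 0).hasDerivAt
    rw [← hσ0] at h1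
    have := (h1.comp (0 : ℝ) hσd).deriv
    rw [hσ0, mul_one] at this
    rw [← this] at hρ1
    exact hρ1
  · have hc : HasDerivAt (fun t : ℝ => (((0 : ℝ), (0 : ℝ), t) : R3)) (0, 0, 1) 0 :=
      (hasDerivAt_const _ _).prodMk ((hasDerivAt_const _ _).prodMk (hasDerivAt_id _))
    have hVc := hV.hasDerivAt_comp hc
    have hV0' : V (0, 0, 0) = 0 := hV0
    have hq : HasDerivAt (fun t : ℝ => (((0 : ℝ), (0 : ℝ), V (0, 0, t) ^ 2) : R3)) 0 0 := by
      have := hVc.pow 2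
      simp only [hV0'] at this
      refine ((hasDerivAt_const _ _).prodMk ((hasDerivAt_const _ _).prodMk this)).congr_deriv ?_
      simp
    have h1 := (hE.hasDerivAt_comp hq).add (hVc.mul (hτ.hasDerivAt_comp hq))
    have h2 := hc.continuousAt.tendsto.eventually hTΘ
    simp only [hγ0, sub_zero] at h2
    have h3 := (hasDerivAt_id (0 : ℝ)).unique (h1.congr_of_eventuallyEq h2)
    simp only [hV0', map_zero, zero_add, mul_zero, add_zero] at h3
    intro h4
    have h5 : τ (0, 0, 0 ^ 2) = 0 := by simp; exact h4
    rw [h5, mul_zero] at h3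
    exact one_ne_zero h3
  · have hc : HasDerivAt (fun t : ℝ => (((0 : ℝ), t, (0 : ℝ)) : R3)) (0, 1, 0) 0 :=
      (hasDerivAt_const _ _).prodMk ((hasDerivAt_id _).prodMk (hasDerivAt_const _ _))
    have hVc := hV.hasDerivAt_comp hc
    have hV0' : V (0, 0, 0) = 0 := hV0
    have hq : HasDerivAt (fun t : ℝ => (((0 : ℝ), t, V (0, t, 0) ^ 2) : R3)) (0, 1, 0) 0 := by
      have := hVc.pow 2
      simp only [hV0'] at this
      refine ((hasDerivAt_const _ _).prodMk ((hasDerivAt_id _).prodMk this)).congr_deriv ?_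
      simp
    have h1 := (hS₀.hasDerivAt_comp hq).add (hVc.mul (hS₁.hasDerivAt_comp hq))
    have h2 := hc.continuousAt.tendsto.eventually hSΘ
    simp only [hγ0, sub_zero] at h2
    have h3 := (hS.hasDerivAt_comp hc).unique (h1.congr_of_eventuallyEq h2)
    have z : ((0 : ℝ), (0 : ℝ), (0 : ℝ) ^ 2) = (0 : R3) := by simp
    have z' : ((0 : ℝ), (0 : ℝ), (0 : ℝ)) = (0 : R3) := rfl
    simp only [hV0', z, hS₁0, mul_zero, add_zero, zero_mul] at h3
    rw [z'] at h3
    rwa [← h3]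
  · have hc : HasDerivAt (fun s : ℝ => ((s, ρ s) : R2)) (1, deriv ρ 0) 0 :=
      (hasDerivAt_id _).prodMk (hρ.differentiable (by simp) 0).hasDerivAt
    have h1 := hG.hasDerivAt_comp hc
    have h2 : ∀ᶠ s in 𝓝 (0 : ℝ), G (s, ρ s) = (x s, 0, 0) := by
      have := hedge.mono fun s h => h.1
      rw [eventually_nhdsWithin_iff] at this
      filter_upwards [this] with s hs
      by_cases h : s = 0
      · rw [h, hρ0, hx0]; exact hG0
      · exact hs h
    have h3 : HasDerivAt (fun s => ((x s, 0, 0) : R3)) (1, 0, 0) 0 :=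
      hx.prodMk ((hasDerivAt_const _ _).prodMk (hasDerivAt_const _ _))
    have h4 := h1.unique (h3.congr_of_eventuallyEq h2)
    rw [hρ0] at h4
    have h5 : ((1, deriv ρ 0) : R2) = (1, 0) + deriv ρ 0 • ((0, 1) : R2) := by simp
    rw [h5, map_add, map_smul] at h4
    change fderiv ℝ G 0 (1, 0) + deriv ρ 0 • fderiv ℝ G 0 (0, 1) = _ at h4
    rw [hGr] at h4
    simpa using h4

end EdgeForm

section Core

theorem exists_edgeForm_of_primitives {a b B₂ B₃ g h : ℝ → ℝ} {ε : ℝ} (ha : ContDiff ℝ ∞ a)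
    (hb : ContDiff ℝ ∞ b) (hB₂ : ContDiff ℝ ∞ B₂) (hB₃ : ContDiff ℝ ∞ B₃) (hg : ContDiff ℝ ∞ g)
    (hh : ContDiff ℝ ∞ h) (hε : ε ≠ 0) (ha0 : a 0 = 0) (hb0 : b 0 = 0) (hB₂0 : B₂ 0 = 0)
    (hB₃0 : B₃ 0 = 0) (hg0 : g 0 = 0) (hh0 : h 0 = 0) (hg1 : deriv g 0 ≠ 0) (hh1 : deriv h 0 ≠ 0)
    (hda : ∀ᶠ s in 𝓝 (0 : ℝ), HasDerivAt a (g s) s)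
    (hdb : ∀ᶠ s in 𝓝 (0 : ℝ), HasDerivAt b (g s ^ 2) s)
    (hdB₂ : ∀ᶠ r in 𝓝 (0 : ℝ), HasDerivAt B₂ (2 * ε * r * h r) r)
    (hdB₃ : ∀ᶠ r in 𝓝 (0 : ℝ), HasDerivAt B₃ (2 * ε * r * h r ^ 2) r) :
    ∃ (Q : R3 → R3) (E τ S₀ S₁ : R3 → ℝ) (R : ℝ → ℝ) (v : R2 → ℝ),
      IsDiffeoGerm Q 0 ∧ Q 0 = 0 ∧
      EdgeForm (fun q => Q (q.1 + ε * q.2 ^ 2, a q.1 + B₂ q.2, b q.1 + B₃ q.2)) E τ S₀ S₁ R v := by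
  have hdiff : ∀ f : ℝ → ℝ, ContDiff ℝ ∞ f → ∀ x, HasDerivAt f (deriv f x) x := fun f hf x =>
    (hf.differentiable (by simp) x).hasDerivAt
  have hdg : ContDiff ℝ ∞ (deriv g) := (contDiff_infty_iff_deriv.1 hg).2
  have hdh : ContDiff ℝ ∞ (deriv h) := (contDiff_infty_iff_deriv.1 hh).2
  obtain ⟨l, hl, hle, -⟩ := exists_eq_pow_mul hdg 0 hg0 (Eventually.of_forall fun r => by
    simpa using hdiff g hg r)
  obtain ⟨k, hk, hke, hk0⟩ := exists_eq_pow_mul hdh 0 hh0 (Eventually.of_forall fun r => by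
    simpa using hdiff h hh r)
  obtain ⟨α, hα, hαe, -⟩ := exists_eq_pow_mul hl 1 ha0 (by
    filter_upwards [hda, hle] with s h1 h2
    rwa [h2] at h1)
  obtain ⟨β, hβ, hβe, -⟩ := exists_eq_pow_mul (φ := fun s => l s ^ 2) (by fun_prop) 2 hb0 (by
    filter_upwards [hdb, hle] with s h1 h2
    rw [h2] at h1
    exact h1.congr_deriv (by ring))
  obtain ⟨m, hm, hme, hm0⟩ := exists_eq_pow_mul (φ := fun r => 2 * ε * k r) (by fun_prop) 2 hB₂0 (by
    filter_upwards [hdB₂, hke] with s h1 h2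
    rw [h2] at h1
    exact h1.congr_deriv (by ring))
  obtain ⟨n, hn, hne, hn0⟩ := exists_eq_pow_mul (φ := fun r => 2 * ε * k r ^ 2) (by fun_prop) 3 hB₃0
    (by
    filter_upwards [hdB₃, hke] with s h1 h2
    rw [h2] at h1
    exact h1.congr_deriv (by ring))
  obtain ⟨m₀, m₁, hm₀, hm₁, hme'⟩ := exists_even_odd_real hm
  obtain ⟨n₀, n₁, hn₀, hn₁, hne'⟩ := exists_even_odd_real hn
  have hk0' : k 0 ≠ 0 := by rw [hk0]; simpa using hh1
  have hm₀0 : m₀ 0 ≠ 0 := by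
    have h1 := hme'.self_of_nhds
    have h2 : m₀ 0 = m 0 := by simpa using h1.symm
    rw [h2, hm0]; positivity
  have hn₀0 : n₀ 0 ≠ 0 := by
    have h1 := hne'.self_of_nhds
    have h2 : n₀ 0 = n 0 := by simpa using h1.symm
    rw [h2, hn0]; positivity
  obtain ⟨μ, hμ, hμe⟩ := exists_contDiff_inv hm₀ hm₀0
  set S : R3 → ℝ := fun q => (q.2.1 - a (q.1 - ε * q.2.2) - q.2.2 ^ 2 * m₁ q.2.2) * μ q.2.2
    with hSdef
  have hS : ContDiff ℝ ∞ S := by fun_prop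
  set Λ : R2 × ℝ → ℝ := fun q => b (q.1.1 - ε * q.2) + q.2 ^ 2 * n₀ q.2
    + q.2 * n₁ q.2 * S (q.1.1, q.1.2, q.2) with hΛdef
  have hΛ : ContDiff ℝ ∞ Λ := by fun_prop
  have ht1 : Tendsto (fun t : ℝ => -ε * t) (𝓝 0) (𝓝 0) := by
    have := (by fun_prop : Continuous fun t : ℝ => -ε * t).tendsto 0
    simpa using this
  obtain ⟨V, Λ₀, K, hV, hΛ₀, hK, hV0, hΛ₀0, hV1, hVe⟩ := parametric_morse hΛ
    (N := fun t => -ε ^ 3 * t * β (-ε * t) + n₀ t +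
      t * n₁ t * (-ε ^ 2 * α (-ε * t) - m₁ t) * μ t) (by fun_prop) (by simpa using hn₀0) (by
      filter_upwards [ht1.eventually hαe, ht1.eventually hβe] with t h1 h2
      simp only [hΛdef, hSdef, Prod.fst_zero, Prod.snd_zero]
      rw [show 0 - ε * t = -ε * t by ring, h1, h2]
      ring)
  -- the edge
  obtain ⟨ρ, hρ, hρ0, hρe⟩ := exists_implicit (Φ := fun q : ℝ × ℝ => g q.1 - h q.2) (by fun_prop)
    (q₀ := 0) (p₀ := 0) (by simp [hg0, hh0]) (by
      intro w hw
      have h1 := (show ContDiff ℝ ∞ fun q : ℝ × ℝ => g q.1 - h q.2 by fun_prop).hasDerivAt_comp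
        ((hasDerivAt_const (0 : ℝ) (0 : ℝ)).prodMk ((hasDerivAt_id (0 : ℝ)).mul_const w))
      have h2 : HasDerivAt (fun t : ℝ => g 0 - h (t * w)) (-(deriv h 0 * w)) 0 := by
        have h3 := (hdiff h hh (0 * w)).scomp (0 : ℝ) ((hasDerivAt_id (0 : ℝ)).mul_const w)
        exact (h3.const_sub (g 0)).congr_deriv (by simp; ring)
      have h3 := h1.unique h2
      simp only [id, zero_mul, one_mul] at h3
      rw [hw] at h3
      have h4 : deriv h 0 * w = 0 := by linarith
      exact (mul_eq_zero.1 h4).resolve_left hh1)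
  have hρ1 : deriv ρ 0 ≠ 0 := by
    intro h0
    have h1 := hdiff h hh (ρ 0)
    have h2 := h1.comp (0 : ℝ) (hdiff ρ hρ 0)
    have h3 : HasDerivAt (h ∘ ρ) (deriv g 0) 0 := (hdiff g hg 0).congr_of_eventuallyEq (by
      filter_upwards [hρe] with s hs
      exact (sub_eq_zero.1 hs).symm)
    have h4 := h2.unique h3
    rw [h0, mul_zero] at h4
    exact hg1 h4.symm
  have hρt : Tendsto ρ (𝓝 0) (𝓝 0) := by
    have := hρ.continuous.tendsto 0
    rwa [hρ0] at this
  set F : R2 → R3 := fun q => (q.1 + ε * q.2 ^ 2, a q.1 + B₂ q.2, b q.1 + B₃ q.2) with hFdef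
  have hF : ContDiff ℝ ∞ F := by fun_prop
  have hF0 : F 0 = 0 := by simp [hFdef, ha0, hb0, hB₂0, hB₃0]
  have hkey : ∀ᶠ s in 𝓝 (0 : ℝ), fderiv ℝ F (s, ρ s) (-(2 * ε * ρ s), 1) = 0 := by
    filter_upwards [hda, hdb, hρt.eventually hdB₂, hρt.eventually hdB₃, hρe] with s h1 h2 h3 h4 h5
    set κ := -(2 * ε * ρ s) with hκ
    have hc1 : HasDerivAt (fun t => s + t * κ) κ 0 := by
      simpa using ((hasDerivAt_id (0 : ℝ)).mul_const κ).const_add s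
    have hc2 : HasDerivAt (fun t => ρ s + t) 1 0 := by
      simpa using (hasDerivAt_id (0 : ℝ)).const_add (ρ s)
    have e1 : s + 0 * κ = s := by ring
    have e2 : ρ s + 0 = ρ s := by ring
    have h6 := hF.hasDerivAt_comp (hc1.prodMk hc2)
    rw [e1, e2] at h6
    rw [← e1] at h1 h2
    rw [← e2] at h3 h4
    have h7 : HasDerivAt (fun t => F (s + t * κ, ρ s + t)) 0 0 := by
      have c1 := hc1.fun_add ((hc2.fun_pow 2).const_mul ε)
      have c2 := (h1.comp (0 : ℝ) hc1).fun_add (h3.comp (0 : ℝ) hc2)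
      have c3 := (h2.comp (0 : ℝ) hc1).fun_add (h4.comp (0 : ℝ) hc2)
      refine (c1.prodMk (c2.prodMk c3)).congr_deriv ?_
      have hgh : g s = h (ρ s) := sub_eq_zero.1 h5
      rw [e1, e2, hgh, hκ]
      refine Prod.ext ?_ (Prod.ext ?_ ?_) <;> simp <;> ring
    exact h6.unique h7
  refine exists_edgeForm hF hF0 ?_ hρ hρ0 hρ1 (hkey.mono fun s hs => ⟨_, hs⟩) ?_
    (V := fun q => V ((q.1, q.2.1), q.2.2)) (by fun_prop) hS hΛ₀ hK hV0 hΛ₀0 ?_ ?_ ?_ ?_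
  · have := hkey.self_of_nhds
    simp only [hρ0, mul_zero, neg_zero] at this
    exact this
  · have h1 := (hasDerivAt_id (0 : ℝ)).fun_add (((hdiff ρ hρ 0).fun_pow 2).const_mul ε)
    exact h1.congr_deriv (by simp [hρ0])
  · have hc : HasDerivAt (fun t : ℝ => (((0 : ℝ), (0 : ℝ), t) : R3)) (0, 0, 1) 0 :=
      (hasDerivAt_const _ _).prodMk ((hasDerivAt_const _ _).prodMk (hasDerivAt_id _))
    have hc' : HasDerivAt (fun t : ℝ => (((0 : ℝ), (0 : ℝ)), t)) ((0, 0), 1) 0 :=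
      ((hasDerivAt_const _ _).prodMk (hasDerivAt_const _ _)).prodMk (hasDerivAt_id _)
    have h1 := (show ContDiff ℝ ∞ fun q : R3 => V ((q.1, q.2.1), q.2.2) by fun_prop).hasDerivAt_comp
      hc
    have h2 := h1.unique (hV.hasDerivAt_comp hc')
    change fderiv ℝ (fun q : R3 => V ((q.1, q.2.1), q.2.2)) 0 (0, 0, 1) = fderiv ℝ V 0 (0, 1) at h2
    rw [h2]
    exact hV1
  · have hc : HasDerivAt (fun t : ℝ => (((0 : ℝ), t, (0 : ℝ)) : R3)) (0, 1, 0) 0 :=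
      (hasDerivAt_const _ _).prodMk ((hasDerivAt_id _).prodMk (hasDerivAt_const _ _))
    have h1 := hS.hasDerivAt_comp hc
    have h2 : HasDerivAt (fun t : ℝ => S (0, t, 0)) (μ 0) 0 := by
      have := (((hasDerivAt_id (0 : ℝ)).sub_const (a (0 - ε * 0))).sub_const
        (0 ^ 2 * m₁ 0)).mul_const (μ 0)
      exact this.congr_deriv (by simp)
    have h3 := h1.unique h2
    change fderiv ℝ S 0 (0, 1, 0) = μ 0 at h3
    rw [h3]
    intro h0
    have := hμe.self_of_nhds
    rw [h0, zero_mul] at this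
    exact zero_ne_one this
  all_goals
    have hr : Tendsto (fun q : R2 => q.2) (𝓝 0) (𝓝 0) := continuous_snd.tendsto (0 : R2)
    have hr2 : Tendsto (fun q : R2 => q.2 ^ 2) (𝓝 0) (𝓝 0) := by
      have := (by fun_prop : Continuous fun q : R2 => q.2 ^ 2).tendsto 0
      simpa using this
    have hSe : ∀ᶠ q in 𝓝 (0 : R2), q.2 ^ 3 = S ((F q).1, (F q).2.1, q.2 ^ 2) := by
      filter_upwards [hr.eventually hme, hr.eventually hme', hr2.eventually hμe] with q h1 h2 h3
      simp only [hSdef, hFdef, add_sub_cancel_right]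
      rw [h1, h2]
      linear_combination (-q.2 ^ 3) * h3
  · exact hSe
  · have hFt : Tendsto (fun q : R2 => ((((F q).1, (F q).2.1), q.2 ^ 2) : R2 × ℝ)) (𝓝 0) (𝓝 0) := by
      have : Continuous (fun q : R2 => ((((F q).1, (F q).2.1), q.2 ^ 2) : R2 × ℝ)) := by
        have := hF.continuous
        fun_prop
      have := this.tendsto 0
      simp only [hF0, Prod.fst_zero, Prod.snd_zero, ne_eq, OfNat.ofNat_ne_zero, not_false_eq_true,
        zero_pow] at this
      exact this
    filter_upwards [hSe, hFt.eventually hVe, hr.eventually hne, hr.eventually hne'] with q h1 h2 h3 h4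
    rw [← h2]
    simp only [hΛdef]
    rw [← h1]
    simp only [hFdef, add_sub_cancel_right]
    rw [h3, h4]
    ring

end Core

section Reparametrization

/-! If `r² = E + v τ`, `r³ = S₀ + v S₁` and `v² = Z`, then `r + c r² + d r³` satisfies relations
of the same shape, with the coefficients below. -/

/-- The even part of `(r + c r² + d r³)²`. -/
def sqEven (E τ S₀ S₁ Z c d : ℝ) : ℝ :=
  E + 2 * c * S₀ + (c ^ 2 + 2 * d) * (E ^ 2 + τ ^ 2 * Z) + 2 * c * d * (E * S₀ + τ * S₁ * Z)
    + d ^ 2 * (E ^ 3 + 3 * E * τ ^ 2 * Z)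

/-- The odd part of `(r + c r² + d r³)²`. -/
def sqOdd (E τ S₀ S₁ Z c d : ℝ) : ℝ :=
  τ + 2 * c * S₁ + (c ^ 2 + 2 * d) * (2 * E * τ) + 2 * c * d * (E * S₁ + τ * S₀)
    + d ^ 2 * (3 * E ^ 2 * τ + τ ^ 3 * Z)

/-- The even part of `(r + c r² + d r³)³`. -/
def cubeEven (E τ S₀ S₁ Z c d : ℝ) : ℝ :=
  S₀ + 3 * c * (E ^ 2 + τ ^ 2 * Z) + (3 * c ^ 2 + 3 * d) * (E * S₀ + τ * S₁ * Z)
    + (c ^ 3 + 6 * c * d) * (E ^ 3 + 3 * E * τ ^ 2 * Z)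
    + (3 * c ^ 2 * d + 3 * d ^ 2) * ((E ^ 2 + τ ^ 2 * Z) * S₀ + 2 * E * τ * S₁ * Z)
    + 3 * c * d ^ 2 * ((E ^ 2 + τ ^ 2 * Z) ^ 2 + 4 * E ^ 2 * τ ^ 2 * Z)
    + d ^ 3 * ((E ^ 3 + 3 * E * τ ^ 2 * Z) * S₀ + (3 * E ^ 2 * τ + τ ^ 3 * Z) * S₁ * Z)

/-- The odd part of `(r + c r² + d r³)³`. -/
def cubeOdd (E τ S₀ S₁ Z c d : ℝ) : ℝ :=
  S₁ + 3 * c * (2 * E * τ) + (3 * c ^ 2 + 3 * d) * (E * S₁ + τ * S₀)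
    + (c ^ 3 + 6 * c * d) * (3 * E ^ 2 * τ + τ ^ 3 * Z)
    + (3 * c ^ 2 * d + 3 * d ^ 2) * ((E ^ 2 + τ ^ 2 * Z) * S₁ + 2 * E * τ * S₀)
    + 3 * c * d ^ 2 * (4 * E * τ * (E ^ 2 + τ ^ 2 * Z))
    + d ^ 3 * ((E ^ 3 + 3 * E * τ ^ 2 * Z) * S₁ + (3 * E ^ 2 * τ + τ ^ 3 * Z) * S₀)

theorem sq_eq_sqEven_add {r v E τ S₀ S₁ Z : ℝ} (c d : ℝ) (h₂ : r ^ 2 = E + v * τ)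
    (h₃ : r ^ 3 = S₀ + v * S₁) (hv : v ^ 2 = Z) :
    (r + c * r ^ 2 + d * r ^ 3) ^ 2 =
      sqEven E τ S₀ S₁ Z c d + v * sqOdd E τ S₀ S₁ Z c d := by
  have h : (r + c * r ^ 2 + d * r ^ 3) ^ 2 = r ^ 2 + 2 * c * r ^ 3 + (c ^ 2 + 2 * d) * (r ^ 2) ^ 2
    + 2 * c * d * (r ^ 2 * r ^ 3) + d ^ 2 * (r ^ 2) ^ 3 := by ring
  rw [h, h₂, h₃, ← hv]
  unfold sqEven sqOdd
  ring

theorem cube_eq_cubeEven_add {r v E τ S₀ S₁ Z : ℝ} (c d : ℝ) (h₂ : r ^ 2 = E + v * τ)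
    (h₃ : r ^ 3 = S₀ + v * S₁) (hv : v ^ 2 = Z) :
    (r + c * r ^ 2 + d * r ^ 3) ^ 3 =
      cubeEven E τ S₀ S₁ Z c d + v * cubeOdd E τ S₀ S₁ Z c d := by
  have h : (r + c * r ^ 2 + d * r ^ 3) ^ 3 = r ^ 3 + 3 * c * (r ^ 2) ^ 2
      + (3 * c ^ 2 + 3 * d) * (r ^ 2 * r ^ 3) + (c ^ 3 + 6 * c * d) * (r ^ 2) ^ 3
      + (3 * c ^ 2 * d + 3 * d ^ 2) * ((r ^ 2) ^ 2 * r ^ 3) + 3 * c * d ^ 2 * (r ^ 2) ^ 4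
      + d ^ 3 * ((r ^ 2) ^ 3 * r ^ 3) := by ring
  rw [h, h₂, h₃, ← hv]
  unfold cubeEven cubeOdd
  ring

/-- The obstruction to bringing the pair of relations to the form satisfied by cuspidal beaks. -/
def beaksDefect (E τ S₀ S₁ Z c d : ℝ) : ℝ :=
  sqOdd E τ S₀ S₁ Z c d ^ 2 * sqEven E τ S₀ S₁ Z c d - 4 / 9 * cubeOdd E τ S₀ S₁ Z c d ^ 2

theorem cubeOdd_edge (R τ c d : ℝ) :
    cubeOdd (R ^ 2) τ (R ^ 3) (3 / 2 * τ * R) 0 c d =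
      3 / 2 * sqOdd (R ^ 2) τ (R ^ 3) (3 / 2 * τ * R) 0 c d * (R + c * R ^ 2 + d * R ^ 3) := by
  unfold cubeOdd sqOdd
  ring

theorem beaksDefect_edge (R τ c d : ℝ) :
    beaksDefect (R ^ 2) τ (R ^ 3) (3 / 2 * τ * R) 0 c d = 0 := by
  have h : sqEven (R ^ 2) τ (R ^ 3) (3 / 2 * τ * R) 0 c d = (R + c * R ^ 2 + d * R ^ 3) ^ 2 := by
    unfold sqEven
    ring
  rw [beaksDefect, cubeOdd_edge, h]
  ring

theorem hasDerivAt_beaksDefect {e θ s₀ s₁ ζ : ℝ → ℝ} {e' s₀' ζ' : ℝ} (c d : ℝ)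
    (he : HasDerivAt e e' 0) (hθ : DifferentiableAt ℝ θ 0) (hs₀ : HasDerivAt s₀ s₀' 0)
    (hs₁ : DifferentiableAt ℝ s₁ 0) (hζ : HasDerivAt ζ ζ' 0) (he0 : e 0 = 0) (hs₀0 : s₀ 0 = 0)
    (hs₁0 : s₁ 0 = 0) (hζ0 : ζ 0 = 0) :
    HasDerivAt (fun t => beaksDefect (e t) (θ t) (s₀ t) (s₁ t) (ζ t) c d)
      (θ 0 ^ 2 * (e' + 2 * c * s₀' + (c ^ 2 + 2 * d) * (θ 0 ^ 2 * ζ'))) 0 := by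
  have ed := he.differentiableAt
  have s₀d := hs₀.differentiableAt
  have ζd := hζ.differentiableAt
  have h1 : HasDerivAt (fun t => sqEven (e t) (θ t) (s₀ t) (s₁ t) (ζ t) c d)
      (e' + 2 * c * s₀' + (c ^ 2 + 2 * d) * (θ 0 ^ 2 * ζ')) 0 := by
    have p1 : DifferentiableAt ℝ (fun t => (c ^ 2 + 2 * d) * e t + 2 * c * d * s₀ t
      + d ^ 2 * (e t ^ 2 + 3 * θ t ^ 2 * ζ t)) 0 := by fun_prop
    have p2 : DifferentiableAt ℝ (fun t => 2 * c * d * θ t * s₁ t) 0 := by fun_prop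
    have p3 := ((((he.fun_add (hs₀.const_mul (2 * c))).fun_add
      (((hθ.hasDerivAt.fun_pow 2).fun_mul hζ).const_mul (c ^ 2 + 2 * d))).fun_add
      (he.fun_mul p1.hasDerivAt)).fun_add (hζ.fun_mul p2.hasDerivAt))
    refine (p3.congr_deriv ?_).congr_of_eventuallyEq (Eventually.of_forall fun t => ?_)
    · simp [he0, hs₀0, hs₁0, hζ0]
    · simp only [sqEven]; ring
  have h2 : DifferentiableAt ℝ (fun t => sqOdd (e t) (θ t) (s₀ t) (s₁ t) (ζ t) c d) 0 := by
    unfold sqOdd; fun_prop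
  have h3 : DifferentiableAt ℝ (fun t => cubeOdd (e t) (θ t) (s₀ t) (s₁ t) (ζ t) c d) 0 := by
    unfold cubeOdd; fun_prop
  have h4 := ((h2.hasDerivAt.fun_pow 2).fun_mul h1).fun_sub ((h3.hasDerivAt.fun_pow 2).const_mul (4 / 9))
  refine h4.congr_deriv ?_
  simp [sqEven, sqOdd, cubeOdd, he0, hs₀0, hs₁0, hζ0]

variable {G : R2 → R3} {E τ S₀ S₁ : R3 → ℝ} {R : ℝ → ℝ} {v : R2 → ℝ}

theorem EdgeForm.values_zero (H : EdgeForm G E τ S₀ S₁ R v) : E 0 = 0 ∧ S₀ 0 = 0 ∧ S₁ 0 = 0 := by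
  have h1 := H.edge_E.self_of_nhds
  have h2 := H.edge_S₀.self_of_nhds
  have h3 := H.edge_S₁.self_of_nhds
  rw [H.R_zero] at h1 h2 h3
  change E 0 = _ at h1
  change S₀ 0 = _ at h2
  change 2 * S₁ 0 = _ at h3
  refine ⟨by simpa using h1, by simpa using h2, by linarith⟩

theorem EdgeForm.exists_beaksDefect_eq_zero (H : EdgeForm G E τ S₀ S₁ R v) :
    ∃ c d : R3 → ℝ, ContDiff ℝ ∞ c ∧ ContDiff ℝ ∞ d ∧
      ∀ᶠ q in 𝓝 (0 : R3), beaksDefect (E q) (τ q) (S₀ q) (S₁ q) q.2.2 (c q) (d q) = 0 := by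
  obtain ⟨hE0, hS₀0, hS₁0⟩ := H.values_zero
  have hE := H.smooth_E
  have hτ := H.smooth_τ
  have hS₀ := H.smooth_S₀
  have hS₁ := H.smooth_S₁
  set φ : (ℝ × ℝ × ℝ) × ℝ × ℝ → ℝ := fun q => beaksDefect (E (q.1.1, q.2)) (τ (q.1.1, q.2))
    (S₀ (q.1.1, q.2)) (S₁ (q.1.1, q.2)) q.2.2 q.1.2.1 q.1.2.2 with hφdef
  have hφ : ContDiff ℝ ∞ φ := by
    rw [hφdef]
    unfold beaksDefect sqOdd sqEven cubeOdd
    fun_prop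
  obtain ⟨φ₁, φ₂, hφ₁, hφ₂, hφe, hφ₁0, hφ₂0⟩ := hadamard_two hφ
  set t₀ := τ 0 with ht₀
  have ht₀n : t₀ ≠ 0 := H.τ_zero
  set eJ := fderiv ℝ E 0 (0, 1, 0)
  set eZ := fderiv ℝ E 0 (0, 0, 1)
  set sJ := fderiv ℝ S₀ 0 (0, 1, 0) with hsJ
  set sZ := fderiv ℝ S₀ 0 (0, 0, 1)
  have hsJn : sJ ≠ 0 := H.S₀_deriv
  have hJ : HasDerivAt (fun t : ℝ => (((0 : ℝ), t, (0 : ℝ)) : R3)) (0, 1, 0) 0 :=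
    (hasDerivAt_const _ _).prodMk ((hasDerivAt_id _).prodMk (hasDerivAt_const _ _))
  have hZ : HasDerivAt (fun t : ℝ => (((0 : ℝ), (0 : ℝ), t) : R3)) (0, 0, 1) 0 :=
    (hasDerivAt_const _ _).prodMk ((hasDerivAt_const _ _).prodMk (hasDerivAt_id _))
  have v1 : ∀ c d : ℝ, φ₁ ((0, c, d), 0, 0) = t₀ ^ 2 * (eJ + 2 * c * sJ) := by
    intro c d
    rw [hφ₁0]
    have c1 : HasDerivAt (fun t : ℝ => (((0, c, d), t, 0) : (ℝ × ℝ × ℝ) × ℝ × ℝ)) (0, 1, 0) 0 :=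
      (hasDerivAt_const _ _).prodMk ((hasDerivAt_id _).prodMk (hasDerivAt_const _ _))
    have c2 := hasDerivAt_beaksDefect c d (hE.hasDerivAt_comp hJ)
      (hτ.hasDerivAt_comp hJ).differentiableAt (hS₀.hasDerivAt_comp hJ)
      (hS₁.hasDerivAt_comp hJ).differentiableAt (hasDerivAt_const (0 : ℝ) (0 : ℝ))
      hE0 hS₀0 hS₁0 rfl
    rw [mul_zero, mul_zero, add_zero] at c2
    exact (hφ.hasDerivAt_comp c1).unique c2
  have v2 : ∀ c d : ℝ, φ₂ ((0, c, d), 0, 0) =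
      t₀ ^ 2 * (eZ + 2 * c * sZ + (c ^ 2 + 2 * d) * t₀ ^ 2) := by
    intro c d
    rw [hφ₂0]
    have c1 : HasDerivAt (fun t : ℝ => (((0, c, d), 0, t) : (ℝ × ℝ × ℝ) × ℝ × ℝ)) (0, 0, 1) 0 :=
      (hasDerivAt_const _ _).prodMk ((hasDerivAt_const _ _).prodMk (hasDerivAt_id _))
    have c2 := hasDerivAt_beaksDefect c d (hE.hasDerivAt_comp hZ)
      (hτ.hasDerivAt_comp hZ).differentiableAt (hS₀.hasDerivAt_comp hZ)
      (hS₁.hasDerivAt_comp hZ).differentiableAt (hasDerivAt_id (0 : ℝ))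
      hE0 hS₀0 hS₁0 rfl
    rw [mul_one] at c2
    exact (hφ.hasDerivAt_comp c1).unique c2
  set c₀ := -eJ / (2 * sJ) with hc₀
  set d₀ := (-(eZ + 2 * c₀ * sZ) / t₀ ^ 2 - c₀ ^ 2) / 2 with hd₀
  have hΞ : ContDiff ℝ ∞ (fun q : R3 × R2 => ((φ₁ ((q.1.1, q.2), q.1.2), φ₂ ((q.1.1, q.2), q.1.2)) : R2)) := by
    fun_prop
  obtain ⟨p, hp, hp0, hpe⟩ := exists_implicit hΞ (q₀ := 0) (p₀ := (c₀, d₀)) (by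
    refine Prod.ext ?_ ?_
    · refine (v1 c₀ d₀).trans ?_
      rw [hc₀]; field_simp; simp
    · refine (v2 c₀ d₀).trans ?_
      rw [hd₀]; field_simp; simp) (by
    rintro ⟨h, k⟩ hw
    have c1 : HasDerivAt (fun t : ℝ => (((0 : R3), (c₀ + t * h, d₀ + t * k)) : R3 × R2))
        (0, (h, k)) 0 := by
      refine (hasDerivAt_const _ _).prodMk (HasDerivAt.prodMk ?_ ?_)
      · simpa using ((hasDerivAt_id (0 : ℝ)).mul_const h).const_add c₀
      · simpa using ((hasDerivAt_id (0 : ℝ)).mul_const k).const_add d₀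
    have c2 := hΞ.hasDerivAt_comp c1
    have z1 : c₀ + 0 * h = c₀ := by ring
    have z2 : d₀ + 0 * k = d₀ := by ring
    rw [z1, z2, hw] at c2
    have l1 : HasDerivAt (fun t : ℝ => c₀ + t * h) h 0 := by
      simpa using ((hasDerivAt_id (0 : ℝ)).mul_const h).const_add c₀
    have l2 : HasDerivAt (fun t : ℝ => d₀ + t * k) k 0 := by
      simpa using ((hasDerivAt_id (0 : ℝ)).mul_const k).const_add d₀
    have c3 : HasDerivAt (fun t : ℝ => ((t₀ ^ 2 * (eJ + 2 * (c₀ + t * h) * sJ), t₀ ^ 2 * (eZ +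
        2 * (c₀ + t * h) * sZ + ((c₀ + t * h) ^ 2 + 2 * (d₀ + t * k)) * t₀ ^ 2)) : R2))
        (t₀ ^ 2 * (2 * h * sJ), t₀ ^ 2 * (2 * h * sZ + (2 * c₀ * h + 2 * k) * t₀ ^ 2)) 0 := by
      refine HasDerivAt.prodMk ?_ ?_
      · exact ((((l1.const_mul 2).mul_const sJ).const_add eJ).const_mul (t₀ ^ 2))
      · have := (((((l1.const_mul 2).mul_const sZ).const_add eZ).fun_add
          (((l1.fun_pow 2).fun_add (l2.const_mul 2)).mul_const (t₀ ^ 2))).const_mul (t₀ ^ 2))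
        exact this.congr_deriv (by simp)
    have c4 := c2.unique (c3.congr_of_eventuallyEq (Eventually.of_forall fun t =>
      Prod.ext (v1 (c₀ + t * h) (d₀ + t * k)) (v2 (c₀ + t * h) (d₀ + t * k))))
    obtain ⟨c5, c6⟩ := Prod.ext_iff.1 c4
    have e1 : h = 0 := by
      have : t₀ ^ 2 * (2 * h * sJ) = 0 := c5.symm
      simpa [ht₀n, hsJn] using this
    have e2 : k = 0 := by
      have : t₀ ^ 2 * (2 * h * sZ + (2 * c₀ * h + 2 * k) * t₀ ^ 2) = 0 := c6.symm
      simpa [ht₀n, e1] using this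
    rw [e1, e2]; rfl)
  refine ⟨fun q => (p q).1, fun q => (p q).2, by fun_prop, by fun_prop, ?_⟩
  have ht : Tendsto (fun q : R3 => q.1) (𝓝 0) (𝓝 0) := continuous_fst.tendsto (0 : R3)
  filter_upwards [hpe, ht.eventually H.edge_E, ht.eventually H.edge_S₀, ht.eventually H.edge_S₁]
    with q h1 h2 h3 h4
  have h5 := hφe (q.1, p q) q.2.1 q.2.2
  obtain ⟨h6, h7⟩ := Prod.ext_iff.1 h1
  change φ₁ ((q.1, p q), q.2.1, q.2.2) = 0 at h6
  change φ₂ ((q.1, p q), q.2.1, q.2.2) = 0 at h7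
  have h8 : φ ((q.1, p q), 0, 0) = 0 := by
    simp only [hφdef]
    rw [h2, h3, show S₁ (q.1, 0, 0) = 3 / 2 * τ (q.1, 0, 0) * R q.1 by linarith]
    exact beaksDefect_edge _ _ _ _
  rw [h6, h7, h8, mul_zero, mul_zero, add_zero, add_zero] at h5
  exact h5

end Reparametrization

section Beaks

variable {G : R2 → R3} {E τ S₀ S₁ : R3 → ℝ} {R : ℝ → ℝ} {v : R2 → ℝ}

theorem fCBK_eq_of_relations {ρ A Y Z : ℝ} (h₃ : (ρ + A) ^ 3 = Y + 3 * A * (ρ + A) ^ 2)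
    (hZ : ((ρ + A) ^ 2 - 4 * A ^ 2) ^ 2 = Z) :
    (√3 * A, Y + 2 * A ^ 3, 3 * (Z - 4 * A * (Y + 2 * A ^ 3) - 9 * A ^ 4)) =
      fCBK (ρ, √3 * A) := by
  have h : √3 ^ 2 = 3 := Real.sq_sqrt (by norm_num)
  have hY : Y = (ρ + A) ^ 3 - 3 * A * (ρ + A) ^ 2 := by linarith
  refine Prod.ext rfl (Prod.ext ?_ ?_)
  · simp only [fCBK, mul_pow, h, hY]
    ring
  · simp only [fCBK, mul_pow, h, hY, ← hZ]
    ring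

/-- The derivative of the target coordinate change; the coordinates are `√3 A`, `Y + 2 A³` and
`3 (Z - 4 A (Y + 2 A³) - 9 A⁴)`. -/
theorem isDiffeoGerm_beaksTarget {A Y Z : R3 → ℝ} (hA : ContDiff ℝ ∞ A) (hY : ContDiff ℝ ∞ Y)
    (hZ : ContDiff ℝ ∞ Z) (hA0 : A 0 = 0) (hY0 : Y 0 = 0)
    (hAd : fderiv ℝ A 0 (1, 0, 0) ≠ 0) (hYd : ∀ w : R3, w.2.2 = 0 → fderiv ℝ Y 0 w = 0 → w.2.1 = 0)
    (hZd : ∀ w : R3, fderiv ℝ Z 0 w = 0 → w.2.2 = 0) :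
    IsDiffeoGerm (fun q => ((√3 * A q, Y q + 2 * A q ^ 3,
      3 * (Z q - 4 * A q * (Y q + 2 * A q ^ 3) - 9 * A q ^ 4)) : R3)) 0 := by
  refine isDiffeoGerm_of_injective (by fun_prop) fun w hw => ?_
  have hline : HasDerivAt (fun t : ℝ => t • w) w 0 :=
    ((hasDerivAt_id (0 : ℝ)).smul_const w).congr_deriv (by simp)
  have h1 := (show ContDiff ℝ ∞ fun q => ((√3 * A q, Y q + 2 * A q ^ 3,
      3 * (Z q - 4 * A q * (Y q + 2 * A q ^ 3) - 9 * A q ^ 4)) : R3) by fun_prop).hasDerivAt_comp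
      hline
  have kA := hA.hasDerivAt_comp hline
  have kY := hY.hasDerivAt_comp hline
  have kZ := hZ.hasDerivAt_comp hline
  have y1 := kY.fun_add ((kA.fun_pow 3).const_mul 2)
  have h2 := (kA.const_mul √3).prodMk (y1.prodMk
    (((kZ.fun_sub ((kA.const_mul 4).fun_mul y1)).fun_sub ((kA.fun_pow 4).const_mul 9)).const_mul 3))
  have h3 := h1.unique h2
  simp only [zero_smul, hw, hA0, hY0] at h3
  simp only [Prod.ext_iff, Prod.fst_zero, Prod.snd_zero] at h3
  obtain ⟨h4, h5, h6⟩ := h3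
  have e3 : w.2.2 = 0 := hZd w (by simpa using h6.symm)
  have e2 : w.2.1 = 0 := hYd w e3 (by simpa using h5.symm)
  have e4 : w = w.1 • ((1, 0, 0) : R3) :=
    Prod.ext (by simp) (Prod.ext (by simp [e2]) (by simp [e3]))
  have e5 : fderiv ℝ A 0 w = 0 := by
    have : √3 ≠ 0 := by positivity
    exact (mul_eq_zero.1 h4.symm).resolve_left this
  rw [e4, map_smul, smul_eq_mul] at e5
  have e1 : w.1 = 0 := (mul_eq_zero.1 e5).resolve_right hAd
  rw [e4, e1, zero_smul]

theorem EdgeForm.exists_fCBK_eq (H : EdgeForm G E τ S₀ S₁ R v) :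
    ∃ (Φ : R2 → R2) (Ψ : R3 → R3), IsDiffeoGerm Φ 0 ∧ Φ 0 = 0 ∧ IsDiffeoGerm Ψ 0 ∧
      ∀ᶠ q in 𝓝 (0 : R2), Ψ (G q) = fCBK (Φ q) := by
  obtain ⟨hE0, hS₀0, hS₁0⟩ := H.values_zero
  have hG := H.smooth_G
  have hE := H.smooth_E
  have hτ := H.smooth_τ
  have hS₀ := H.smooth_S₀
  have hS₁ := H.smooth_S₁
  have hR := H.smooth_R
  have hG0 := H.G_zero
  obtain ⟨c, d, hc, hd, hcd⟩ := H.exists_beaksDefect_eq_zero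
  set e : R3 → ℝ := fun q => sqEven (E q) (τ q) (S₀ q) (S₁ q) q.2.2 (c q) (d q) with hedef
  set o : R3 → ℝ := fun q => sqOdd (E q) (τ q) (S₀ q) (S₁ q) q.2.2 (c q) (d q) with hodef
  set s : R3 → ℝ := fun q => cubeEven (E q) (τ q) (S₀ q) (S₁ q) q.2.2 (c q) (d q) with hsdef
  set t : R3 → ℝ := fun q => cubeOdd (E q) (τ q) (S₀ q) (S₁ q) q.2.2 (c q) (d q) with htdef
  have he : ContDiff ℝ ∞ e := by rw [hedef]; unfold sqEven; fun_prop
  have ho : ContDiff ℝ ∞ o := by rw [hodef]; unfold sqOdd; fun_prop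
  have hs : ContDiff ℝ ∞ s := by rw [hsdef]; unfold cubeEven; fun_prop
  have ht : ContDiff ℝ ∞ t := by rw [htdef]; unfold cubeOdd; fun_prop
  have he0 : e 0 = 0 := by simp [hedef, sqEven, hE0, hS₀0, hS₁0]
  have ho0 : o 0 = τ 0 := by simp [hodef, sqOdd, hE0, hS₀0, hS₁0]
  have hs0 : s 0 = 0 := by simp [hsdef, cubeEven, hE0, hS₀0, hS₁0]
  have ht0 : t 0 = 0 := by simp [htdef, cubeOdd, hE0, hS₀0, hS₁0]
  have hdef : ∀ᶠ q in 𝓝 (0 : R3), o q ^ 2 * e q = 4 / 9 * t q ^ 2 := by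
    filter_upwards [hcd] with q hq
    exact sub_eq_zero.1 hq
  obtain ⟨o', ho', hoo⟩ := exists_contDiff_inv ho (x₀ := 0) (by rw [ho0]; exact H.τ_zero)
  have ho'0 : o' 0 ≠ 0 := by
    intro h
    have := hoo.self_of_nhds
    rw [h, zero_mul] at this
    exact zero_ne_one this
  set A : R3 → ℝ := fun q => t q * o' q / 3 with hAdef
  have hA : ContDiff ℝ ∞ A := by fun_prop
  have hA0 : A 0 = 0 := by simp [hAdef, ht0]
  have hAe : ∀ᶠ q in 𝓝 (0 : R3), e q = 4 * A q ^ 2 := by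
    filter_upwards [hdef, hoo] with q h1 h2
    simp only [hAdef]
    linear_combination o' q ^ 2 * h1 - e q * (o' q * o q + 1) * h2
  set Y : R3 → ℝ := fun q => s q - 3 * A q * e q with hYdef
  set Z : R3 → ℝ := fun q => o q ^ 2 * q.2.2 with hZdef
  have hY : ContDiff ℝ ∞ Y := by fun_prop
  have hZ : ContDiff ℝ ∞ Z := by fun_prop
  have hY0 : Y 0 = 0 := by simp [hYdef, hs0, hA0]
  have hXline : HasDerivAt (fun x : ℝ => ((x, 0, 0) : R3)) (1, 0, 0) 0 :=
    (hasDerivAt_id _).prodMk ((hasDerivAt_const _ _).prodMk (hasDerivAt_const _ _))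
  have hXt : Tendsto (fun x : ℝ => ((x, 0, 0) : R3)) (𝓝 0) (𝓝 0) := hXline.continuousAt.tendsto
  -- first derivatives at the origin
  have hAX : fderiv ℝ A 0 (1, 0, 0) = deriv R 0 / 2 := by
    have h1 := hA.hasDerivAt_comp hXline
    have h2 : ∀ᶠ x in 𝓝 (0 : ℝ), A (x, 0, 0) =
        1 / 2 * (R x + c (x, 0, 0) * R x ^ 2 + d (x, 0, 0) * R x ^ 3) := by
      filter_upwards [hXt.eventually hoo, H.edge_E, H.edge_S₀, H.edge_S₁] with x h1 h2 h3 h4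
      have h5 : t (x, 0, 0) = 3 / 2 * o (x, 0, 0) *
          (R x + c (x, 0, 0) * R x ^ 2 + d (x, 0, 0) * R x ^ 3) := by
        simp only [htdef, hodef]
        rw [h2, h3, show S₁ (x, 0, 0) = 3 / 2 * τ (x, 0, 0) * R x by linarith]
        exact cubeOdd_edge _ _ _ _
      simp only [hAdef, h5]
      linear_combination (1 / 2 * (R x + c (x, 0, 0) * R x ^ 2 + d (x, 0, 0) * R x ^ 3)) * h1
    have hRd := (hR.differentiable (by simp) 0).hasDerivAt
    have h3 := (((hRd.fun_add ((hc.hasDerivAt_comp hXline).fun_mul (hRd.fun_pow 2))).fun_add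
      ((hd.hasDerivAt_comp hXline).fun_mul (hRd.fun_pow 3)))).const_mul (1 / 2)
    have h4 := h1.unique (h3.congr_of_eventuallyEq h2)
    rw [H.R_zero] at h4
    change fderiv ℝ A 0 (1, 0, 0) = _ at h4
    rw [h4]
    simp only [Nat.cast_ofNat, Nat.add_one_sub_one, zero_pow, ne_eq, OfNat.ofNat_ne_zero,
      not_false_eq_true, mul_zero, zero_mul, add_zero]
    ring
  have hS₀X : fderiv ℝ S₀ 0 (1, 0, 0) = 0 := by
    have h1 := hS₀.hasDerivAt_comp hXline
    have h2 := ((hR.differentiable (by simp) 0).hasDerivAt.fun_pow 3).congr_of_eventuallyEq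
      H.edge_S₀
    have h3 := h1.unique h2
    rw [H.R_zero] at h3
    change fderiv ℝ S₀ 0 (1, 0, 0) = _ at h3
    rw [h3]
    simp
  have hZd : ∀ w : R3, fderiv ℝ Z 0 w = 0 → w.2.2 = 0 := by
    intro w hw
    have hline : HasDerivAt (fun t : ℝ => t • w) w 0 :=
      ((hasDerivAt_id (0 : ℝ)).smul_const w).congr_deriv (by simp)
    have h1 := hZ.hasDerivAt_comp hline
    have h2 := ((ho.hasDerivAt_comp hline).fun_pow 2).fun_mul
      ((show ContDiff ℝ ∞ fun q : R3 => q.2.2 by fun_prop).hasDerivAt_comp hline)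
    have h3 : HasDerivAt (fun t : ℝ => (t • w).2.2) w.2.2 0 := by
      simpa using (hasDerivAt_id (0 : ℝ)).mul_const w.2.2
    have h4 := h1.unique (((ho.hasDerivAt_comp hline).fun_pow 2).fun_mul h3)
    simp only [zero_smul, hw, ho0, Prod.snd_zero, mul_zero, zero_add] at h4
    have h5 : τ 0 ^ 2 ≠ 0 := pow_ne_zero 2 H.τ_zero
    exact (mul_eq_zero.1 h4.symm).resolve_left h5
  have hYd : ∀ w : R3, w.2.2 = 0 → fderiv ℝ Y 0 w = 0 → w.2.1 = 0 := by
    intro w hw2 hw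
    have hline : HasDerivAt (fun t : ℝ => t • w) w 0 :=
      ((hasDerivAt_id (0 : ℝ)).smul_const w).congr_deriv (by simp)
    have h1 := hY.hasDerivAt_comp hline
    have h2 : HasDerivAt (fun t : ℝ => s (t • w)) (fderiv ℝ S₀ 0 w) 0 := by
      have kE := hE.hasDerivAt_comp hline
      have kS := hS₀.hasDerivAt_comp hline
      have kP := (show ContDiff ℝ ∞ fun q : R3 => 3 * c q * E q + (3 * c q ^ 2 + 3 * d q) * S₀ q
        + (c q ^ 3 + 6 * c q * d q) * E q ^ 2 + (3 * c q ^ 2 * d q + 3 * d q ^ 2) * E q * S₀ q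
        + 3 * c q * d q ^ 2 * E q ^ 3 + d q ^ 3 * E q ^ 2 * S₀ q by fun_prop).hasDerivAt_comp hline
      refine ((kS.fun_add (kE.fun_mul kP)).congr_deriv ?_).congr_of_eventuallyEq
        (Eventually.of_forall fun x => ?_)
      · simp [hE0, hS₀0]
      · simp only [hsdef, cubeEven, Prod.smul_snd, hw2, smul_zero]
        ring
    have h3 := h1.unique (h2.fun_sub (((hA.hasDerivAt_comp hline).const_mul 3).fun_mul
      (he.hasDerivAt_comp hline)))
    simp only [zero_smul, hw, hA0, he0, mul_zero, zero_mul, add_zero, sub_zero] at h3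
    have e4 : w = w.1 • ((1, 0, 0) : R3) + w.2.1 • ((0, 1, 0) : R3) :=
      Prod.ext (by simp) (Prod.ext (by simp) (by simp [hw2]))
    rw [e4, map_add, map_smul, map_smul, hS₀X, smul_zero, zero_add, smul_eq_mul] at h3
    exact (mul_eq_zero.1 h3.symm).resolve_right H.S₀_deriv
  -- the source coordinate change
  set Φ : R2 → R2 := fun q =>
    (q.2 + c (G q) * q.2 ^ 2 + d (G q) * q.2 ^ 3 - A (G q), √3 * A (G q)) with hΦdef
  have hΦ : ContDiff ℝ ∞ Φ := by fun_prop
  refine ⟨Φ, _, isDiffeoGerm_of_injective hΦ ?_, ?_, isDiffeoGerm_beaksTarget hA hY hZ hA0 hY0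
    (by rw [hAX]; exact div_ne_zero H.deriv_R two_ne_zero) hYd hZd, ?_⟩
  · intro w hw
    have hline : HasDerivAt (fun t : ℝ => t • w) w 0 :=
      ((hasDerivAt_id (0 : ℝ)).smul_const w).congr_deriv (by simp)
    have h1 := hΦ.hasDerivAt_comp hline
    have hGl := hG.hasDerivAt_comp hline
    have kc := hc.hasDerivAt_comp hGl
    have kd := hd.hasDerivAt_comp hGl
    have kA := hA.hasDerivAt_comp hGl
    have k2 : HasDerivAt (fun t : ℝ => (t • w).2) w.2 0 := by
      simpa using (hasDerivAt_id (0 : ℝ)).mul_const w.2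
    have h3 := h1.unique ((((k2.fun_add (kc.fun_mul (k2.fun_pow 2))).fun_add
      (kd.fun_mul (k2.fun_pow 3))).fun_sub kA).prodMk (kA.const_mul √3))
    have hw' : w = w.1 • ((1, 0) : R2) + w.2 • ((0, 1) : R2) := Prod.ext (by simp) (by simp)
    have h4 : fderiv ℝ G 0 w = w.1 • ((1, 0, 0) : R3) := by
      conv_lhs => rw [hw']
      rw [map_add, map_smul, map_smul, H.G_deriv_fst, H.G_deriv_snd, smul_zero, add_zero]
    simp only [zero_smul, hw, hG0, Prod.snd_zero, h4, map_smul, hAX] at h3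
    obtain ⟨h5, h6⟩ := Prod.ext_iff.1 h3
    have h7 : w.1 = 0 := by
      have h8 : √3 ≠ 0 := by positivity
      have h9 := (mul_eq_zero.1 h6.symm).resolve_left h8
      exact (mul_eq_zero.1 h9).resolve_right (div_ne_zero H.deriv_R two_ne_zero)
    have h8 : w.2 = 0 := by
      rw [h7] at h5
      simpa using h5.symm
    exact Prod.ext h7 h8
  · simp [hΦdef, hG0, hA0]
  · have hGt : Tendsto G (𝓝 0) (𝓝 0) := by
      have := hG.continuous.tendsto 0
      rwa [hG0] at this
    filter_upwards [H.sq_eq, H.cube_eq, H.v_sq, hGt.eventually hoo, hGt.eventually hAe]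
      with q h1 h2 h3 h4 h5
    have k2 := sq_eq_sqEven_add (c (G q)) (d (G q)) h1 h2 h3
    have k3 := cube_eq_cubeEven_add (c (G q)) (d (G q)) h1 h2 h3
    set r' := q.2 + c (G q) * q.2 ^ 2 + d (G q) * q.2 ^ 3 with hr'
    change r' ^ 2 = e (G q) + v q * o (G q) at k2
    change r' ^ 3 = s (G q) + v q * t (G q) at k3
    refine fCBK_eq_of_relations ?_ ?_
    · simp only [sub_add_cancel, hYdef]
      rw [k3, k2]
      simp only [hAdef]
      linear_combination (-(v q) * t (G q)) * h4
    · simp only [sub_add_cancel, hZdef]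
      rw [← h5, k2, ← h3]
      ring

end Beaks

section Sum

theorem IsDiffeoGerm.of_deriv_ne_zero {α : ℝ → ℝ} (hα : ContDiff ℝ ∞ α) {x₀ : ℝ}
    (h : deriv α x₀ ≠ 0) : IsDiffeoGerm α x₀ :=
  isDiffeoGerm_of_injective hα fun w hw => by
    rw [(hα.differentiable (by simp) x₀).hasDerivAt.hasFDerivAt.fderiv] at hw
    simpa [h] using hw

/-- The inverse function, with its derivative. -/
theorem exists_inverse {α : ℝ → ℝ} (hα : ContDiff ℝ ∞ α) (h0 : α 0 = 0) (h1 : deriv α 0 ≠ 0) :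
    ∃ χ : ℝ → ℝ, ContDiff ℝ ∞ χ ∧ χ 0 = 0 ∧ (∀ᶠ x in 𝓝 0, χ (α x) = x) ∧
      (∀ᶠ s in 𝓝 0, α (χ s) = s) ∧ deriv χ 0 ≠ 0 := by
  obtain ⟨-, χ, hχ, e1, e2, e3⟩ := IsDiffeoGerm.of_deriv_ne_zero hα h1
  rw [h0] at e1 e3
  refine ⟨χ, hχ, e1, e2, e3, fun h => ?_⟩
  have k1 := (hα.differentiable (by simp) (χ 0)).hasDerivAt.comp (0 : ℝ)
    (hχ.differentiable (by simp) 0).hasDerivAt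
  have k2 := k1.unique ((hasDerivAt_id (0 : ℝ)).congr_of_eventuallyEq e3)
  rw [h, mul_zero] at k2
  exact zero_ne_one k2

/-- Cuspidal beaks as a sum of an immersed curve and a `3/2`-cusp like curve, both
tangent to the directions `(1, γ, γ²)`. -/
theorem exists_fCBK_eq_of_sum {α₁ α₂ α₃ β₁ β₂ β₃ γ δ : ℝ → ℝ} (hα₁ : ContDiff ℝ ∞ α₁)
    (hα₂ : ContDiff ℝ ∞ α₂) (hα₃ : ContDiff ℝ ∞ α₃) (hβ₁ : ContDiff ℝ ∞ β₁)
    (hβ₂ : ContDiff ℝ ∞ β₂) (hβ₃ : ContDiff ℝ ∞ β₃) (hγ : ContDiff ℝ ∞ γ) (hδ : ContDiff ℝ ∞ δ)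
    (hα₁0 : α₁ 0 = 0) (hα₂0 : α₂ 0 = 0) (hα₃0 : α₃ 0 = 0) (hβ₁0 : β₁ 0 = 0) (hβ₂0 : β₂ 0 = 0)
    (hβ₃0 : β₃ 0 = 0) (hγ0 : γ 0 = 0) (hδ0 : δ 0 = 0) (hγ1 : deriv γ 0 ≠ 0) (hδ1 : deriv δ 0 ≠ 0)
    (hα₁1 : deriv α₁ 0 ≠ 0) (hβ₁1 : deriv β₁ 0 = 0) (hβ₁2 : deriv (deriv β₁) 0 ≠ 0)
    (hdα₂ : ∀ᶠ x in 𝓝 (0 : ℝ), HasDerivAt α₂ (γ x * deriv α₁ x) x)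
    (hdα₃ : ∀ᶠ x in 𝓝 (0 : ℝ), HasDerivAt α₃ (γ x ^ 2 * deriv α₁ x) x)
    (hdβ₂ : ∀ᶠ y in 𝓝 (0 : ℝ), HasDerivAt β₂ (δ y * deriv β₁ y) y)
    (hdβ₃ : ∀ᶠ y in 𝓝 (0 : ℝ), HasDerivAt β₃ (δ y ^ 2 * deriv β₁ y) y) :
    ∃ (Φ : R2 → R2) (Ψ : R3 → R3), IsDiffeoGerm Φ 0 ∧ Φ 0 = 0 ∧ IsDiffeoGerm Ψ 0 ∧
      ∀ᶠ q in 𝓝 (0 : R2),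
        Ψ (α₁ q.1 + β₁ q.2, α₂ q.1 + β₂ q.2, α₃ q.1 + β₃ q.2) = fCBK (Φ q) := by
  have hdiff : ∀ f : ℝ → ℝ, ContDiff ℝ ∞ f → ∀ x, HasDerivAt f (deriv f x) x := fun f hf x =>
    (hf.differentiable (by simp) x).hasDerivAt
  have hβ₁' : ContDiff ℝ ∞ (deriv β₁) := (contDiff_infty_iff_deriv.1 hβ₁).2
  have hβ₁'' : ContDiff ℝ ∞ (deriv (deriv β₁)) := (contDiff_infty_iff_deriv.1 hβ₁').2
  obtain ⟨χ, hχ, hχ0, hχα, hαχ, hχ1⟩ := exists_inverse hα₁ hα₁0 hα₁1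
  -- a square root of `β₁`
  obtain ⟨κ, hκ, hκe, hκ0⟩ := exists_eq_pow_mul hβ₁'' 0 hβ₁1 (Eventually.of_forall fun r => by
    simpa using hdiff _ hβ₁' r)
  obtain ⟨k, hk, hke, hk0⟩ := exists_eq_pow_mul hκ 1 hβ₁0 (by
    filter_upwards [hκe] with r hr
    rw [zero_add] at hr
    rw [← hr]
    exact hdiff _ hβ₁ r)
  set ε := k 0 with hεdef
  have hε : ε ≠ 0 := by
    rw [hk0, hκ0]
    simpa using hβ₁2
  obtain ⟨ψ, hψ, hψ0, hψe⟩ := exists_contDiff_sqrt (f := fun y => k y / ε) (x₀ := 0) (by fun_prop)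
    (by rw [← hεdef, div_self hε]; exact one_pos)
  rw [← hεdef, div_self hε, Real.sqrt_one] at hψ0
  set ρ : ℝ → ℝ := fun y => y * ψ y with hρdef
  have hρ : ContDiff ℝ ∞ ρ := by fun_prop
  have hρ0 : ρ 0 = 0 := by simp [hρdef]
  have hρ1 : deriv ρ 0 ≠ 0 := by
    have h1 := (hasDerivAt_id (0 : ℝ)).fun_mul (hdiff ψ hψ 0)
    have h2 : deriv ρ 0 = 1 := by
      refine (h1.congr_deriv ?_).deriv
      simp [hψ0]
    rw [h2]; exact one_ne_zero
  obtain ⟨η, hη, hη0, hηρ, hρη, hη1⟩ := exists_inverse hρ hρ0 hρ1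
  have hβρ : ∀ᶠ y in 𝓝 (0 : ℝ), β₁ y = ε * ρ y ^ 2 := by
    filter_upwards [hke, hψe] with y h1 h2
    rw [h1]
    simp only [hρdef, mul_pow, h2]
    field_simp
    ring
  have hχt : Tendsto χ (𝓝 0) (𝓝 0) := by
    have := hχ.continuous.tendsto 0
    rwa [hχ0] at this
  have hηt : Tendsto η (𝓝 0) (𝓝 0) := by
    have := hη.continuous.tendsto 0
    rwa [hη0] at this
  have hβη : ∀ᶠ r in 𝓝 (0 : ℝ), β₁ (η r) = ε * r ^ 2 := by
    filter_upwards [hηt.eventually hβρ, hρη] with r h1 h2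
    rw [h1, h2]
  have hχd : ∀ᶠ s in 𝓝 (0 : ℝ), deriv α₁ (χ s) * deriv χ s = 1 := by
    filter_upwards [hαχ.eventually_nhds] with s hs
    exact ((hdiff _ hα₁ (χ s)).comp s (hdiff _ hχ s)).unique
      ((hasDerivAt_id s).congr_of_eventuallyEq hs)
  have hηd : ∀ᶠ r in 𝓝 (0 : ℝ), deriv β₁ (η r) * deriv η r = 2 * ε * r := by
    filter_upwards [hβη.eventually_nhds] with r hr
    refine ((hdiff _ hβ₁ (η r)).comp r (hdiff _ hη r)).unique
      ((((hasDerivAt_id r).fun_pow 2).const_mul ε).congr_of_eventuallyEq hr |>.congr_deriv ?_)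
    simp only [id, Nat.cast_ofNat, Nat.add_one_sub_one, pow_one, mul_one]
    ring
  have hdcomp : ∀ f g : ℝ → ℝ, ContDiff ℝ ∞ f → ContDiff ℝ ∞ g → g 0 = 0 → deriv f 0 ≠ 0 →
      deriv g 0 ≠ 0 → deriv (fun x => f (g x)) 0 ≠ 0 := by
    intro f g hf hg h0 h1 h2
    have := ((hdiff f hf (g 0)).comp (0 : ℝ) (hdiff g hg 0)).deriv
    rw [h0] at this
    change deriv (f ∘ g) 0 ≠ 0
    rw [this]
    exact mul_ne_zero h1 h2
  obtain ⟨Q, E, τ, S₀, S₁, R, v, hQ, hQ0, H⟩ := exists_edgeForm_of_primitives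
    (a := fun s => α₂ (χ s)) (b := fun s => α₃ (χ s)) (B₂ := fun r => β₂ (η r))
    (B₃ := fun r => β₃ (η r)) (g := fun s => γ (χ s)) (h := fun r => δ (η r)) (ε := ε)
    (by fun_prop) (by fun_prop) (by fun_prop) (by fun_prop) (by fun_prop) (by fun_prop) hε
    (by simp only [hχ0, hα₂0]) (by simp only [hχ0, hα₃0]) (by simp only [hη0, hβ₂0])
    (by simp only [hη0, hβ₃0]) (by simp only [hχ0, hγ0]) (by simp only [hη0, hδ0])
    (hdcomp γ χ hγ hχ hχ0 hγ1 hχ1) (hdcomp δ η hδ hη hη0 hδ1 hη1)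
    (by
      filter_upwards [hχt.eventually hdα₂, hχd] with s h1 h2
      exact (h1.comp s (hdiff _ hχ s)).congr_deriv (by linear_combination γ (χ s) * h2))
    (by
      filter_upwards [hχt.eventually hdα₃, hχd] with s h1 h2
      exact (h1.comp s (hdiff _ hχ s)).congr_deriv (by linear_combination γ (χ s) ^ 2 * h2))
    (by
      filter_upwards [hηt.eventually hdβ₂, hηd] with r h1 h2
      exact (h1.comp r (hdiff _ hη r)).congr_deriv (by linear_combination δ (η r) * h2))
    (by
      filter_upwards [hηt.eventually hdβ₃, hηd] with r h1 h2
      exact (h1.comp r (hdiff _ hη r)).congr_deriv (by linear_combination δ (η r) ^ 2 * h2))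
  obtain ⟨Φ, Ψ, hΦ, hΦ0, hΨ, hΨe⟩ := H.exists_fCBK_eq
  set θ : R2 → R2 := fun q => (α₁ q.1, ρ q.2) with hθdef
  have hθs : ContDiff ℝ ∞ θ := by fun_prop
  have hθ0 : θ 0 = 0 := by simp [hθdef, hα₁0, hρ0]
  have hθ : IsDiffeoGerm θ 0 := by
    refine isDiffeoGerm_of_injective hθs fun w hw => ?_
    have hline : HasDerivAt (fun t : ℝ => t • w) w 0 :=
      ((hasDerivAt_id (0 : ℝ)).smul_const w).congr_deriv (by simp)
    have h1 := hθs.hasDerivAt_comp hline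
    have k1 : HasDerivAt (fun t : ℝ => (t • w).1) w.1 0 := by
      simpa using (hasDerivAt_id (0 : ℝ)).mul_const w.1
    have k2 : HasDerivAt (fun t : ℝ => (t • w).2) w.2 0 := by
      simpa using (hasDerivAt_id (0 : ℝ)).mul_const w.2
    have h2 := h1.unique (((hdiff _ hα₁ _).comp (0 : ℝ) k1).prodMk
      ((hdiff _ hρ _).comp (0 : ℝ) k2))
    simp only [zero_smul, hw, Prod.fst_zero, Prod.snd_zero] at h2
    obtain ⟨h3, h4⟩ := Prod.ext_iff.1 h2
    exact Prod.ext ((mul_eq_zero.1 h3.symm).resolve_left hα₁1)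
      ((mul_eq_zero.1 h4.symm).resolve_left hρ1)
  refine ⟨fun q => Φ (θ q), fun q => Ψ (Q q), ?_, by simp only [hθ0, hΦ0], ?_, ?_⟩
  · exact IsDiffeoGerm.comp (by rwa [hθ0]) hθ
  · exact IsDiffeoGerm.comp (by rwa [hQ0]) hQ
  · have hθt : Tendsto θ (𝓝 0) (𝓝 0) := by
      have := hθs.continuous.tendsto 0
      rwa [hθ0] at this
    have h1 : Tendsto (fun q : R2 => q.1) (𝓝 0) (𝓝 0) := continuous_fst.tendsto (0 : R2)
    have h2 : Tendsto (fun q : R2 => q.2) (𝓝 0) (𝓝 0) := continuous_snd.tendsto (0 : R2)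
    filter_upwards [hθt.eventually hΨe, h1.eventually hχα, h2.eventually hηρ, h2.eventually hβρ]
      with q e1 e2 e3 e4
    rw [← e1]
    simp only [hθdef, e2, e3, e4]

end Sum

section Weierstrass

variable {f : R2 → R3} {g1 g2 w1 w2 : ℝ → ℝ}

theorem IsGTMS.hasDerivAt_fst (hf : IsGTMS f g1 g2 w1 w2) (u v : ℝ) :
    HasDerivAt (fun s => f (s, v)) (pu f (u, v)) u :=
  hf.smooth_f.hasDerivAt_comp ((hasDerivAt_id u).prodMk (hasDerivAt_const u v))

theorem IsGTMS.hasDerivAt_snd (hf : IsGTMS f g1 g2 w1 w2) (u v : ℝ) :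
    HasDerivAt (fun s => f (u, s)) (pv f (u, v)) v :=
  hf.smooth_f.hasDerivAt_comp ((hasDerivAt_const v u).prodMk (hasDerivAt_id v))

/-- A generalized timelike minimal surface is a sum of two curves. -/
theorem IsGTMS.eq_add (hf : IsGTMS f g1 g2 w1 w2) (p q : R2) :
    f q = f (q.1, p.2) + f (p.1, q.2) - f p := by
  have h : ∀ v, HasDerivAt (fun s => f (q.1, s) - f (p.1, s)) 0 v := by
    intro v
    have := (hf.hasDerivAt_snd q.1 v).fun_sub (hf.hasDerivAt_snd p.1 v)
    rw [hf.deriv_v, hf.deriv_v, sub_self] at this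
    exact this
  have h1 := is_const_of_deriv_eq_zero (fun v => (h v).differentiableAt) (fun v => (h v).deriv)
    q.2 p.2
  change f q - f (p.1, q.2) = f (q.1, p.2) - f p at h1
  rw [sub_eq_iff_eq_add] at h1
  rw [h1]; abel

/-- Linear coordinates in which the null curves of a timelike minimal surface
are tangent to `(1, g - m, (g - m)²)`. -/
def nullCoord (m : ℝ) (z : R3) : R3 :=
  (z.2.1 - z.1, z.2.2 - m * (z.2.1 - z.1),
    -(z.1 + z.2.1) - 2 * m * z.2.2 + m ^ 2 * (z.2.1 - z.1))

theorem contDiff_nullCoord (m : ℝ) : ContDiff ℝ ∞ (nullCoord m) := by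
  unfold nullCoord; fun_prop

theorem nullCoord_add (m : ℝ) (z z' : R3) :
    nullCoord m (z + z') = nullCoord m z + nullCoord m z' :=
  Prod.ext (by simp [nullCoord]; ring) (Prod.ext (by simp [nullCoord]; ring)
    (by simp [nullCoord]; ring))

theorem nullCoord_smul (m t : ℝ) (z : R3) : nullCoord m (t • z) = t • nullCoord m z :=
  Prod.ext (by simp [nullCoord]; ring) (Prod.ext (by simp [nullCoord]; ring)
    (by simp [nullCoord]; ring))

theorem nullCoord_eq_zero {m : ℝ} {z : R3} (h : nullCoord m z = 0) : z = 0 := by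
  simp only [nullCoord, Prod.ext_iff, Prod.fst_zero, Prod.snd_zero] at h
  obtain ⟨h1, h2, h3⟩ := h
  rw [h1, mul_zero, sub_zero] at h2
  rw [h1, h2] at h3
  refine Prod.ext ?_ (Prod.ext ?_ h2)
  · simp only [Prod.fst_zero]; linarith
  · simp only [Prod.fst_zero, Prod.snd_zero]; linarith

theorem HasDerivAt.nullCoord {c : ℝ → R3} {c' : R3} {t : ℝ} (m : ℝ) (hc : HasDerivAt c c' t) :
    HasDerivAt (fun t => nullCoord m (c t)) (nullCoord m c') t := by
  let L : R3 →ₗ[ℝ] R3 :=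
    { toFun := _root_.nullCoord m
      map_add' := nullCoord_add m
      map_smul' := nullCoord_smul m }
  exact (LinearMap.toContinuousLinearMap L).hasFDerivAt.comp_hasDerivAt t hc

theorem isDiffeoGerm_nullCoord (m : ℝ) (z₀ : R3) :
    IsDiffeoGerm (fun z => nullCoord m (z - z₀)) z₀ := by
  have hs : ContDiff ℝ ∞ fun z => nullCoord m (z - z₀) :=
    (contDiff_nullCoord m).comp (contDiff_id.sub contDiff_const)
  refine isDiffeoGerm_of_injective hs fun w hw => ?_
  have hline : HasDerivAt (fun t : ℝ => z₀ + t • w) w 0 :=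
    (((hasDerivAt_id (0 : ℝ)).smul_const w).const_add z₀).congr_deriv (by simp)
  have h1 := hs.hasDerivAt_comp hline
  rw [zero_smul, add_zero, hw] at h1
  exact nullCoord_eq_zero (((hline.sub_const z₀).nullCoord m).unique h1)

theorem isDiffeoGerm_sub (p : R2) : IsDiffeoGerm (fun q : R2 => q - p) p := by
  refine isDiffeoGerm_of_injective (by fun_prop) fun w hw => ?_
  have h : HasFDerivAt (fun q : R2 => q - p) (ContinuousLinearMap.id ℝ R2) p :=
    (hasFDerivAt_id p).sub_const p
  rwa [h.fderiv] at hw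

theorem IsGTMS.aEquiv_fCBK (hf : IsGTMS f g1 g2 w1 w2) {p : R2} (hw2 : w2 p.2 = 0)
    (hw1 : w1 p.1 ≠ 0) (hw2' : deriv w2 p.2 ≠ 0) (hg : g1 p.1 * g2 p.2 = 1)
    (hg' : deriv g1 p.1 * deriv g2 p.2 ≠ 0) : AEquiv f p fCBK (0, 0) := by
  have hdiff : ∀ f : ℝ → ℝ, ContDiff ℝ ∞ f → ∀ x, HasDerivAt f (deriv f x) x := fun f hf x =>
    (hf.differentiable (by simp) x).hasDerivAt
  have sf := hf.smooth_f
  have sg1 := hf.smooth_g1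
  have sg2 := hf.smooth_g2
  have sw1 := hf.smooth_w1
  have sw2 := hf.smooth_w2
  set m := g1 p.1 with hm
  have hg2 : g2 p.2 ≠ 0 := right_ne_zero_of_mul_eq_one hg
  set N : R3 → R3 := fun z => nullCoord m (z - f p) with hN
  have sN : ContDiff ℝ ∞ N := (contDiff_nullCoord m).comp (contDiff_id.sub contDiff_const)
  set a : ℝ → R3 := fun x => N (f (p.1 + x, p.2)) with ha
  set b : ℝ → R3 := fun y => N (f (p.1, p.2 + y)) with hb
  have sa : ContDiff ℝ ∞ a := by fun_prop
  have sb : ContDiff ℝ ∞ b := by fun_prop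
  have ha0 : a 0 = 0 := by simp [ha, hN, nullCoord]
  have hb0 : b 0 = 0 := by simp [hb, hN, nullCoord]
  have hda : ∀ x, HasDerivAt a (w1 (p.1 + x), (g1 (p.1 + x) - m) * w1 (p.1 + x),
      (g1 (p.1 + x) - m) ^ 2 * w1 (p.1 + x)) x := by
    intro x
    have h1 := ((hf.hasDerivAt_fst (p.1 + x) p.2).comp_const_add p.1 x).sub_const (f p)
    rw [hf.deriv_u] at h1
    refine (h1.nullCoord m).congr_deriv ?_
    refine Prod.ext ?_ (Prod.ext ?_ ?_) <;> simp only [nullCoord] <;> ring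
  have hdb : ∀ y, HasDerivAt b (-(w2 (p.2 + y) * g2 (p.2 + y) ^ 2),
      -(w2 (p.2 + y) * g2 (p.2 + y) * (1 - m * g2 (p.2 + y))),
      -(w2 (p.2 + y) * (1 - m * g2 (p.2 + y)) ^ 2)) y := by
    intro y
    have h1 := ((hf.hasDerivAt_snd p.1 (p.2 + y)).comp_const_add p.2 y).sub_const (f p)
    rw [hf.deriv_v] at h1
    refine (h1.nullCoord m).congr_deriv ?_
    refine Prod.ext ?_ (Prod.ext ?_ ?_) <;> simp only [nullCoord] <;> ring
  obtain ⟨i, si, hi⟩ := exists_contDiff_inv (f := fun y => g2 (p.2 + y)) (x₀ := 0) (by fun_prop)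
    (by simpa using hg2)
  have hi0 : i 0 * g2 p.2 = 1 := by simpa using hi.self_of_nhds
  have hfst : ∀ {c : ℝ → R3} {c' : R3} {t : ℝ}, HasDerivAt c c' t →
      HasDerivAt (fun t => (c t).1) c'.1 t := fun {_ _ t} h =>
    (ContinuousLinearMap.fst ℝ ℝ (ℝ × ℝ)).hasFDerivAt.comp_hasDerivAt t h
  have hsnd : ∀ {c : ℝ → R3} {c' : R3} {t : ℝ}, HasDerivAt c c' t →
      HasDerivAt (fun t => (c t).2) c'.2 t := fun {_ _ t} h =>
    (ContinuousLinearMap.snd ℝ ℝ (ℝ × ℝ)).hasFDerivAt.comp_hasDerivAt t h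
  have hfst2 : ∀ {c : ℝ → R3} {c' : R3} {t : ℝ}, HasDerivAt c c' t →
      HasDerivAt (fun t => (c t).2.1) c'.2.1 t := fun {_ _ t} h =>
    (ContinuousLinearMap.fst ℝ ℝ ℝ).hasFDerivAt.comp_hasDerivAt t (hsnd h)
  have hsnd2 : ∀ {c : ℝ → R3} {c' : R3} {t : ℝ}, HasDerivAt c c' t →
      HasDerivAt (fun t => (c t).2.2) c'.2.2 t := fun {_ _ t} h =>
    (ContinuousLinearMap.snd ℝ ℝ ℝ).hasFDerivAt.comp_hasDerivAt t (hsnd h)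
  have da1 : deriv (fun x => (a x).1) = fun x => w1 (p.1 + x) :=
    funext fun x => (hfst (hda x)).deriv
  have db1 : deriv (fun y => (b y).1) = fun y => -(w2 (p.2 + y) * g2 (p.2 + y) ^ 2) :=
    funext fun y => (hfst (hdb y)).deriv
  have dadd : ∀ (φ : ℝ → ℝ) (x₀ : ℝ), ContDiff ℝ ∞ φ →
      HasDerivAt (fun x => φ (x₀ + x)) (deriv φ x₀) 0 := by
    intro φ x₀ hφ
    have := (hdiff φ hφ (x₀ + 0)).comp_const_add x₀ 0
    rwa [add_zero] at this
  obtain ⟨Φ, Ψ, hΦ, hΦ0, hΨ, he⟩ := exists_fCBK_eq_of_sum (α₁ := fun x => (a x).1)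
    (α₂ := fun x => (a x).2.1) (α₃ := fun x => (a x).2.2) (β₁ := fun y => (b y).1)
    (β₂ := fun y => (b y).2.1) (β₃ := fun y => (b y).2.2) (γ := fun x => g1 (p.1 + x) - m)
    (δ := fun y => (1 - m * g2 (p.2 + y)) * i y) (by fun_prop) (by fun_prop) (by fun_prop)
    (by fun_prop) (by fun_prop) (by fun_prop) (by fun_prop) (by fun_prop)
    (by simp [ha0]) (by simp [ha0]) (by simp [ha0]) (by simp [hb0]) (by simp [hb0]) (by simp [hb0])
    (by simp [hm]) (by simp [hg])
    (by
      rw [((dadd g1 p.1 sg1).sub_const m).deriv]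
      exact left_ne_zero_of_mul hg')
    (by
      rw [((((dadd g2 p.2 sg2).const_mul m).const_sub 1).fun_mul (hdiff i si 0)).deriv, add_zero,
        hg, sub_self, zero_mul, add_zero]
      refine mul_ne_zero (neg_ne_zero.2 (mul_ne_zero (left_ne_zero_of_mul_eq_one hg)
        (right_ne_zero_of_mul hg'))) (left_ne_zero_of_mul_eq_one hi0))
    (by rw [da1]; simpa using hw1) (by rw [db1]; simp [hw2])
    (by
      rw [db1, (((dadd w2 p.2 sw2).fun_mul ((dadd g2 p.2 sg2).fun_pow 2)).fun_neg).deriv, add_zero,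
        hw2, zero_mul, add_zero]
      exact neg_ne_zero.2 (mul_ne_zero hw2' (pow_ne_zero 2 hg2)))
    (Eventually.of_forall fun x => by rw [da1]; exact hfst2 (hda x))
    (Eventually.of_forall fun x => by rw [da1]; exact hsnd2 (hda x))
    (by
      filter_upwards [hi] with y hy
      rw [db1]
      refine (hfst2 (hdb y)).congr_deriv ?_
      linear_combination (w2 (p.2 + y) * g2 (p.2 + y) * (1 - m * g2 (p.2 + y))) * hy)
    (by
      filter_upwards [hi] with y hy
      rw [db1]
      refine (hsnd2 (hdb y)).congr_deriv ?_
      linear_combination (w2 (p.2 + y) * (1 - m * g2 (p.2 + y)) ^ 2) *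
        (i y * g2 (p.2 + y) + 1) * hy)
  have hsum : ∀ q : R2, ((a q.1).1 + (b q.2).1, (a q.1).2.1 + (b q.2).2.1,
      (a q.1).2.2 + (b q.2).2.2) = N (f (p + q)) := by
    intro q
    have h1 : N (f (p + q)) = a q.1 + b q.2 := by
      simp only [ha, hb, hN, ← nullCoord_add]
      rw [hf.eq_add p (p + q)]
      congr 1
      simp only [Prod.fst_add, Prod.snd_add]
      abel
    rw [h1]; rfl
  have hNf : N (f p) = 0 := by simp [hN, nullCoord]
  have hpp : p - p = 0 := sub_self p
  refine ⟨fun q => Φ (q - p), fun z => Ψ (N z), IsDiffeoGerm.isLocalDiffeoAt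
    (IsDiffeoGerm.comp (by rwa [hpp]) (isDiffeoGerm_sub p)), by simp only [hpp, hΦ0]; rfl,
    IsDiffeoGerm.isLocalDiffeoAt
    (IsDiffeoGerm.comp (by simpa only [hN, hNf, hpp] using (hNf ▸ hΨ : IsDiffeoGerm Ψ (N (f p))))
      (isDiffeoGerm_nullCoord m (f p))), ?_, ?_⟩
  · have h1 := he.self_of_nhds
    rw [hsum, add_zero, hΦ0] at h1
    exact h1
  · have ht : Tendsto (fun q : R2 => q - p) (𝓝 p) (𝓝 0) := by
      have := (by fun_prop : Continuous fun q : R2 => q - p).tendsto p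
      rwa [hpp] at this
    filter_upwards [ht.eventually he] with q hq
    rw [hsum, add_sub_cancel] at hq
    exact hq

end Weierstrass

section Necessity

/-- The cross product of `ℝ³`. -/
def cross3 (x y : R3) : R3 :=
  (x.2.1 * y.2.2 - x.2.2 * y.2.1, x.2.2 * y.1 - x.1 * y.2.2, x.1 * y.2.1 - x.2.1 * y.1)

/-- The action of the cofactor matrix of `A` on `ℝ³`. -/
def cofactor3 (A : R3 →L[ℝ] R3) (n : R3) : R3 :=
  n.1 • cross3 (A (0, 1, 0)) (A (0, 0, 1)) + n.2.1 • cross3 (A (0, 0, 1)) (A (1, 0, 0)) +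
    n.2.2 • cross3 (A (1, 0, 0)) (A (0, 1, 0))

theorem cofactor3_add (A : R3 →L[ℝ] R3) (m n : R3) :
    cofactor3 A (m + n) = cofactor3 A m + cofactor3 A n := by
  simp only [cofactor3, Prod.fst_add, Prod.snd_add, add_smul]
  abel

theorem cofactor3_smul (A : R3 →L[ℝ] R3) (t : ℝ) (n : R3) :
    cofactor3 A (t • n) = t • cofactor3 A n := by
  simp only [cofactor3, Prod.smul_fst, Prod.smul_snd, smul_eq_mul, mul_smul, smul_add]

theorem cross3_map (A : R3 →L[ℝ] R3) (x y : R3) :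
    cross3 (A x) (A y) = cofactor3 A (cross3 x y) := by
  have h : ∀ z : R3, A z = z.1 • A (1, 0, 0) + z.2.1 • A (0, 1, 0) + z.2.2 • A (0, 0, 1) := by
    intro z
    simp only [← map_smul, ← map_add]
    congr 1
    ext <;> simp
  rw [h x, h y]
  simp only [cofactor3, cross3]
  ext <;> simp <;> ring

theorem cofactor3_ne_zero {A C : R3 →L[ℝ] R3} (h : ∀ z, C (A z) = z) {n : R3} (hn : n ≠ 0) :
    cofactor3 A n ≠ 0 := by
  intro h0
  apply hn
  have h1 : cofactor3 C (cofactor3 A n) = n := by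
    rw [cofactor3.eq_1 A n, cofactor3_add, cofactor3_add, cofactor3_smul, cofactor3_smul, cofactor3_smul,
      ← cross3_map, ← cross3_map, ← cross3_map, h, h, h]
    ext <;> simp [cross3]
  rw [← h1, h0]
  simp [cofactor3]

variable {E F : Type*} [NormedAddCommGroup E] [NormedSpace ℝ E] [NormedAddCommGroup F]
  [NormedSpace ℝ F]

theorem IsLocalDiffeoAt.eventually_differentiableAt {Φ : E → F} {p : E}
    (h : IsLocalDiffeoAt Φ p) : ∀ᶠ q in 𝓝 p, DifferentiableAt ℝ Φ q := by
  obtain ⟨U, V, Φ', hU, hp, -, -, hΦ, -⟩ := h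
  filter_upwards [hU.mem_nhds hp] with q hq
  exact (hΦ.differentiableOn (by simp)).differentiableAt (hU.mem_nhds hq)

theorem IsLocalDiffeoAt.continuousAt_fderiv {Φ : E → F} {p : E} (h : IsLocalDiffeoAt Φ p) :
    ContinuousAt (fderiv ℝ Φ) p := by
  obtain ⟨U, V, Φ', hU, hp, -, -, hΦ, -⟩ := h
  exact (hΦ.continuousOn_fderiv_of_isOpen hU (by simp)).continuousAt (hU.mem_nhds hp)

theorem IsLocalDiffeoAt.exists_leftInverse_fderiv {Φ : E → F} {p : E}
    (h : IsLocalDiffeoAt Φ p) : ∃ C : F →L[ℝ] E, ∀ z, C (fderiv ℝ Φ p z) = z := by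
  have hd := h.eventually_differentiableAt.self_of_nhds
  obtain ⟨U, V, Φ', hU, hp, hV, hpV, -, hΦ', -, -, hl, -⟩ := h
  have hd' : DifferentiableAt ℝ Φ' (Φ p) :=
    (hΦ'.differentiableOn (by simp)).differentiableAt (hV.mem_nhds hpV)
  refine ⟨fderiv ℝ Φ' (Φ p), fun z => ?_⟩
  have h1 := hd'.hasFDerivAt.comp p hd.hasFDerivAt
  have h2 : HasFDerivAt (Φ' ∘ Φ) (ContinuousLinearMap.id ℝ E) p :=
    (hasFDerivAt_id p).congr_of_eventuallyEq
      (by filter_upwards [hU.mem_nhds hp] with q hq using hl q hq)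
  exact congrArg (fun L : E →L[ℝ] E => L z) (h1.unique h2)

theorem contDiff_fCBK : ContDiff ℝ ∞ fCBK := by
  unfold fCBK; fun_prop

theorem fderiv_fCBK (q x : R2) : fderiv ℝ fCBK q x = (x.2,
    (3 * q.1 ^ 2 - q.2 ^ 2) * x.1 - 2 * q.1 * q.2 * x.2,
    4 * q.1 * (3 * q.1 ^ 2 - q.2 ^ 2) * x.1 - 4 * q.1 ^ 2 * q.2 * x.2) := by
  have hu : HasDerivAt (fun t : ℝ => q.1 + t * x.1) x.1 0 :=
    (((hasDerivAt_id (0 : ℝ)).mul_const x.1).const_add q.1).congr_deriv (one_mul _)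
  have hv : HasDerivAt (fun t : ℝ => q.2 + t * x.2) x.2 0 :=
    (((hasDerivAt_id (0 : ℝ)).mul_const x.2).const_add q.2).congr_deriv (one_mul _)
  have h1 := contDiff_fCBK.hasDerivAt_comp (hu.prodMk hv)
  simp only [zero_mul, add_zero] at h1
  refine h1.unique ?_
  refine (hv.prodMk (((hu.fun_pow 3).fun_sub (hu.fun_mul (hv.fun_pow 2))).prodMk
    (((hu.fun_pow 4).const_mul 3).fun_sub
      (((hu.fun_pow 2).const_mul 2).fun_mul (hv.fun_pow 2))))).congr_deriv ?_
  refine Prod.ext rfl (Prod.ext ?_ ?_) <;> simp <;> ring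

theorem cross3_fderiv_fCBK (q x y : R2) :
    cross3 (fderiv ℝ fCBK q x) (fderiv ℝ fCBK q y) =
      (det2 x y * (3 * q.1 ^ 2 - q.2 ^ 2)) • (4 * q.1 ^ 2 * q.2, 4 * q.1, -1) := by
  rw [fderiv_fCBK, fderiv_fCBK]
  refine Prod.ext ?_ (Prod.ext ?_ ?_) <;> simp [cross3, det2] <;> ring

variable {f : R2 → R3} {g1 g2 w1 w2 : ℝ → ℝ}

/-- Up to a nonvanishing factor, the signed area density of a timelike minimal surface. -/
def density (g1 g2 w1 w2 : ℝ → ℝ) (q : R2) : ℝ := w1 q.1 * w2 q.2 * (1 - g1 q.1 * g2 q.2)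

theorem IsGTMS.cross3_partial (hf : IsGTMS f g1 g2 w1 w2) (q : R2) :
    cross3 (pu f q) (pv f q) = density g1 g2 w1 w2 q •
      (-(g1 q.1 + g2 q.2) / 2, (g1 q.1 - g2 q.2) / 2, -(1 + g1 q.1 * g2 q.2) / 2) := by
  rw [hf.deriv_u, hf.deriv_v]
  refine Prod.ext ?_ (Prod.ext ?_ ?_) <;> simp [cross3, density] <;> ring

theorem map_prod_eq_smul_add_smul (L : R2 →L[ℝ] R2) (s t : ℝ) : L (s, t) = s • L (1, 0) + t • L (0, 1) := by
  simp only [← map_smul, ← map_add]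
  congr 1
  ext <;> simp

/-- Along rays, the density of a cuspidal beaks singularity is asymptotic to a
nondegenerate indefinite quadratic form. -/
theorem IsGTMS.exists_tendsto_density (hf : IsGTMS f g1 g2 w1 w2) {p : R2} (hw2 : w2 p.2 = 0)
    (h : AEquiv f p fCBK (0, 0)) :
    ∃ κ a b k : ℝ, κ ≠ 0 ∧ b ≠ 0 ∧ k ≠ 0 ∧ w1 p.1 ≠ 0 ∧ ∀ s t : ℝ,
      Tendsto (fun τ : ℝ => density g1 g2 w1 w2 (p.1 + τ * s, p.2 + τ * t) / τ ^ 2) (𝓝[≠] 0)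
        (𝓝 (κ * (3 * (s * a + t * k) ^ 2 - (s * b) ^ 2))) := by
  obtain ⟨Φ, Ψ, hΦ, hΦp, hΨ, -, he⟩ := h
  have cf : ContinuousAt f p := hf.smooth_f.continuous.continuousAt
  -- the chain rule
  have hchain : ∀ᶠ q in 𝓝 p, ∀ x, fderiv ℝ Ψ (f q) (fderiv ℝ f q x) =
      fderiv ℝ fCBK (Φ q) (fderiv ℝ Φ q x) := by
    filter_upwards [he.eventually_nhds, hΦ.eventually_differentiableAt,
      cf.eventually hΨ.eventually_differentiableAt] with q hq h1 h2 x
    have d1 := h2.hasFDerivAt.comp q (hf.smooth_f.differentiable (by simp) q).hasFDerivAt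
    have d2 := ((contDiff_fCBK.differentiable (by simp) (Φ q)).hasFDerivAt).comp q h1.hasFDerivAt
    exact congrArg (fun L : R2 →L[ℝ] R3 => L x) (d1.unique (d2.congr_of_eventuallyEq hq))
  obtain ⟨C, hC⟩ := hΦ.exists_leftInverse_fderiv
  obtain ⟨C', hC'⟩ := hΨ.exists_leftInverse_fderiv
  have hinj : ∀ x, fderiv ℝ Φ p x = 0 → x = 0 := fun x hx => by rw [← hC x, hx, map_zero]
  -- the differential of the change of parameters
  obtain ⟨a, b, hab⟩ : ∃ a b, fderiv ℝ Φ p (1, 0) = (a, b) := ⟨_, _, rfl⟩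
  obtain ⟨k, k', hk⟩ : ∃ k k', fderiv ℝ Φ p (0, 1) = (k, k') := ⟨_, _, rfl⟩
  have hk' : k' = 0 := by
    have h1 := hchain.self_of_nhds (0, 1)
    rw [← pv, hf.deriv_v, hw2, hk, fderiv_fCBK] at h1
    simpa [Prod.mk_zero_zero] using (congrArg Prod.fst h1).symm
  subst hk'
  have hk0 : k ≠ 0 := by
    rintro rfl
    simpa using hinj _ hk
  have hb0 : b ≠ 0 := by
    rintro rfl
    have h1 := hinj (k, -a) (by rw [map_prod_eq_smul_add_smul, hab, hk]; ext <;> simp; ring)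
    exact hk0 (congrArg Prod.fst h1)
  have hw1 : w1 p.1 ≠ 0 := by
    intro h0
    have h1 := hchain.self_of_nhds (1, 0)
    rw [← pu, hf.deriv_u, h0, hab, fderiv_fCBK] at h1
    exact hb0 (by simpa [Prod.mk_zero_zero] using (congrArg Prod.fst h1).symm)
  -- comparison of the cross products of the partial derivatives
  set n : R2 → R3 := fun q =>
    (-(g1 q.1 + g2 q.2) / 2, (g1 q.1 - g2 q.2) / 2, -(1 + g1 q.1 * g2 q.2) / 2) with hn
  set K : R2 → R3 := fun q => cofactor3 (fderiv ℝ Ψ (f q)) (n q) with hK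
  set δ : R2 → ℝ := fun q => det2 (fderiv ℝ Φ q (1, 0)) (fderiv ℝ Φ q (0, 1)) with hδ
  have hcross : ∀ᶠ q in 𝓝 p, density g1 g2 w1 w2 q • K q =
      (δ q * (3 * (Φ q).1 ^ 2 - (Φ q).2 ^ 2)) • (4 * (Φ q).1 ^ 2 * (Φ q).2, 4 * (Φ q).1, -1) := by
    filter_upwards [hchain] with q hq
    rw [← cross3_fderiv_fCBK, ← hq, ← hq, cross3_map, ← cofactor3_smul, ← hf.cross3_partial]
    rfl
  have c1 := hf.smooth_g1.continuous
  have c2 := hf.smooth_g2.continuous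
  have cn : Continuous n := by fun_prop
  have cA : ContinuousAt (fun q => fderiv ℝ Ψ (f q)) p :=
    ContinuousAt.comp (f := f) hΨ.continuousAt_fderiv cf
  have cAx : ∀ x, ContinuousAt (fun q => fderiv ℝ Ψ (f q) x) p := fun x =>
    cA.clm_apply continuousAt_const
  have cK : ContinuousAt K p := by
    have e1 := cAx (1, 0, 0)
    have e2 := cAx (0, 1, 0)
    have e3 := cAx (0, 0, 1)
    have := cn.continuousAt (x := p)
    simp only [hK, cofactor3, cross3]
    fun_prop
  have cδ : ContinuousAt δ p := by
    have e1 : ContinuousAt (fun q => fderiv ℝ Φ q (1, 0)) p :=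
      hΦ.continuousAt_fderiv.clm_apply continuousAt_const
    have e2 : ContinuousAt (fun q => fderiv ℝ Φ q (0, 1)) p :=
      hΦ.continuousAt_fderiv.clm_apply continuousAt_const
    simp only [hδ, det2]
    fun_prop
  have hδp : δ p = -(b * k) := by simp [hδ, det2, hab, hk]
  have hKp : K p ≠ 0 := by
    refine cofactor3_ne_zero hC' fun h0 => ?_
    simp only [hn, Prod.ext_iff, Prod.fst_zero, Prod.snd_zero] at h0
    obtain ⟨h1, h2, h3⟩ := h0
    have h4 : g1 p.1 = 0 := by linarith
    rw [h4] at h3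
    norm_num at h3
  -- asymptotics along rays
  have hray : ∀ s t : ℝ, Tendsto (fun τ : ℝ => (p.1 + τ * s, p.2 + τ * t)) (𝓝[≠] 0) (𝓝 p) := by
    intro s t
    have hc : Continuous fun τ : ℝ => (p.1 + τ * s, p.2 + τ * t) := by fun_prop
    have := hc.tendsto 0
    simp only [zero_mul, add_zero] at this
    exact this.mono_left nhdsWithin_le_nhds
  have hlimΦ : ∀ s t : ℝ, Tendsto (fun τ : ℝ => τ⁻¹ • Φ (p.1 + τ * s, p.2 + τ * t)) (𝓝[≠] 0)
      (𝓝 (s * a + t * k, s * b)) := by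
    intro s t
    have hline : HasDerivAt (fun τ : ℝ => (p.1 + τ * s, p.2 + τ * t)) (s, t) 0 :=
      ((((hasDerivAt_id (0 : ℝ)).mul_const s).const_add p.1).prodMk
        (((hasDerivAt_id (0 : ℝ)).mul_const t).const_add p.2)).congr_deriv (by simp)
    have hd : HasFDerivAt Φ (fderiv ℝ Φ p) (p.1 + 0 * s, p.2 + 0 * t) := by
      simpa using hΦ.eventually_differentiableAt.self_of_nhds.hasFDerivAt
    have h1 := (hd.comp_hasDerivAt 0 hline).tendsto_slope_zero
    have h2 : fderiv ℝ Φ p (s, t) = (s * a + t * k, s * b) := by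
      rw [map_prod_eq_smul_add_smul, hab, hk]; ext <;> simp
    rw [h2] at h1
    simpa [hΦp, Prod.mk_zero_zero] using h1
  have hlim : ∀ s t : ℝ, Tendsto (fun τ : ℝ =>
      density g1 g2 w1 w2 (p.1 + τ * s, p.2 + τ * t) / τ ^ 2 *
        (K (p.1 + τ * s, p.2 + τ * t)).2.2) (𝓝[≠] 0)
      (𝓝 (b * k * (3 * (s * a + t * k) ^ 2 - (s * b) ^ 2))) := by
    intro s t
    have h1 := (cδ.tendsto.comp (hray s t)).neg
    have h2 := (((hlimΦ s t).fst_nhds.pow 2).const_mul 3).sub ((hlimΦ s t).snd_nhds.pow 2)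
    have h3 := h1.mul h2
    rw [hδp, neg_neg] at h3
    refine h3.congr' ?_
    filter_upwards [(hray s t).eventually hcross] with τ hτ
    have h4 := congrArg (fun z : R3 => z.2.2) hτ
    simp only [Prod.smul_snd, smul_eq_mul] at h4
    simp only [Function.comp, Prod.smul_fst, Prod.smul_snd, smul_eq_mul]
    rw [div_mul_eq_mul_div, h4]
    ring
  have hK2 : (K p).2.2 ≠ 0 := by
    obtain ⟨s, t, hst⟩ : ∃ s t : ℝ, b * k * (3 * (s * a + t * k) ^ 2 - (s * b) ^ 2) ≠ 0 :=
      ⟨0, 1, by simp [hb0, hk0]⟩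
    have hcK := cK.tendsto.comp (hray s t)
    have hcΦ : Tendsto (fun τ : ℝ => Φ (p.1 + τ * s, p.2 + τ * t)) (𝓝[≠] 0) (𝓝 (0, 0)) := by
      have := hΦ.eventually_differentiableAt.self_of_nhds.continuousAt.tendsto.comp (hray s t)
      rwa [hΦp] at this
    have hev := (hlim s t).eventually_ne hst
    have e1 : (K p).1 = 0 := by
      refine tendsto_nhds_unique hcK.fst_nhds ?_
      have h1 := (((hcΦ.fst_nhds.pow 2).const_mul (-4)).mul hcΦ.snd_nhds).mul
        hcK.snd_nhds.snd_nhds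
      simp only [mul_zero, zero_mul] at h1
      refine h1.congr' ?_
      filter_upwards [(hray s t).eventually hcross, hev] with τ hτ hne
      have hd : density g1 g2 w1 w2 (p.1 + τ * s, p.2 + τ * t) ≠ 0 := fun h0 => hne (by simp [h0])
      have h4 := congrArg (fun z : R3 => z.2.2) hτ
      have h5 := congrArg (fun z : R3 => z.1) hτ
      simp only [Prod.smul_snd, Prod.smul_fst, smul_eq_mul] at h4 h5
      refine mul_left_cancel₀ hd ?_
      simp only [Function.comp]
      linear_combination (-4 * (Φ (p.1 + τ * s, p.2 + τ * t)).1 ^ 2 *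
        (Φ (p.1 + τ * s, p.2 + τ * t)).2) * h4 - h5
    have e2 : (K p).2.1 = 0 := by
      refine tendsto_nhds_unique hcK.snd_nhds.fst_nhds ?_
      have h1 := (hcΦ.fst_nhds.const_mul (-4)).mul hcK.snd_nhds.snd_nhds
      simp only [mul_zero, zero_mul] at h1
      refine h1.congr' ?_
      filter_upwards [(hray s t).eventually hcross, hev] with τ hτ hne
      have hd : density g1 g2 w1 w2 (p.1 + τ * s, p.2 + τ * t) ≠ 0 := fun h0 => hne (by simp [h0])
      have h4 := congrArg (fun z : R3 => z.2.2) hτ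
      have h5 := congrArg (fun z : R3 => z.2.1) hτ
      simp only [Prod.smul_snd, Prod.smul_fst, smul_eq_mul] at h4 h5
      refine mul_left_cancel₀ hd ?_
      simp only [Function.comp]
      linear_combination (-4 * (Φ (p.1 + τ * s, p.2 + τ * t)).1) * h4 - h5
    intro e3
    exact hKp (Prod.ext e1 (Prod.ext e2 e3))
  refine ⟨b * k / (K p).2.2, a, b, k, div_ne_zero (mul_ne_zero hb0 hk0) hK2, hb0, hk0, hw1,
    fun s t => ?_⟩
  have hcK := (cK.tendsto.comp (hray s t)).snd_nhds.snd_nhds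
  have h1 := (hlim s t).div hcK hK2
  rw [div_mul_eq_mul_div]
  refine h1.congr' ?_
  filter_upwards [hcK.eventually_ne hK2] with τ hτ
  exact mul_div_cancel_right₀ _ hτ

theorem IsGTMS.of_aEquiv_fCBK (hf : IsGTMS f g1 g2 w1 w2) {p : R2} (hw2 : w2 p.2 = 0)
    (h : AEquiv f p fCBK (0, 0)) : w1 p.1 ≠ 0 ∧ deriv w2 p.2 ≠ 0 ∧ g1 p.1 * g2 p.2 = 1 ∧
      deriv g1 p.1 * deriv g2 p.2 ≠ 0 := by
  obtain ⟨κ, a, b, k, hκ, hb, hk, hw1, hlim⟩ := hf.exists_tendsto_density hw2 h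
  have hdiff : ∀ φ : ℝ → ℝ, ContDiff ℝ ∞ φ → ∀ x s, HasDerivAt (fun τ => φ (x + τ * s))
      (deriv φ x * s) 0 := by
    intro φ hφ x s
    have h1 : HasDerivAt φ (deriv φ x) (x + 0 * s) := by
      simpa using (hφ.differentiable (by simp) x).hasDerivAt
    exact h1.comp 0 ((((hasDerivAt_id (0 : ℝ)).mul_const s).const_add x).congr_deriv (one_mul s))
  have hcont : ∀ φ : ℝ → ℝ, ContDiff ℝ ∞ φ → ∀ x s, Tendsto (fun τ => φ (x + τ * s))
      (𝓝[≠] 0) (𝓝 (φ x)) := by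
    intro φ hφ x s
    have h1 := (hdiff φ hφ x s).continuousAt.tendsto.mono_left (nhdsWithin_le_nhds (s := {0}ᶜ))
    simpa using h1
  have hslope : ∀ s, Tendsto (fun τ => w2 (p.2 + τ * s) / τ) (𝓝[≠] 0) (𝓝 (deriv w2 p.2 * s)) := by
    intro s
    have h1 := (hdiff w2 hf.smooth_w2 p.2 s).tendsto_slope_zero
    simpa [hw2, div_eq_inv_mul] using h1
  have h3 : 3 * a ^ 2 - b ^ 2 = 0 := by
    have h1 := tendsto_nhds_unique (hlim 1 0) (tendsto_const_nhds.congr (f₁ := fun _ => (0 : ℝ))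
      fun τ => by simp [density, hw2])
    simpa [hκ] using h1
  have ha : a ≠ 0 := by
    rintro rfl
    exact hb (by simpa using h3)
  have hne : κ * (3 * (1 * a + 1 * k) ^ 2 - (1 * b) ^ 2) ≠
      κ * (3 * (0 * a + 1 * k) ^ 2 - (0 * b) ^ 2) := by
    intro h0
    have h1 := mul_left_cancel₀ hκ h0
    have h2 : a * k = 0 := by linear_combination h1 / 6 - h3 / 6
    exact mul_ne_zero ha hk h2
  have hne0 : κ * (3 * (0 * a + 1 * k) ^ 2 - (0 * b) ^ 2) ≠ 0 := by
    simp [hκ, hk]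
  have hg : g1 p.1 * g2 p.2 = 1 := by
    by_contra hg
    have hA : w1 p.1 * (1 - g1 p.1 * g2 p.2) ≠ 0 := mul_ne_zero hw1 (sub_ne_zero.2 (Ne.symm hg))
    have hfac : ∀ s, Tendsto (fun τ : ℝ => w1 (p.1 + τ * s) *
        (1 - g1 (p.1 + τ * s) * g2 (p.2 + τ * 1))) (𝓝[≠] 0)
        (𝓝 (w1 p.1 * (1 - g1 p.1 * g2 p.2))) := fun s =>
      (hcont w1 hf.smooth_w1 p.1 s).mul
        (((hcont g1 hf.smooth_g1 p.1 s).mul (hcont g2 hf.smooth_g2 p.2 1)).const_sub 1)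
    have hquot : ∀ s, Tendsto (fun τ : ℝ => w2 (p.2 + τ * 1) / τ ^ 2) (𝓝[≠] 0)
        (𝓝 (κ * (3 * (s * a + 1 * k) ^ 2 - (s * b) ^ 2) / (w1 p.1 * (1 - g1 p.1 * g2 p.2)))) := by
      intro s
      refine ((hlim s 1).div (hfac s) hA).congr' ?_
      filter_upwards [(hfac s).eventually_ne hA] with τ hτ
      change density g1 g2 w1 w2 (p.1 + τ * s, p.2 + τ * 1) / τ ^ 2 / _ = _
      rw [div_eq_iff hτ]
      simp only [density]
      ring
    exact hne ((div_left_inj' hA).1 (tendsto_nhds_unique (hquot 1) (hquot 0)))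
  have hval : ∀ s, κ * (3 * (s * a + 1 * k) ^ 2 - (s * b) ^ 2) =
      w1 p.1 * deriv w2 p.2 * -(deriv g1 p.1 * s * g2 p.2 + g1 p.1 * deriv g2 p.2) := by
    intro s
    have h1 := (((hdiff g1 hf.smooth_g1 p.1 s).fun_mul
      (hdiff g2 hf.smooth_g2 p.2 1)).const_sub 1).tendsto_slope_zero
    have h2 := ((hcont w1 hf.smooth_w1 p.1 s).mul (hslope 1)).mul h1
    refine tendsto_nhds_unique (hlim s 1) ?_
    simp only [zero_add, zero_mul, add_zero, mul_one, hg, sub_self, sub_zero, smul_eq_mul] at h2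
    refine h2.congr fun τ => ?_
    simp only [density, mul_one]
    ring
  rw [hval 1, hval 0] at hne
  rw [hval 0] at hne0
  refine ⟨hw1, fun h0 => hne0 (by simp [h0]), hg, mul_ne_zero (fun h0 => hne (by simp [h0]))
    fun h0 => hne0 (by simp [h0])⟩

end Necessity

/-- criterion for cuspidal beaks at an ω-singular point. -/
theorem criterion_cuspidal_beaks
    (f : R2 → R3) (g1 g2 w1 w2 : ℝ → ℝ) (hf : IsGTMS f g1 g2 w1 w2)
    (p : R2) (hw2 : w2 p.2 = 0) :
    AEquiv f p fCBK (0, 0) ↔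
      (w1 p.1 ≠ 0 ∧ deriv w2 p.2 ≠ 0 ∧ g1 p.1 * g2 p.2 = 1 ∧
        deriv g1 p.1 * deriv g2 p.2 ≠ 0) := by
  refine ⟨hf.of_aEquiv_fCBK hw2, ?_⟩
  rintro ⟨hw1, hw2', hg, hg'⟩
  exact hf.aEquiv_fCBK hw2 hw1 hw2' hg hg'
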